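/- Let f be a transcendental entire function in the Eremenko–Lyubich class B, let N, m ∈ ℕ, and suppose that for some R > 0 the set A_R = {z ∈ ℂ : |f(z)| > R} has exactly N connected components. If log log M(r,f) ≤ (N/2 + 1/log^m(r)) log r for all sufficiently large r, where log^m denotes the m-th iterate of the logarithm, then the escaping set I(f) has positive two-dimensional Lebesgue measure. -/

import Mathlib

open MeasureTheory Filter Topology

/-- The maximum modulus `M(r,f) = max_{|z|=r} |f(z)|`. -/
noncomputable def maxModulus (f : ℂ → ℂ) (r : ℝ) : ℝ :=
  sSup ((fun z => ‖f z‖) '' Metric.sphere (0 : ℂ) r)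

/-- An entire function is transcendental if it is not a polynomial. -/
def TranscendentalEntire (f : ℂ → ℂ) : Prop :=
  Differentiable ℂ f ∧ ¬ ∃ p : Polynomial ℂ, ∀ z, f z = p.eval z

/-- The set of critical values of `f`. -/
def criticalValues (f : ℂ → ℂ) : Set ℂ :=
  {w | ∃ z, deriv f z = 0 ∧ f z = w}

/-- The set of finite asymptotic values of `f`. -/
def asymptoticValues (f : ℂ → ℂ) : Set ℂ :=
  {a | ∃ γ : ℝ → ℂ, Continuous γ ∧
    Tendsto (fun t => ‖γ t‖) atTop atTop ∧
    Tendsto (fun t => f (γ t)) atTop (nhds a)}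

/-- The Eremenko–Lyubich class `B`. -/
def InClassB (f : ℂ → ℂ) : Prop :=
  TranscendentalEntire f ∧
  Bornology.IsBounded (criticalValues f ∪ asymptoticValues f)

/-- The escaping set `I(f)`. -/
def escapingSet (f : ℂ → ℂ) : Set ℂ :=
  {z | Tendsto (fun n => ‖f^[n] z‖) atTop atTop}

/-- The set of connected components of `A_R = {z : |f(z)| > R}`. -/
def componentsAR (f : ℂ → ℂ) (R : ℝ) : Set (Set ℂ) :=
  {S | ∃ z, R < ‖f z‖ ∧
    S = connectedComponentIn {w : ℂ | R < ‖f w‖} z}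

/-- The area formula for injective holomorphic maps. -/
theorem volume_image_eq_lintegral_norm_deriv_sq {ψ : ℂ → ℂ} {s : Set ℂ} (hs : MeasurableSet s)
    (hd : ∀ z ∈ s, DifferentiableAt ℂ ψ z) (hinj : Set.InjOn ψ s) :
    volume (ψ '' s) = ∫⁻ z in s, ENNReal.ofReal (‖deriv ψ z‖ ^ 2) := by
  rw [← lintegral_abs_det_fderiv_eq_addHaar_image volume hs
    (fun x hx => ((hd x hx).hasFDerivAt.restrictScalars ℝ).hasFDerivWithinAt) hinj]
  refine lintegral_congr fun z => ?_
  congr 1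
  simp [ContinuousLinearMap.det, LinearMap.det_restrictScalars, Algebra.norm_complex_eq,
    Complex.normSq_eq_norm_sq]

/-- If `|1/g - b| ≤ M` on a circle about a zero of `g`, then every value omitted by `1/g` inside
the circle lies in the disc of radius `M` about `b`. -/
theorem norm_omitted_sub_le {g : ℂ → ℂ} {ρ M : ℝ} {b v : ℂ} (hρ : 0 < ρ)
    (hg : DifferentiableOn ℂ g (Metric.closedBall 0 ρ)) (hg0 : g 0 = 0)
    (hgs : ∀ z ∈ Metric.sphere (0 : ℂ) ρ, g z ≠ 0)
    (hM : ∀ z ∈ Metric.sphere (0 : ℂ) ρ, ‖(g z)⁻¹ - b‖ ≤ M)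
    (hv : ∀ z ∈ Metric.closedBall (0 : ℂ) ρ, 1 - v * g z ≠ 0) : ‖v - b‖ ≤ M := by
  by_contra! hlt
  have hM0 : 0 ≤ M := (norm_nonneg _).trans (hM (ρ : ℂ) (by simp [abs_of_pos hρ]))
  have hd : DifferentiableOn ℂ (fun z => Complex.exp ((1 - b * g z) / (1 - v * g z)))
      (Metric.closedBall 0 ρ) := by
    refine DifferentiableOn.cexp (DifferentiableOn.div ?_ ?_ hv)
    · exact (differentiableOn_const _).sub ((differentiableOn_const _).mul hg)
    · exact (differentiableOn_const _).sub ((differentiableOn_const _).mul hg)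
  have hfr : ∀ z ∈ frontier (Metric.ball (0 : ℂ) ρ),
      ‖Complex.exp ((1 - b * g z) / (1 - v * g z))‖ ≤ Real.exp (1 / 2) := by
    intro z hz
    rw [frontier_ball _ hρ.ne'] at hz
    have h1 := hgs z hz
    have h2 := hM z hz
    have h3 := hv z (Metric.sphere_subset_closedBall hz)
    rw [Complex.norm_exp]
    refine Real.exp_le_exp.2 ?_
    set w := (g z)⁻¹ with hw
    have hgw : g z = w⁻¹ := by simp [hw]
    have hw0 : w ≠ 0 := inv_ne_zero h1
    have hwv : w - v ≠ 0 := by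
      intro h
      apply h3
      rw [hgw, ← sub_eq_zero.1 h, mul_inv_cancel₀ hw0, sub_self]
    have : (1 - b * g z) / (1 - v * g z) = (w - b) / (w - v) := by
      rw [hgw]; field_simp
    rw [this]
    have hn : Complex.normSq (w - b) ≤ Complex.normSq (v - b) := by
      rw [Complex.normSq_eq_norm_sq, Complex.normSq_eq_norm_sq]
      exact pow_le_pow_left₀ (norm_nonneg _) (h2.trans hlt.le) 2
    have hp : 0 < Complex.normSq (w - v) := Complex.normSq_pos.2 hwv
    rw [Complex.div_re, ← add_div, div_le_iff₀ hp]
    simp only [Complex.normSq_apply, Complex.sub_re, Complex.sub_im] at hn ⊢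
    nlinarith
  have key := Complex.norm_le_of_forall_mem_frontier_norm_le (U := Metric.ball (0 : ℂ) ρ)
    Metric.isBounded_ball
    (DifferentiableOn.diffContOnCl (by rwa [closure_ball _ hρ.ne'])) hfr
    (z := 0) (subset_closure (Metric.mem_ball_self hρ))
  rw [hg0, Complex.norm_exp] at key
  have := Real.exp_le_exp.1 key
  norm_num at this

/-- Integration over an annulus in polar coordinates. -/
theorem setIntegral_annulus_eq {F : ℂ → ℝ} {ρ r : ℝ} (hρ : 0 < ρ) (hρr : ρ ≤ r)
    (hF : ContinuousOn F {z | ρ ≤ ‖z‖ ∧ ‖z‖ ≤ r}) :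
    ∫ z in {z : ℂ | ρ < ‖z‖ ∧ ‖z‖ < r}, F z =
      ∫ t in ρ..r, 2 * Real.pi * t * Real.circleAverage F 0 t := by
  have hmeas : MeasurableSet {z : ℂ | ρ < ‖z‖ ∧ ‖z‖ < r} :=
    (measurableSet_lt measurable_const measurable_norm).inter
      (measurableSet_lt measurable_norm measurable_const)
  have hsymm : ∀ p : ℝ × ℝ, Complex.polarCoord.symm p = circleMap 0 p.1 p.2 := by
    intro p
    simp [circleMap, Complex.exp_mul_I]
  have hcont : ContinuousOn (fun p : ℝ × ℝ => p.1 * F (circleMap 0 p.1 p.2))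
      (Set.Icc ρ r ×ˢ Set.univ) := by
    refine continuousOn_fst.mul (hF.comp ?_ ?_)
    · exact Continuous.continuousOn (by unfold circleMap; fun_prop)
    · rintro ⟨t, θ⟩ ⟨⟨h1, h2⟩, -⟩
      simp only [norm_circleMap_zero, Set.mem_ofPred_eq]
      rw [abs_of_nonneg (hρ.le.trans h1)]
      exact ⟨h1, h2⟩
  rw [← integral_indicator hmeas, ← Complex.integral_comp_polarCoord_symm]
  have h1 : ∫ p in polarCoord.target, p.1 • Set.indicator {z : ℂ | ρ < ‖z‖ ∧ ‖z‖ < r} F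
      (Complex.polarCoord.symm p) =
      ∫ p in Set.Ioo ρ r ×ˢ Set.Ioo (-Real.pi) Real.pi, p.1 * F (circleMap 0 p.1 p.2) := by
    rw [← integral_indicator (polarCoord.open_target.measurableSet),
      ← integral_indicator (measurableSet_Ioo.prod measurableSet_Ioo)]
    congr 1
    ext ⟨t, θ⟩
    simp only [hsymm]
    by_cases hθ : θ ∈ Set.Ioo (-Real.pi) Real.pi
    · by_cases ht : 0 < t
      · by_cases hh : t ∈ Set.Ioo ρ r
        · rw [Set.indicator_of_mem (by exact ⟨ht, hθ⟩),
            Set.indicator_of_mem (by simpa [abs_of_pos ht] using hh),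
            Set.indicator_of_mem (by exact ⟨hh, hθ⟩), smul_eq_mul]
        · rw [Set.indicator_of_mem (by exact ⟨ht, hθ⟩),
            Set.indicator_of_notMem (by simpa [abs_of_pos ht] using hh),
            Set.indicator_of_notMem (by exact fun h => hh h.1), smul_zero]
      · rw [Set.indicator_of_notMem (by exact fun h => ht h.1),
          Set.indicator_of_notMem (by exact fun h => ht (hρ.trans h.1.1))]
    · rw [Set.indicator_of_notMem (by exact fun h => hθ h.2),
          Set.indicator_of_notMem (by exact fun h => hθ h.2)]
  rw [h1, Measure.volume_eq_prod, setIntegral_prod]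
  · rw [intervalIntegral.integral_of_le hρr, ← integral_Ioc_eq_integral_Ioo]
    refine setIntegral_congr_fun measurableSet_Ioc fun t ht => ?_
    simp only
    rw [← integral_Ioc_eq_integral_Ioo, integral_const_mul,
      ← intervalIntegral.integral_of_le (by linarith [Real.pi_pos]),
      Real.circleAverage_eq_integral_add (-Real.pi), smul_eq_mul]
    have : ∫ θ in (0:ℝ)..2 * Real.pi, F (circleMap 0 t (θ + -Real.pi)) =
        ∫ θ in (-Real.pi)..Real.pi, F (circleMap 0 t θ) := by
      rw [intervalIntegral.integral_comp_add_right (fun θ => F (circleMap 0 t θ))]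
      congr 1 <;> ring
    rw [this]
    field_simp
  · refine IntegrableOn.mono_set
      ((hcont.mono (Set.prod_mono subset_rfl (Set.subset_univ _))).integrableOn_compact
      (isCompact_Icc.prod (isCompact_Icc (a := -Real.pi) (b := Real.pi)))) ?_
    exact Set.prod_mono Set.Ioo_subset_Icc_self Set.Ioo_subset_Icc_self

theorem circleAverage_norm_sq_neg_inv_sq_add {p : ℂ → ℂ} {t : ℝ} (ht : 0 < t)
    (hp : DifferentiableOn ℂ p (Metric.closedBall 0 t)) :
    Real.circleAverage (fun z => ‖-(z ^ 2)⁻¹ + p z‖ ^ 2) 0 t =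
      t⁻¹ ^ 4 + Real.circleAverage (fun z => ‖p z‖ ^ 2) 0 t := by
  have hs : Metric.sphere (0 : ℂ) |t| ⊆ Metric.closedBall 0 t := by
    rw [abs_of_pos ht]; exact Metric.sphere_subset_closedBall
  have hpc : ContinuousOn p (Metric.sphere 0 |t|) := hp.continuousOn.mono hs
  have hq : CircleIntegrable (fun z => z ^ 2 * p z) 0 t :=
    ContinuousOn.circleIntegrable' (by fun_prop)
  have hqr : CircleIntegrable (fun z => (z ^ 2 * p z).re) 0 t :=
    ContinuousOn.circleIntegrable' (by
      exact Complex.continuous_re.comp_continuousOn (by fun_prop))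
  have hn : CircleIntegrable (fun z => ‖p z‖ ^ 2) 0 t :=
    ContinuousOn.circleIntegrable' (by fun_prop)
  have h0 : Real.circleAverage (fun z => z ^ 2 * p z) 0 t = 0 := by
    rw [circleAverage_of_differentiable_on_off_countable (s := ∅) Set.countable_empty]
    · simp
    · rw [abs_of_pos ht]
      exact ContinuousOn.mul (by fun_prop) hp.continuousOn
    · intro z hz
      rw [abs_of_pos ht] at hz
      refine DifferentiableAt.mul (by fun_prop) (hp.differentiableAt ?_)
      exact Filter.mem_of_superset (Metric.isOpen_ball.mem_nhds hz.1) Metric.ball_subset_closedBall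
  have h0r : Real.circleAverage (fun z => (z ^ 2 * p z).re) 0 t = 0 := by
    have := Complex.reCLM.circleAverage_comp_comm hq
    rw [h0] at this
    simpa [Function.comp_def] using this
  have : Real.circleAverage (fun z => ‖-(z ^ 2)⁻¹ + p z‖ ^ 2) 0 t =
      Real.circleAverage
        (fun z => (t⁻¹ ^ 4 + ‖p z‖ ^ 2) + (-2 * t⁻¹ ^ 4) • (z ^ 2 * p z).re) 0 t := by
    apply Real.circleAverage_congr_sphere
    intro z hz
    rw [abs_of_pos ht] at hz
    have hzt : ‖z‖ = t := by simpa using hz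
    have hz2 : Complex.normSq (z ^ 2) = t ^ 4 := by
      rw [Complex.normSq_eq_norm_sq, norm_pow, hzt]; ring
    simp only [← Complex.normSq_eq_norm_sq, smul_eq_mul]
    rw [add_comm, ← sub_eq_add_neg, Complex.normSq_sub, Complex.normSq_inv, hz2, map_inv₀,
      Complex.inv_def, Complex.normSq_conj, hz2, Complex.conj_conj, inv_pow]
    have : (p z * (z ^ 2 * ((t ^ 4)⁻¹ : ℝ))).re = (t ^ 4)⁻¹ * (z ^ 2 * p z).re := by
      rw [← mul_assoc, mul_comm (p z), Complex.re_mul_ofReal, mul_comm]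
    rw [this]
    ring
  rw [this, Real.circleAverage_fun_add, Real.circleAverage_fun_add,
    Real.circleAverage_fun_smul, h0r]
  · simp [Real.circleAverage_const]
  · exact circleIntegrable_const _ _ _
  · exact hn
  · exact (circleIntegrable_const _ _ _).add hn
  · exact hqr.const_smul

theorem integral_annulus_norm_sq_neg_inv_sq_add {p : ℂ → ℂ} {ρ : ℝ} (hρ : 0 < ρ) (hρ2 : ρ ≤ 1 / 2)
    (hp : DifferentiableOn ℂ p (Metric.ball 0 1)) :
    Real.pi * (ρ⁻¹ ^ 2 - 16 / 9) +
      ∫ t in (1 / 2 : ℝ)..(3 / 4), 2 * Real.pi * t * Real.circleAverage (fun z => ‖p z‖ ^ 2) 0 t ≤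
    ∫ z in {z : ℂ | ρ < ‖z‖ ∧ ‖z‖ < 3 / 4}, ‖-(z ^ 2)⁻¹ + p z‖ ^ 2 := by
  have hpc := hp.continuousOn
  have hsub : {z : ℂ | ρ ≤ ‖z‖ ∧ ‖z‖ ≤ 3 / 4} ⊆ Metric.ball 0 1 := by
    rintro z ⟨-, h⟩
    simp only [Metric.mem_ball, dist_zero_right]; linarith
  rw [setIntegral_annulus_eq hρ (by linarith)]
  swap
  · refine ((ContinuousOn.neg (ContinuousOn.inv₀ (by fun_prop) ?_)).add (hpc.mono hsub)).norm.pow 2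
    rintro z ⟨h, -⟩
    exact pow_ne_zero _ (norm_pos_iff.1 (hρ.trans_le h))
  have hAc : ContinuousOn (Real.circleAverage (fun z => ‖p z‖ ^ 2) 0) (Set.Ico 0 1) := by
    refine Real.ContinuousOn.circleAverage ((hpc.norm.pow 2).mono ?_) fun r hr => hr.1
    rintro z ⟨-, h⟩
    simpa using h
  have hBc : ContinuousOn (fun t => 2 * Real.pi * t * Real.circleAverage (fun z => ‖p z‖ ^ 2) 0 t)
      (Set.Ico 0 1) := ContinuousOn.mul (by fun_prop) hAc
  have hBi : ∀ a b : ℝ, 0 ≤ a → a ≤ b → b < 1 → IntervalIntegrable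
      (fun t => 2 * Real.pi * t * Real.circleAverage (fun z => ‖p z‖ ^ 2) 0 t) volume a b := by
    intro a b ha hab hb
    refine ContinuousOn.intervalIntegrable (hBc.mono ?_)
    rw [Set.uIcc_of_le hab]
    exact fun t ht => ⟨ha.trans ht.1, ht.2.trans_lt hb⟩
  have h0 : (0 : ℝ) ∉ Set.uIcc ρ (3 / 4) := by
    rw [Set.uIcc_of_le (by linarith)]; exact fun h => by linarith [h.1]
  have hz : IntervalIntegrable (fun t : ℝ => 2 * Real.pi * t ^ (-3 : ℤ)) volume ρ (3 / 4) :=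
    (intervalIntegral.intervalIntegrable_zpow (Or.inr h0)).const_mul _
  have hcongr : ∫ t in ρ..(3 / 4), 2 * Real.pi * t *
        Real.circleAverage (fun z => ‖-(z ^ 2)⁻¹ + p z‖ ^ 2) 0 t =
      ∫ t in ρ..(3 / 4), (2 * Real.pi * t ^ (-3 : ℤ) +
        2 * Real.pi * t * Real.circleAverage (fun z => ‖p z‖ ^ 2) 0 t) := by
    refine intervalIntegral.integral_congr fun t ht => ?_
    rw [Set.uIcc_of_le (by linarith)] at ht
    have ht0 : 0 < t := hρ.trans_le ht.1
    rw [circleAverage_norm_sq_neg_inv_sq_add ht0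
      (hp.mono (Metric.closedBall_subset_ball (by linarith [ht.2]))), mul_add]
    congr 1
    rw [zpow_neg]
    have : t ^ (3 : ℤ) = t ^ 3 := by norm_cast
    rw [this]
    field_simp
  rw [hcongr, intervalIntegral.integral_add hz (hBi _ _ hρ.le (by linarith) (by norm_num)),
    intervalIntegral.integral_const_mul, integral_zpow (Or.inr ⟨by norm_num, h0⟩),
    ← intervalIntegral.integral_add_adjacent_intervals (hBi ρ (1 / 2) hρ.le hρ2 (by norm_num))
      (hBi (1 / 2) (3 / 4) (by norm_num) (by norm_num) (by norm_num))]
  have hnn : 0 ≤ ∫ t in ρ..(1 / 2),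
      2 * Real.pi * t * Real.circleAverage (fun z => ‖p z‖ ^ 2) 0 t := by
    refine intervalIntegral.integral_nonneg hρ2 fun t ht => ?_
    have : 0 ≤ Real.circleAverage (fun z => ‖p z‖ ^ 2) 0 t :=
      Real.circleAverage_nonneg_of_nonneg fun z _ => by positivity
    have := hρ.le.trans ht.1
    have := Real.pi_pos
    positivity
  have e : 2 * Real.pi * (((3 / 4 : ℝ) ^ (-3 + 1 : ℤ) - ρ ^ (-3 + 1 : ℤ)) / ((-3 : ℤ) + 1)) =
      Real.pi * (ρ⁻¹ ^ 2 - 16 / 9) := by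
    have h1 : (ρ : ℝ) ^ (-3 + 1 : ℤ) = ρ⁻¹ ^ 2 := by
      rw [show (-3 + 1 : ℤ) = -2 by norm_num, zpow_neg, inv_pow]; norm_cast
    have h2 : (3 / 4 : ℝ) ^ (-3 + 1 : ℤ) = 16 / 9 := by norm_num [zpow_neg]
    rw [h1, h2]; push_cast; ring
  rw [e]
  linarith

theorem norm_circleAverage_le_circleAverage_norm {F : ℂ → ℂ} {c : ℂ} {r : ℝ} :
    ‖Real.circleAverage F c r‖ ≤ Real.circleAverage (fun z => ‖F z‖) c r := by
  rw [Real.circleAverage, Real.circleAverage, norm_smul, Real.norm_of_nonneg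
    (by have := Real.pi_pos; positivity), smul_eq_mul]
  gcongr
  exact intervalIntegral.norm_integral_le_integral_norm (by have := Real.pi_pos; positivity)

/-- Area theorem with a non-sharp constant: if `1/z + m` is injective in the punctured unit disc,
then `m'` is bounded on the disc of radius `1/4`. -/
theorem norm_deriv_le_of_injOn_inv_add {g m : ℂ → ℂ} (hg : DifferentiableOn ℂ g (Metric.ball 0 1))
    (hinj : Set.InjOn g (Metric.ball 0 1)) (hg0 : g 0 = 0)
    (hm : DifferentiableOn ℂ m (Metric.ball 0 1))
    (hgm : ∀ z ∈ Metric.ball (0 : ℂ) 1, z ≠ 0 → (g z)⁻¹ = z⁻¹ + m z) :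
    ∀ z ∈ Metric.closedBall (0 : ℂ) (1 / 4), ‖deriv m z‖ ≤ 20 := by
  set p := deriv m with hpdef
  have hp : DifferentiableOn ℂ p (Metric.ball 0 1) := hm.deriv Metric.isOpen_ball
  have hgne : ∀ z ∈ Metric.ball (0 : ℂ) 1, z ≠ 0 → g z ≠ 0 := fun z hz hz0 h =>
    hz0 (hinj hz (Metric.mem_ball_self one_pos) (h.trans hg0.symm))
  set S := ‖p 0‖ + 1 with hS
  have hS0 : 0 < S := by positivity
  obtain ⟨ρ, hρ, hρ2, hρS, hpS⟩ : ∃ ρ : ℝ, 0 < ρ ∧ ρ ≤ 1 / 2 ∧ ρ * S ≤ 1 ∧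
      ∀ z ∈ Metric.closedBall (0 : ℂ) ρ, ‖p z‖ ≤ S := by
    have hc : ContinuousAt (fun z => ‖p z‖) 0 :=
      (hp.continuousOn.continuousAt (Metric.ball_mem_nhds 0 one_pos)).norm
    have := hc.eventually (gt_mem_nhds (lt_add_one ‖p 0‖))
    obtain ⟨δ, hδ, h⟩ := Metric.eventually_nhds_iff_ball.1 this
    refine ⟨min (δ / 2) (min (1 / 2) S⁻¹), by positivity, ?_, ?_, ?_⟩
    · exact (min_le_right _ _).trans (min_le_left _ _)
    · calc _ ≤ S⁻¹ * S := by gcongr; exact (min_le_right _ _).trans (min_le_right _ _)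
        _ = 1 := by field_simp
    · intro z hz
      refine (h z ?_).le
      have h1 := Metric.mem_closedBall.1 hz
      have := min_le_left (δ / 2) (min (1 / 2) S⁻¹)
      exact Metric.mem_ball.2 (by linarith)
  have hmS : ∀ z ∈ Metric.closedBall (0 : ℂ) ρ, ‖m z - m 0‖ ≤ S * ρ := by
    intro z hz
    have := Convex.norm_image_sub_le_of_norm_deriv_le (f := m) (C := S)
      (s := Metric.closedBall (0 : ℂ) ρ) (x := 0) (y := z)
      (fun x hx => hm.differentiableAt (Metric.isOpen_ball.mem_nhds
        (Metric.closedBall_subset_ball (by linarith) hx))) hpS (convex_closedBall _ _)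
      (Metric.mem_closedBall_self hρ.le) hz
    refine this.trans ?_
    gcongr
    simpa using hz
  have hsub : Metric.closedBall (0 : ℂ) ρ ⊆ Metric.ball 0 1 :=
    Metric.closedBall_subset_ball (by linarith)
  set Ann := {z : ℂ | ρ < ‖z‖ ∧ ‖z‖ < 3 / 4} with hAnn
  have hAsub : ∀ z ∈ Ann, z ∈ Metric.ball (0 : ℂ) 1 ∧ z ≠ 0 := by
    rintro z ⟨h1, h2⟩
    refine ⟨by simp; linarith, norm_pos_iff.1 (hρ.trans h1)⟩
  have hmaps : (fun z => (g z)⁻¹) '' Ann ⊆ Metric.closedBall (m 0) (ρ⁻¹ + S * ρ) := by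
    rintro _ ⟨z, hz, rfl⟩
    obtain ⟨hz1, hz0⟩ := hAsub z hz
    rw [Metric.mem_closedBall, dist_eq_norm]
    refine norm_omitted_sub_le hρ (hg.mono hsub) hg0 ?_ ?_ ?_
    · intro w hw
      exact hgne w (hsub (Metric.sphere_subset_closedBall hw))
        (Metric.ne_of_mem_sphere hw hρ.ne')
    · intro w hw
      rw [hgm w (hsub (Metric.sphere_subset_closedBall hw)) (Metric.ne_of_mem_sphere hw hρ.ne'),
        add_sub_assoc]
      refine (norm_add_le _ _).trans (add_le_add ?_ (hmS w (Metric.sphere_subset_closedBall hw)))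
      rw [norm_inv, mem_sphere_zero_iff_norm.1 hw]
    · intro w hw h
      have hgz := hgne z hz1 hz0
      have : g w = g z := by
        field_simp at h
        rw [mul_zero] at h
        exact (sub_eq_zero.1 h).symm
      have hwz := hinj (hsub hw) hz1 this
      have h1 := mem_closedBall_zero_iff.1 hw
      rw [hwz] at h1
      exact absurd hz.1 (not_lt.2 h1)
  have hderiv : ∀ z ∈ Ann, HasDerivAt (fun z => (g z)⁻¹) (-(z ^ 2)⁻¹ + p z) z := by
    intro z hz
    obtain ⟨hz1, hz0⟩ := hAsub z hz
    have h1 : HasDerivAt (fun z => z⁻¹ + m z) (-(z ^ 2)⁻¹ + p z) z :=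
      (hasDerivAt_inv hz0).add
        (hm.differentiableAt (Metric.isOpen_ball.mem_nhds hz1)).hasDerivAt
    refine h1.congr_of_eventuallyEq ?_
    filter_upwards [Metric.isOpen_ball.mem_nhds hz1, isOpen_ne.mem_nhds hz0] with w hw hw0
    exact hgm w hw hw0
  have hmeas : MeasurableSet Ann :=
    (measurableSet_lt measurable_const measurable_norm).inter
      (measurableSet_lt measurable_norm measurable_const)
  have harea : ∫⁻ z in Ann, ENNReal.ofReal (‖-(z ^ 2)⁻¹ + p z‖ ^ 2) ≤
      ENNReal.ofReal (Real.pi * (ρ⁻¹ + S * ρ) ^ 2) := by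
    have e1 := volume_image_eq_lintegral_norm_deriv_sq hmeas
      (fun z hz => (hderiv z hz).differentiableAt)
      (fun z hz w hw h => hinj (hAsub z hz).1 (hAsub w hw).1 (inv_injective h))
    rw [setLIntegral_congr_fun hmeas (fun z hz => by
      rw [(hderiv z hz).deriv])] at e1
    rw [← e1]
    refine (measure_mono hmaps).trans ?_
    rw [Complex.volume_closedBall, mul_comm, ENNReal.ofReal_mul Real.pi_pos.le,
      ENNReal.ofReal_pow (by positivity)]
    gcongr
    rw [← NNReal.coe_real_pi, ENNReal.ofReal_coe_nnreal]
  have hInt : ∫ z in Ann, ‖-(z ^ 2)⁻¹ + p z‖ ^ 2 ≤ Real.pi * (ρ⁻¹ + S * ρ) ^ 2 := by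
    have hcont : ContinuousOn (fun z => ‖-(z ^ 2)⁻¹ + p z‖ ^ 2) Ann := by
      refine ((ContinuousOn.neg (ContinuousOn.inv₀ (by fun_prop) ?_)).add
        (hp.continuousOn.mono fun z hz => (hAsub z hz).1)).norm.pow 2
      exact fun z hz => pow_ne_zero _ (hAsub z hz).2
    rw [integral_eq_lintegral_of_nonneg_ae (Eventually.of_forall fun z => by positivity)
      (hcont.aestronglyMeasurable hmeas)]
    exact ENNReal.toReal_le_of_le_ofReal (by positivity) harea
  have hmain := (integral_annulus_norm_sq_neg_inv_sq_add hρ hρ2 hp).trans hInt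
  set A := Real.circleAverage (fun z => ‖p z‖ ^ 2) 0 with hA
  obtain ⟨t, ht, hAt⟩ : ∃ t ∈ Set.Icc (1 / 2 : ℝ) (3 / 4), A t ≤ 20 + 8 * ‖p 0‖ := by
    by_contra! hcon
    have hAc : ContinuousOn A (Set.Icc (1 / 2) (3 / 4)) := by
      refine Real.ContinuousOn.circleAverage ((hp.continuousOn.norm.pow 2).mono ?_)
        fun r hr => by linarith [hr.1]
      rintro z ⟨-, h⟩
      simp only [sub_zero] at h
      simp only [Metric.mem_ball, dist_zero_right]; linarith
    have hlow : ∫ t in (1 / 2 : ℝ)..(3 / 4), Real.pi * (20 + 8 * ‖p 0‖) ≤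
        ∫ t in (1 / 2 : ℝ)..(3 / 4), 2 * Real.pi * t * A t := by
      refine intervalIntegral.integral_mono_on (by norm_num) (by simp) ?_ ?_
      · refine ContinuousOn.intervalIntegrable ?_
        rw [Set.uIcc_of_le (by norm_num)]
        exact ContinuousOn.mul (by fun_prop) hAc
      · intro t ht
        have := (hcon t ht).le
        have h3 : Real.pi ≤ 2 * Real.pi * t := by nlinarith [ht.1, Real.pi_pos]
        gcongr
        exact Real.pi_pos.le.trans h3
    rw [intervalIntegral.integral_const, smul_eq_mul] at hlow
    have hsq : (ρ⁻¹ + S * ρ) ^ 2 ≤ ρ⁻¹ ^ 2 + 2 * S + 1 := by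
      have : ρ⁻¹ * ρ = 1 := by field_simp
      have h2 : (S * ρ) ^ 2 ≤ 1 := by
        rw [mul_comm]; exact pow_le_one₀ (by positivity) hρS
      calc (ρ⁻¹ + S * ρ) ^ 2 = ρ⁻¹ ^ 2 + 2 * S * (ρ⁻¹ * ρ) + (S * ρ) ^ 2 := by ring
        _ ≤ _ := by rw [this]; linarith
    have h4 := mul_le_mul_of_nonneg_left hsq Real.pi_pos.le
    nlinarith [Real.pi_pos, norm_nonneg (p 0)]
  have ht0 : 0 < t := by linarith [ht.1]
  have hball : Metric.closedBall (0 : ℂ) t ⊆ Metric.ball 0 1 :=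
    Metric.closedBall_subset_ball (by linarith [ht.2])
  have hpt : DiffContOnCl ℂ p (Metric.ball 0 t) :=
    DifferentiableOn.diffContOnCl (by rw [closure_ball _ ht0.ne']; exact hp.mono hball)
  have hsph : Metric.sphere (0 : ℂ) |t| ⊆ Metric.ball 0 1 := by
    rw [abs_of_pos ht0]; exact Metric.sphere_subset_closedBall.trans hball
  have hci : CircleIntegrable (fun z => ‖p z‖) 0 t :=
    ContinuousOn.circleIntegrable' (hp.continuousOn.mono hsph).norm
  have hci2 : CircleIntegrable (fun z => ‖p z‖ ^ 2) 0 t :=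
    ContinuousOn.circleIntegrable' ((hp.continuousOn.mono hsph).norm.pow 2)
  have havg : ∀ c : ℝ, 0 < c → Real.circleAverage (fun z => ‖p z‖) 0 t ≤ (A t / c + c) / 2 := by
    intro c hc
    have h1 : Real.circleAverage (fun z => (2 * c)⁻¹ • ‖p z‖ ^ 2 + c / 2) 0 t =
        (A t / c + c) / 2 := by
      rw [Real.circleAverage_fun_add (f₁ := fun z => (2 * c)⁻¹ • ‖p z‖ ^ 2) hci2.const_smul
        (circleIntegrable_const _ _ _), Real.circleAverage_fun_smul, Real.circleAverage_const,
        smul_eq_mul]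
      field_simp
      rfl
    rw [← h1]
    refine Real.circleAverage_mono hci (hci2.const_smul.add (circleIntegrable_const _ _ _)) ?_
    intro z _
    rw [smul_eq_mul]
    have : (2 * c)⁻¹ * ‖p z‖ ^ 2 + c / 2 - ‖p z‖ = (2 * c)⁻¹ * (‖p z‖ - c) ^ 2 := by
      field_simp; ring
    have : 0 ≤ (2 * c)⁻¹ * (‖p z‖ - c) ^ 2 := by positivity
    linarith
  have hmean : ‖p 0‖ ≤ Real.circleAverage (fun z => ‖p z‖) 0 t := by
    rw [← abs_of_pos ht0] at hpt
    rw [← hpt.circleAverage]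
    exact norm_circleAverage_le_circleAverage_norm
  have hP : ‖p 0‖ ≤ 10 := by
    by_contra! h
    have h1 := hmean.trans (havg ‖p 0‖ (by linarith))
    have h2 : A t / ‖p 0‖ < ‖p 0‖ := by
      rw [div_lt_iff₀ (by linarith)]
      nlinarith
    linarith
  have havg10 : Real.circleAverage (fun z => ‖p z‖) 0 t ≤ 10 := by
    have := havg 10 (by norm_num)
    linarith
  intro z hz
  have hz' : ‖z‖ ≤ 1 / 4 := by simpa using hz
  have hzt : z ∈ Metric.ball (0 : ℂ) |t| := by
    rw [abs_of_pos ht0, mem_ball_zero_iff]; linarith [ht.1]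
  rw [← abs_of_pos ht0] at hpt
  have hq := hpt.circleAverage_smul_div hzt
  rw [← hq]
  refine norm_circleAverage_le_circleAverage_norm.trans ?_
  have hle : ∀ w ∈ Metric.sphere (0 : ℂ) |t|, 0 < ‖w - z‖ ∧ ‖w - 0‖ ≤ 2 * ‖w - z‖ := by
    intro w hw
    rw [abs_of_pos ht0, mem_sphere_zero_iff_norm] at hw
    have := norm_sub_norm_le w z
    rw [sub_zero]
    constructor <;> linarith [ht.1]
  have h2 : Real.circleAverage (fun w => (2 : ℝ) • ‖p w‖) 0 t ≤ 20 := by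
    rw [Real.circleAverage_fun_smul, smul_eq_mul]; linarith
  refine le_trans (Real.circleAverage_mono ?_ hci.const_smul ?_) h2
  · refine ContinuousOn.circleIntegrable' (ContinuousOn.norm ?_)
    refine ContinuousOn.smul (f := fun w => (w - 0) / (w - z))
      (ContinuousOn.div (by fun_prop) (by fun_prop) ?_) (hp.continuousOn.mono hsph)
    exact fun w hw => norm_pos_iff.1 (hle w hw).1
  · intro w hw
    obtain ⟨h1, h3⟩ := hle w hw
    rw [norm_smul, norm_div, Pi.smul_apply, smul_eq_mul]
    gcongr
    rwa [div_le_iff₀ h1]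

/-- A holomorphic injection with non-vanishing derivative. -/
def Univalent (g : ℂ → ℂ) (U : Set ℂ) : Prop :=
  DifferentiableOn ℂ g U ∧ Set.InjOn g U ∧ ∀ z ∈ U, deriv g z ≠ 0

theorem Univalent.mono {g : ℂ → ℂ} {U V : Set ℂ} (h : Univalent g U) (hVU : V ⊆ U) :
    Univalent g V :=
  ⟨h.1.mono hVU, h.2.1.mono hVU, fun z hz => h.2.2 z (hVU hz)⟩

theorem exists_inv_eq_inv_add {g : ℂ → ℂ} (hg : DifferentiableOn ℂ g (Metric.ball 0 1))
    (hinj : Set.InjOn g (Metric.ball 0 1)) (hg0 : g 0 = 0) (hg1 : deriv g 0 = 1) :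
    ∃ m : ℂ → ℂ, DifferentiableOn ℂ m (Metric.ball 0 1) ∧
      (∀ z ∈ Metric.ball (0 : ℂ) 1, z ≠ 0 → (g z)⁻¹ = z⁻¹ + m z) ∧
      deriv (deriv g) 0 = -2 * m 0 := by
  have h0 : Metric.ball (0 : ℂ) 1 ∈ 𝓝 0 := Metric.ball_mem_nhds 0 one_pos
  set P := dslope g 0 with hP
  have hPd : DifferentiableOn ℂ P (Metric.ball 0 1) := (Complex.differentiableOn_dslope h0).2 hg
  have hgP : ∀ z, g z = z * P z := by
    intro z
    have := sub_smul_dslope g 0 z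
    simpa [hg0] using this.symm
  have hP0 : P 0 = 1 := by rw [hP, dslope_same, hg1]
  have hPne : ∀ z ∈ Metric.ball (0 : ℂ) 1, P z ≠ 0 := by
    intro z hz h
    rcases eq_or_ne z 0 with rfl | hz0
    · simp [hP0] at h
    · refine hz0 (hinj hz (Metric.mem_ball_self one_pos) ?_)
      rw [hg0, hgP, h, mul_zero]
  have hud : DifferentiableOn ℂ (fun z => (P z)⁻¹) (Metric.ball 0 1) := hPd.inv hPne
  refine ⟨dslope (fun z => (P z)⁻¹) 0, (Complex.differentiableOn_dslope h0).2 hud, ?_, ?_⟩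
  · intro z hz hz0
    have := sub_smul_dslope (fun z => (P z)⁻¹) 0 z
    rw [hP0, inv_one, sub_zero, smul_eq_mul] at this
    rw [hgP, mul_inv]
    have e : (P z)⁻¹ = 1 + z * dslope (fun z => (P z)⁻¹) 0 z := by rw [this]; ring
    rw [e]; field_simp
  · have hPat : DifferentiableAt ℂ P 0 := hPd.differentiableAt h0
    have hP'at : DifferentiableAt ℂ (deriv P) 0 :=
      (hPd.deriv Metric.isOpen_ball).differentiableAt h0
    have h1 : deriv g =ᶠ[𝓝 0] fun z => P z + z * deriv P z := by
      filter_upwards [h0] with z hz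
      have : HasDerivAt (fun z => z * P z) (1 * P z + z * deriv P z) z :=
        (hasDerivAt_id z).mul (hPd.differentiableAt (Metric.isOpen_ball.mem_nhds hz)).hasDerivAt
      rw [show g = fun z => z * P z from funext hgP, this.deriv, one_mul]
    have h2 : HasDerivAt (fun z => P z + z * deriv P z)
        (deriv P 0 + (1 * deriv P 0 + 0 * deriv (deriv P) 0)) 0 :=
      hPat.hasDerivAt.add ((hasDerivAt_id (0 : ℂ)).mul hP'at.hasDerivAt)
    have h3 : HasDerivAt (fun z => (P z)⁻¹) (-deriv P 0 / P 0 ^ 2) 0 :=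
      hPat.hasDerivAt.inv (by simp [hP0])
    rw [h1.deriv_eq, h2.deriv, dslope_same, h3.deriv, hP0]
    ring

theorem norm_inv_omitted_add_le {g : ℂ → ℂ} (hg : DifferentiableOn ℂ g (Metric.ball 0 1))
    (hinj : Set.InjOn g (Metric.ball 0 1)) (hg0 : g 0 = 0) (hg1 : deriv g 0 = 1) {v : ℂ}
    (hv : ∀ z ∈ Metric.ball (0 : ℂ) 1, 1 - v * g z ≠ 0) :
    ‖2 * v + deriv (deriv g) 0‖ ≤ 18 := by
  obtain ⟨m, hm, hgm, hm0⟩ := exists_inv_eq_inv_add hg hinj hg0 hg1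
  have hm' := norm_deriv_le_of_injOn_inv_add hg hinj hg0 hm hgm
  have hsub : Metric.closedBall (0 : ℂ) (1 / 4) ⊆ Metric.ball 0 1 :=
    Metric.closedBall_subset_ball (by norm_num)
  have hmS : ∀ z ∈ Metric.closedBall (0 : ℂ) (1 / 4), ‖m z - m 0‖ ≤ 20 * (1 / 4) := by
    intro z hz
    refine (Convex.norm_image_sub_le_of_norm_deriv_le (f := m)
      (fun x hx => hm.differentiableAt (Metric.isOpen_ball.mem_nhds (hsub hx))) hm'
      (convex_closedBall _ _) (Metric.mem_closedBall_self (by norm_num)) hz).trans ?_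
    gcongr
    simpa using hz
  have h := norm_omitted_sub_le (b := m 0) (M := 9) (v := v) (by norm_num : (0 : ℝ) < 1 / 4)
    (hg.mono hsub) hg0 ?_ ?_ (fun z hz => hv z (hsub hz))
  · rw [hm0, show 2 * v + -2 * m 0 = 2 * (v - m 0) by ring, norm_mul]
    norm_num
    linarith
  · intro w hw h
    exact Metric.ne_of_mem_sphere hw (by norm_num)
      (hinj (hsub (Metric.sphere_subset_closedBall hw)) (Metric.mem_ball_self one_pos)
        (h.trans hg0.symm))
  · intro w hw
    rw [hgm w (hsub (Metric.sphere_subset_closedBall hw))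
        (Metric.ne_of_mem_sphere hw (by norm_num)),
      add_sub_assoc]
    refine (norm_add_le _ _).trans ?_
    have := hmS w (Metric.sphere_subset_closedBall hw)
    rw [norm_inv, mem_sphere_zero_iff_norm.1 hw]
    norm_num at this ⊢
    linarith

section Normalization

variable {g : ℂ → ℂ} {c : ℂ} {r : ℝ}

/-- Normalisation of `g` at the centre of the disc `ball c r`. -/
noncomputable def discNormalization (g : ℂ → ℂ) (c : ℂ) (r : ℝ) (z : ℂ) : ℂ :=
  (g (c + r * z) - g c) / (r * deriv g c)

theorem add_mul_mem_ball (hr : 0 < r) {z : ℂ} (hz : z ∈ Metric.ball (0 : ℂ) 1) :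
    c + r * z ∈ Metric.ball c r := by
  rw [Metric.mem_ball, dist_eq_norm, add_sub_cancel_left, norm_mul, Complex.norm_real,
    Real.norm_of_nonneg hr.le]
  have : ‖z‖ < 1 := by simpa using hz
  nlinarith

theorem hasDerivAt_discNormalization (hr : 0 < r) (hg : Univalent g (Metric.ball c r))
    {z : ℂ} (hz : z ∈ Metric.ball (0 : ℂ) 1) :
    HasDerivAt (discNormalization g c r) (deriv g (c + r * z) / deriv g c) z := by
  have h1 : HasDerivAt g (deriv g (c + r * z)) (c + r * z) :=
    (hg.1.differentiableAt (Metric.isOpen_ball.mem_nhds (add_mul_mem_ball hr hz))).hasDerivAt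
  have h2 : HasDerivAt (fun z : ℂ => c + r * z) r z := by
    simpa using ((hasDerivAt_id z).const_mul (r : ℂ)).const_add c
  have h3 := ((h1.comp z h2).sub_const (g c)).div_const (r * deriv g c)
  have hr' : (r : ℂ) ≠ 0 := by exact_mod_cast hr.ne'
  have hgc := hg.2.2 c (Metric.mem_ball_self hr)
  have e : deriv g (c + r * z) / deriv g c = deriv g (c + r * z) * r / (r * deriv g c) := by
    rw [mul_comm _ (r : ℂ), mul_div_mul_left _ _ hr']
  rw [e]
  exact h3

theorem injOn_discNormalization (hr : 0 < r) (hg : Univalent g (Metric.ball c r)) :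
    Set.InjOn (discNormalization g c r) (Metric.ball 0 1) := by
  intro z hz w hw h
  have hr' : (r : ℂ) ≠ 0 := by exact_mod_cast hr.ne'
  have hgc := hg.2.2 c (Metric.mem_ball_self hr)
  rw [discNormalization, discNormalization, div_left_inj' (mul_ne_zero hr' hgc), sub_left_inj] at h
  have := hg.2.1 (add_mul_mem_ball hr hz) (add_mul_mem_ball hr hw) h
  simpa [hr'] using this

theorem deriv_deriv_discNormalization (hr : 0 < r) (hg : Univalent g (Metric.ball c r)) :
    deriv (deriv (discNormalization g c r)) 0 = r * deriv (deriv g) c / deriv g c := by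
  have h1 : deriv (discNormalization g c r) =ᶠ[𝓝 0] fun z => deriv g (c + r * z) / deriv g c := by
    filter_upwards [Metric.ball_mem_nhds (0 : ℂ) one_pos] with z hz
    exact (hasDerivAt_discNormalization hr hg hz).deriv
  have h2 : HasDerivAt (fun z : ℂ => c + r * z) r 0 := by
    simpa using ((hasDerivAt_id (0 : ℂ)).const_mul (r : ℂ)).const_add c
  have h3 : HasDerivAt (deriv g) (deriv (deriv g) (c + r * 0)) (c + r * 0) := by
    refine ((hg.1.deriv Metric.isOpen_ball).differentiableAt
      (Metric.isOpen_ball.mem_nhds ?_)).hasDerivAt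
    simpa using hr
  have h4 : HasDerivAt (fun z => deriv g (c + r * z) / deriv g c)
      (deriv (deriv g) (c + r * 0) * r / deriv g c) 0 := by
    have := HasDerivAt.comp (0 : ℂ) h3 h2
    exact this.div_const (deriv g c)
  rw [h1.deriv_eq, h4.deriv, mul_zero, add_zero, mul_comm]

theorem norm_omitted_discNormalization (hr : 0 < r) (hg : Univalent g (Metric.ball c r))
    {v : ℂ} (hv : ∀ z ∈ Metric.ball (0 : ℂ) 1, 1 - v * discNormalization g c r z ≠ 0) :
    ‖2 * v + r * deriv (deriv g) c / deriv g c‖ ≤ 18 := by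
  rw [← deriv_deriv_discNormalization hr hg]
  refine norm_inv_omitted_add_le
    (fun z hz => (hasDerivAt_discNormalization hr hg hz).differentiableAt.differentiableWithinAt)
    (injOn_discNormalization hr hg) (by simp [discNormalization]) ?_ hv
  rw [(hasDerivAt_discNormalization hr hg (Metric.mem_ball_self one_pos)).deriv, mul_zero, add_zero,
    div_self (hg.2.2 c (Metric.mem_ball_self hr))]

theorem Univalent.norm_deriv_deriv_le (hr : 0 < r) (hg : Univalent g (Metric.ball c r)) :
    ‖deriv (deriv g) c‖ ≤ 18 / r * ‖deriv g c‖ := by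
  have h := norm_omitted_discNormalization hr hg (v := 0) (by simp)
  have hgc := norm_pos_iff.2 (hg.2.2 c (Metric.mem_ball_self hr))
  rw [mul_zero, zero_add, norm_div, norm_mul, Complex.norm_real, Real.norm_of_nonneg hr.le,
    div_le_iff₀ hgc] at h
  rw [div_mul_eq_mul_div, le_div_iff₀ hr]
  linarith

theorem Univalent.ball_subset_image (hr : 0 < r) (hg : Univalent g (Metric.ball c r)) :
    Metric.ball (g c) (r * ‖deriv g c‖ / 18) ⊆ g '' Metric.ball c r := by
  intro w hw
  by_contra hcon
  have hr' : (r : ℂ) ≠ 0 := by exact_mod_cast hr.ne'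
  have hgc := hg.2.2 c (Metric.mem_ball_self hr)
  have hwc : w - g c ≠ 0 := fun h =>
    hcon ⟨c, Metric.mem_ball_self hr, (sub_eq_zero.1 h).symm⟩
  have h0 := norm_omitted_discNormalization hr hg (v := 0) (by simp)
  have h := norm_omitted_discNormalization hr hg (v := r * deriv g c / (w - g c)) (by
    intro z hz h
    rw [discNormalization] at h
    field_simp at h
    refine hcon ⟨c + r * z, add_mul_mem_ball hr hz, ?_⟩
    linear_combination -h)
  rw [mul_zero, zero_add] at h0
  have h2 : ‖2 * (r * deriv g c / (w - g c))‖ ≤ 36 := by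
    have := norm_sub_le (2 * (r * deriv g c / (w - g c)) + r * deriv (deriv g) c / deriv g c)
      (r * deriv (deriv g) c / deriv g c)
    rw [add_sub_cancel_right] at this
    linarith
  rw [norm_mul, norm_div, norm_mul, Complex.norm_real, Real.norm_of_nonneg hr.le,
    Complex.norm_two, mul_div_assoc', div_le_iff₀ (norm_pos_iff.2 hwc)] at h2
  rw [Metric.mem_ball, dist_eq_norm, lt_div_iff₀ (by norm_num)] at hw
  linarith

theorem Univalent.norm_deriv_le_of_mem_closedBall (hr : 0 < r) (hg : Univalent g (Metric.ball c r))
    {z w : ℂ} (hz : z ∈ Metric.closedBall c (r / 2)) (hw : w ∈ Metric.closedBall c (r / 2)) :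
    ‖deriv g w‖ ≤ Real.exp 36 * ‖deriv g z‖ := by
  set l : ℝ → ℂ := fun s => z + s * (w - z) with hl
  have hlmem : ∀ s ∈ Set.Icc (0 : ℝ) 1, l s ∈ Metric.closedBall c (r / 2) := by
    intro s hs
    have := (convex_closedBall c (r / 2)).add_smul_sub_mem hz hw hs
    simpa [hl] using this
  have hsub : Metric.closedBall c (r / 2) ⊆ Metric.ball c r :=
    Metric.closedBall_subset_ball (by linarith)
  have hd : DifferentiableOn ℂ (deriv g) (Metric.ball c r) := hg.1.deriv Metric.isOpen_ball
  have hld : ∀ s, HasDerivAt l (w - z) s := by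
    intro s
    simpa [hl] using ((Complex.ofRealCLM.hasDerivAt (x := s)).mul_const (w - z)).const_add z
  have hcomp : ∀ s ∈ Set.Icc (0 : ℝ) 1, HasDerivAt (fun s => deriv g (l s))
      (deriv (deriv g) (l s) * (w - z)) s := by
    intro s hs
    exact (hd.differentiableAt (Metric.isOpen_ball.mem_nhds (hsub (hlmem s hs)))).hasDerivAt.comp
      s (hld s)
  have hwz : ‖w - z‖ ≤ r := by
    have h1 := Metric.mem_closedBall.1 hz
    have h2 := Metric.mem_closedBall.1 hw
    have := dist_triangle_right w z c
    rw [dist_eq_norm w z] at this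
    linarith
  have hbd : ∀ s ∈ Set.Ico (0 : ℝ) 1, ‖deriv (deriv g) (l s) * (w - z)‖ ≤
      36 * ‖deriv g (l s)‖ + 0 := by
    intro s hs
    have hs' := hlmem s ⟨hs.1, hs.2.le⟩
    have hb : Metric.ball (l s) (r / 2) ⊆ Metric.ball c r :=
      Metric.ball_subset_ball' (by have := Metric.mem_closedBall.1 hs'; linarith)
    have h1 := (hg.mono hb).norm_deriv_deriv_le (by positivity)
    rw [norm_mul, add_zero]
    calc _ ≤ 18 / (r / 2) * ‖deriv g (l s)‖ * r := by gcongr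
      _ = _ := by field_simp; ring
  have := norm_le_gronwallBound_of_norm_deriv_right_le (f := fun s => deriv g (l s))
    (f' := fun s => deriv (deriv g) (l s) * (w - z)) (δ := ‖deriv g z‖) (K := 36) (ε := 0)
    (a := 0) (b := 1) (fun s hs => (hcomp s hs).continuousAt.continuousWithinAt)
    (fun s hs => (hcomp s ⟨hs.1, hs.2.le⟩).hasDerivWithinAt) (by simp [hl]) hbd 1 (by simp)
  rw [gronwallBound_ε0] at this
  simpa [hl, mul_comm] using this

end Normalization

theorem isLocalHomeomorph_of_deriv_ne_zero {F : ℂ → ℂ} (hF : Differentiable ℂ F) :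
    IsLocalHomeomorph (fun z : {z // deriv F z ≠ 0} => F z) := by
  have hopen : IsOpen {z | deriv F z ≠ 0} :=
    isOpen_ne_fun hF.deriv.continuous continuous_const
  have h1 : IsLocalHomeomorphOn F {z | deriv F z ≠ 0} := by
    refine IsLocalHomeomorphOn.mk _ _ fun z hz => ?_
    have hs : HasStrictDerivAt F (deriv F z) z :=
      (hF.analyticAt z).contDiffAt.hasStrictDerivAt (n := 1) (by simp)
    exact ⟨(hs.hasStrictFDerivAt_equiv hz).toOpenPartialHomeomorph F,
      (hs.hasStrictFDerivAt_equiv hz).mem_toOpenPartialHomeomorph_source, fun _ _ => rfl⟩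
  rw [isLocalHomeomorph_iff_isLocalHomeomorphOn_univ]
  exact h1.comp (s := Set.univ)
    hopen.isOpenEmbedding_subtypeVal.isLocalHomeomorph.isLocalHomeomorphOn fun z _ => z.2

theorem eqOn_of_comp_eqOn_of_deriv_ne_zero {F : ℂ → ℂ} (hF : Differentiable ℂ F) {A : Type*}
    [TopologicalSpace A] {s : Set A} (hs : IsPreconnected s) {g₁ g₂ : A → ℂ}
    (h₁ : ContinuousOn g₁ s) (h₂ : ContinuousOn g₂ s) (hd₁ : ∀ t ∈ s, deriv F (g₁ t) ≠ 0)
    (hd₂ : ∀ t ∈ s, deriv F (g₂ t) ≠ 0) (he : ∀ t ∈ s, F (g₁ t) = F (g₂ t)) {a : A} (ha : a ∈ s)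
    (hga : g₁ a = g₂ a) : s.EqOn g₁ g₂ := by
  have : PreconnectedSpace s := isPreconnected_iff_preconnectedSpace.1 hs
  let G₁ : s → {z // deriv F z ≠ 0} := fun t => ⟨g₁ t, hd₁ t t.2⟩
  let G₂ : s → {z // deriv F z ≠ 0} := fun t => ⟨g₂ t, hd₂ t t.2⟩
  have h := (T2Space.isSeparatedMap (fun z : {z // deriv F z ≠ 0} => F z)).eq_of_comp_eq
    (isLocalHomeomorph_of_deriv_ne_zero hF).isLocallyInjective (g₁ := G₁) (g₂ := G₂)
    (Continuous.subtype_mk (continuousOn_iff_continuous_domRestrict.1 h₁) _)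
    (Continuous.subtype_mk (continuousOn_iff_continuous_domRestrict.1 h₂) _)
    (funext fun t => he t t.2) ⟨a, ha⟩ (Subtype.ext hga)
  intro t ht
  exact congrArg Subtype.val (congrFun h ⟨t, ht⟩)

/-- A continuous lift of a holomorphic map is holomorphic. -/
theorem differentiableOn_of_comp {F g h : ℂ → ℂ} {U : Set ℂ} (hU : IsOpen U)
    (hF : Differentiable ℂ F) (hg : ContinuousOn g U) (hd : ∀ z ∈ U, deriv F (g z) ≠ 0)
    (hh : DifferentiableOn ℂ h U) (hFg : ∀ z ∈ U, F (g z) = h z) : DifferentiableOn ℂ g U := by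
  intro z hz
  have hs : HasStrictDerivAt F (deriv F (g z)) (g z) :=
    (hF.analyticAt _).contDiffAt.hasStrictDerivAt (n := 1) (by simp)
  have hl := (hg.continuousAt (hU.mem_nhds hz)).eventually
    (hs.eventually_left_inverse (hd z hz))
  have hl' : g =ᶠ[𝓝 z] fun w => hs.localInverse F _ _ (hd z hz) (h w) := by
    filter_upwards [hl, hU.mem_nhds hz] with w hw hwU
    rw [← hFg w hwU, hw]
  have h1 := (hs.to_localInverse (hd z hz)).hasDerivAt.differentiableAt
  rw [hFg z hz] at h1
  exact ((h1.comp z (hh.differentiableAt (hU.mem_nhds hz))).congr_of_eventuallyEq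
    hl').differentiableWithinAt

section PathLifting

variable {f : ℂ → ℂ} {R : ℝ} {c : ℝ → ℂ} {z₀ : ℂ}

/-- `γ` lifts `c` on `(-∞, T]` and is constant on `(-∞, 0]`. -/
def IsLiftUpTo (f : ℂ → ℂ) (c : ℝ → ℂ) (z₀ : ℂ) (T : ℝ) (γ : ℝ → ℂ) : Prop :=
  ContinuousOn γ (Set.Iic T) ∧ (∀ t ≤ T, f (γ t) = c t) ∧ ∀ t ≤ 0, γ t = z₀

theorem IsLiftUpTo.eqOn (hf : Differentiable ℂ f) (hd : ∀ z, R < ‖f z‖ → deriv f z ≠ 0)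
    (hcR : ∀ t, R < ‖c t‖) {T T' : ℝ} {γ γ' : ℝ → ℂ} (hTT : T ≤ T')
    (h : IsLiftUpTo f c z₀ T γ) (h' : IsLiftUpTo f c z₀ T' γ') : Set.EqOn γ γ' (Set.Iic T) := by
  refine eqOn_of_comp_eqOn_of_deriv_ne_zero hf isPreconnected_Iic h.1
    (h'.1.mono (Set.Iic_subset_Iic.2 hTT))
    (fun t ht => hd _ (by rw [h.2.1 t ht]; exact hcR t))
    (fun t ht => hd _ (by rw [h'.2.1 t (le_trans ht hTT)]; exact hcR t))
    (fun t ht => by rw [h.2.1 t ht, h'.2.1 t (le_trans ht hTT)])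
    (a := min T 0) (Set.mem_Iic.2 (min_le_left _ _)) ?_
  rw [h.2.2 _ (min_le_right _ _), h'.2.2 _ (min_le_right _ _)]

/-- A lift on the half-open interval `(-∞, T)` extends a bit beyond `T`. -/
theorem exists_isLiftUpTo_gt (hf : Differentiable ℂ f) (hd : ∀ z, R < ‖f z‖ → deriv f z ≠ 0)
    (ha : ∀ a ∈ asymptoticValues f, ‖a‖ ≤ R) (hc : Continuous c) (hcR : ∀ t, R < ‖c t‖)
    {T : ℝ} (hT : 0 ≤ T) (hT0 : T = 0 → ∀ t ≤ 0, c t = f z₀) {γ : ℝ → ℂ}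
    (hγ : ContinuousOn γ (Set.Iio T)) (hγl : ∀ t < T, f (γ t) = c t) (hγ0 : ∀ t ≤ 0, γ t = z₀) :
    ∃ T' > T, ∃ γ', IsLiftUpTo f c z₀ T' γ' := by
  have hlim : Tendsto (fun t => f (γ t)) (𝓝[<] T) (𝓝 (c T)) := by
    refine (hc.continuousAt.mono_left nhdsWithin_le_nhds).congr' ?_
    filter_upwards [self_mem_nhdsWithin] with t ht using (hγl t ht).symm
  have hnt : ¬ Tendsto (fun t => ‖γ t‖) (𝓝[<] T) atTop := by
    intro hinf
    refine absurd (ha (c T) ⟨fun s => γ (T - Real.exp (-s)), ?_, ?_, ?_⟩) (not_le.2 (hcR T))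
    · refine hγ.comp_continuous (by fun_prop) fun s => ?_
      simp only [Set.mem_Iio]
      linarith [Real.exp_pos (-s)]
    all_goals
      have htend : Tendsto (fun s : ℝ => T - Real.exp (-s)) atTop (𝓝[<] T) := by
        refine tendsto_nhdsWithin_iff.2 ⟨?_, Eventually.of_forall fun s => ?_⟩
        · simpa using (Real.tendsto_exp_neg_atTop_nhds_zero).const_sub T
        · simp only [Set.mem_Iio]; linarith [Real.exp_pos (-s)]
    · exact hinf.comp htend
    · exact hlim.comp htend
  have hM : ∃ M, ∃ᶠ t in 𝓝[<] T, γ t ∈ Metric.closedBall (0 : ℂ) M := by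
    by_contra! hcon
    refine hnt (tendsto_atTop.2 fun M => ?_)
    filter_upwards [hcon M] with t ht
    simp only [Metric.mem_closedBall, dist_zero_right, not_le] at ht
    exact ht.le
  obtain ⟨M, hM⟩ := hM
  obtain ⟨z, -, hz⟩ := (isCompact_closedBall (0 : ℂ) M).exists_mapClusterPt_of_frequently hM
  have hfz : f z = c T := by
    have h1 : MapClusterPt (f z) (𝓝[<] T) (f ∘ γ) := hz.tendsto_comp hf.continuous.continuousAt
    have h2 : ClusterPt (f z) (𝓝 (c T)) := h1.clusterPt.mono hlim
    exact eq_of_nhds_neBot h2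
  have hs : HasStrictDerivAt f (deriv f z) z :=
    (hf.analyticAt _).contDiffAt.hasStrictDerivAt (n := 1) (by simp)
  have hdz := hd z (by rw [hfz]; exact hcR T)
  set e := (hs.hasStrictFDerivAt_equiv hdz).toOpenPartialHomeomorph f with he
  have hef : ∀ w, e w = f w := fun w => rfl
  have hze : z ∈ e.source := (hs.hasStrictFDerivAt_equiv hdz).mem_toOpenPartialHomeomorph_source
  have hcT : c T ∈ e.target := by rw [← hfz, ← hef]; exact e.map_source hze
  have hnb : c ⁻¹' e.target ∈ 𝓝 T := hc.continuousAt.preimage_mem_nhds (e.open_target.mem_nhds hcT)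
  obtain ⟨δ, hδ, hball⟩ := Metric.mem_nhds_iff.1 hnb
  have hfr : ∃ᶠ t in 𝓝[<] T, γ t ∈ e.source :=
    hz.frequently (e.open_source.mem_nhds hze)
  obtain ⟨t₁, ht₁s, ht₁δ, ht₁T, ht₁0⟩ : ∃ t₁, γ t₁ ∈ e.source ∧ T - δ < t₁ ∧ t₁ < T ∧
      (0 < T → 0 < t₁) := by
    have ev : ∀ᶠ t in 𝓝[<] T, T - δ < t ∧ t < T ∧ (0 < T → 0 < t) := by
      filter_upwards [self_mem_nhdsWithin, nhdsWithin_le_nhds (lt_mem_nhds (sub_lt_self T hδ)),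
        nhdsWithin_le_nhds (show {t | 0 < T → 0 < t} ∈ 𝓝 T by
          by_cases h : 0 < T
          · filter_upwards [lt_mem_nhds h] with t ht _ using ht
          · exact Filter.univ_mem' fun t ht => absurd ht h)] with t h1 h2 h3
      exact ⟨h2, h1, h3⟩
    obtain ⟨t, h1, h2⟩ := (hfr.and_eventually ev).exists
    exact ⟨t, h1, h2⟩
  have hsymm : e.symm (c t₁) = γ t₁ := by
    rw [← hγl t₁ ht₁T, ← hef, e.left_inv ht₁s]
  have hmem : ∀ t ∈ Set.Icc t₁ (T + δ / 2), c t ∈ e.target := by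
    intro t ht
    refine hball ?_
    rw [Metric.mem_ball, Real.dist_eq, abs_lt]
    constructor <;> linarith [ht.1, ht.2]
  refine ⟨T + δ / 2, by linarith, fun t => if t ≤ t₁ then γ t else e.symm (c t), ?_, ?_, ?_⟩
  · have h1 : ContinuousOn (fun t => if t ≤ t₁ then γ t else e.symm (c t))
        (Set.Iic t₁ ∪ Set.Icc t₁ (T + δ / 2)) := by
      refine ContinuousOn.union_of_isClosed ?_ ?_ isClosed_Iic isClosed_Icc
      · refine (hγ.mono fun t ht => lt_of_le_of_lt ht ht₁T).congr fun t ht => ?_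
        exact if_pos ht
      · refine (e.continuousOn_symm.comp hc.continuousOn hmem).congr fun t ht => ?_
        rcases ht.1.eq_or_lt with rfl | hlt
        · simp [hsymm]
        · simp [not_le.2 hlt]
    refine h1.mono fun t ht => ?_
    rcases le_total t t₁ with h | h
    · exact Or.inl h
    · exact Or.inr ⟨h, ht⟩
  · intro t ht
    simp only
    split_ifs with h
    · exact hγl t (h.trans_lt ht₁T)
    · rw [← hef, e.right_inv (hmem t ⟨(not_le.1 h).le, ht⟩)]
  · intro t ht
    simp only
    split_ifs with h
    · exact hγ0 t ht
    · rcases hT.eq_or_lt with h0 | h0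
      · have : c t = c t₁ := by
          rw [hT0 h0.symm t ht, hT0 h0.symm t₁ (by linarith)]
        rw [this, hsymm, hγ0 t₁ (by linarith)]
      · linarith [ht₁0 h0, not_le.1 h]

theorem exists_path_lift (hf : Differentiable ℂ f) (hd : ∀ z, R < ‖f z‖ → deriv f z ≠ 0)
    (ha : ∀ a ∈ asymptoticValues f, ‖a‖ ≤ R) (hc : Continuous c) (hcR : ∀ t, R < ‖c t‖)
    (hc0 : ∀ t ≤ 0, c t = f z₀) (T : ℝ) : ∃ γ, IsLiftUpTo f c z₀ T γ := by
  by_contra hcon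
  set S := {T | ∃ γ, IsLiftUpTo f c z₀ T γ} with hS
  have hdown : ∀ t ∈ S, ∀ s ≤ t, s ∈ S := by
    rintro t ⟨γ, h1, h2, h3⟩ s hst
    exact ⟨γ, h1.mono (Set.Iic_subset_Iic.2 hst), fun u hu => h2 u (hu.trans hst), h3⟩
  have h0 : (0 : ℝ) ∈ S :=
    ⟨fun _ => z₀, continuousOn_const, fun t ht => (hc0 t ht).symm, fun _ _ => rfl⟩
  have hbdd : BddAbove S := ⟨T, fun t ht => by
    by_contra! h
    exact hcon (hdown t ht T h.le)⟩
  have hlt : ∀ t < sSup S, t ∈ S := by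
    intro t ht
    obtain ⟨s, hs, hts⟩ := exists_lt_of_lt_csSup ⟨0, h0⟩ ht
    exact hdown s hs t hts.le
  have hpos : 0 ≤ sSup S := le_csSup hbdd h0
  choose! Γ hΓ using fun t (ht : t ∈ S) => ht
  have hloc : ∀ t ∈ S, ∀ s ≤ t, Γ s s = Γ t s := fun t ht s hs =>
    (hΓ s (hdown t ht s hs)).eqOn hf hd hcR hs (hΓ t ht) (Set.mem_Iic.2 le_rfl)
  have hext : ∃ T' > sSup S, ∃ γ', IsLiftUpTo f c z₀ T' γ' := by
    refine exists_isLiftUpTo_gt hf hd ha hc hcR hpos (fun _ => hc0) (γ := fun t => Γ t t) ?_ ?_ ?_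
    · intro t ht
      obtain ⟨s, hts, hs⟩ := exists_between (Set.mem_Iio.1 ht)
      have hc1 : ContinuousAt (Γ s) t := (hΓ s (hlt s hs)).1.continuousAt (Iic_mem_nhds hts)
      refine (hc1.congr ?_).continuousWithinAt
      filter_upwards [Iic_mem_nhds hts] with u hu
      exact (hloc s (hlt s hs) u hu).symm
    · intro t ht
      exact (hΓ t (hlt t ht)).2.1 t le_rfl
    · intro t ht
      exact (hΓ t (hdown 0 h0 t ht)).2.2 t ht
  obtain ⟨T', hT', h⟩ := hext
  exact absurd (le_csSup hbdd h) (not_le.2 hT')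

end PathLifting

/-- The right half-plane `{Re ζ > ρ}`. -/
def rightHalfPlane (ρ : ℝ) : Set ℂ := {ζ | ρ < ζ.re}

theorem isOpen_rightHalfPlane (ρ : ℝ) : IsOpen (rightHalfPlane ρ) :=
  isOpen_lt continuous_const Complex.continuous_re

theorem convex_rightHalfPlane (ρ : ℝ) : Convex ℝ (rightHalfPlane ρ) :=
  convex_halfSpace_re_gt ρ

theorem isPreconnected_rightHalfPlane (ρ : ℝ) : IsPreconnected (rightHalfPlane ρ) :=
  (convex_rightHalfPlane ρ).isPreconnected

theorem exp_lt_norm_exp {ρ : ℝ} {ζ : ℂ} (h : ζ ∈ rightHalfPlane ρ) :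
    Real.exp ρ < ‖Complex.exp ζ‖ := by
  rw [Complex.norm_exp]; exact Real.exp_lt_exp.2 h

theorem exists_differentiableOn_lift_exp {f : ℂ → ℂ} {ρ : ℝ} (hf : Differentiable ℂ f)
    (hd : ∀ z, Real.exp ρ < ‖f z‖ → deriv f z ≠ 0)
    (ha : ∀ a ∈ asymptoticValues f, ‖a‖ ≤ Real.exp ρ) {z₀ ζ₀ : ℂ} (hζ₀ : ζ₀ ∈ rightHalfPlane ρ)
    (hz₀ : f z₀ = Complex.exp ζ₀) :
    ∃ φ : ℂ → ℂ, DifferentiableOn ℂ φ (rightHalfPlane ρ) ∧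
      (∀ ζ ∈ rightHalfPlane ρ, f (φ ζ) = Complex.exp ζ) ∧ φ ζ₀ = z₀ := by
  set H := rightHalfPlane ρ with hH
  let l : ℝ → ℂ → ℂ := fun t ζ => ζ₀ + t * (ζ - ζ₀)
  have hl : Continuous fun q : ℝ × ℂ => l q.1 q.2 := by fun_prop
  have hlH : ∀ t ∈ Set.Icc (0 : ℝ) 1, ∀ ζ ∈ H, l t ζ ∈ H := fun t ht ζ hζ => by
    simpa [l] using (convex_rightHalfPlane ρ).add_smul_sub_mem hζ₀ hζ ht
  let c : ℂ → ℝ → ℂ := fun ζ t => Complex.exp (l (Set.projIcc 0 1 zero_le_one t) ζ)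
  have hcc : ∀ ζ, Continuous (c ζ) := fun ζ =>
    Complex.continuous_exp.comp (hl.comp
      ((continuous_subtype_val.comp (continuous_projIcc (h := zero_le_one))).prodMk
        continuous_const))
  have hcR : ∀ ζ ∈ H, ∀ t, Real.exp ρ < ‖c ζ t‖ := fun ζ hζ t =>
    exp_lt_norm_exp (hlH _ (Set.projIcc 0 1 zero_le_one t).2 ζ hζ)
  have hc0 : ∀ ζ, ∀ t ≤ 0, c ζ t = f z₀ := by
    intro ζ t ht
    simp [c, Set.projIcc_of_le_left zero_le_one ht, l, hz₀]
  have hc1 : ∀ ζ (t : unitInterval), c ζ t = Complex.exp (l t ζ) := by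
    intro ζ t
    simp [c]
  choose! γ hγ using fun ζ (hζ : ζ ∈ H) =>
    exists_path_lift hf hd ha (hcc ζ) (hcR ζ hζ) (hc0 ζ) 1
  have hne : ∀ ζ ∈ H, ∀ t ≤ 1, deriv f (γ ζ t) ≠ 0 := fun ζ hζ t ht =>
    hd _ (by rw [(hγ ζ hζ).2.1 t ht]; exact hcR ζ hζ t)
  let g : unitInterval × H → {z // deriv f z ≠ 0} :=
    fun q => ⟨γ q.2 q.1, hne q.2 q.2.2 q.1 q.1.2.2⟩
  have hgc : Continuous g := by
    let G : C(unitInterval × H, ℂ) := ⟨fun q => Complex.exp (l q.1 q.2),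
      Complex.continuous_exp.comp (hl.comp ((continuous_subtype_val.comp continuous_fst).prodMk
        (continuous_subtype_val.comp continuous_snd)))⟩
    refine (isLocalHomeomorph_of_deriv_ne_zero hf).continuous_lift (T2Space.isSeparatedMap _)
      (g := g) G ?_ ?_ ?_
    · ext q
      change f (γ q.2 q.1) = Complex.exp (l q.1 q.2)
      rw [(hγ q.2 q.2.2).2.1 q.1 q.1.2.2, hc1]
    · refine continuous_const.congr (f := fun _ => g (0, ⟨ζ₀, hζ₀⟩)) fun ζ => Subtype.ext ?_
      change γ ζ₀ 0 = γ ζ 0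
      rw [(hγ ζ ζ.2).2.2 0 le_rfl, (hγ ζ₀ hζ₀).2.2 0 le_rfl]
    · intro ζ
      refine Continuous.subtype_mk ?_ _
      exact (hγ ζ ζ.2).1.comp_continuous continuous_subtype_val fun t => t.2.2
  have hφl : ∀ ζ ∈ H, f (γ ζ 1) = Complex.exp ζ := by
    intro ζ hζ
    have := (hγ ζ hζ).2.1 1 le_rfl
    rw [this]
    simpa [l] using hc1 ζ 1
  refine ⟨fun ζ => γ ζ 1, ?_, hφl, ?_⟩
  · refine differentiableOn_of_comp (isOpen_rightHalfPlane ρ) hf ?_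
      (fun ζ hζ => hne ζ hζ 1 le_rfl) Complex.differentiable_exp.differentiableOn hφl
    rw [continuousOn_iff_continuous_domRestrict]
    exact continuous_subtype_val.comp (hgc.comp (Continuous.prodMk_right 1))
  · have hconst : IsLiftUpTo f (c ζ₀) z₀ 1 fun _ => z₀ :=
      ⟨continuousOn_const, fun t _ => by simp [c, l, hz₀], fun _ _ => rfl⟩
    exact (hγ ζ₀ hζ₀).eqOn hf hd (hcR ζ₀ hζ₀) le_rfl hconst (Set.mem_Iic.2 le_rfl)

theorem isSimplyConnected_rightHalfPlane (ρ : ℝ) : IsSimplyConnected (rightHalfPlane ρ) := by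
  have : ContractibleSpace (rightHalfPlane ρ) :=
    (convex_rightHalfPlane ρ).contractibleSpace ⟨(ρ + 1 : ℝ), by simp [rightHalfPlane]⟩
  exact (inferInstance : SimplyConnectedSpace (rightHalfPlane ρ))

/-- `Φ` is a holomorphic inverse branch of `log f(e^z)` on the half-plane `Re ζ > ρ`. -/
def IsLogLift (f : ℂ → ℂ) (ρ : ℝ) (Φ : ℂ → ℂ) : Prop :=
  DifferentiableOn ℂ Φ (rightHalfPlane ρ) ∧
    ∀ ζ ∈ rightHalfPlane ρ, f (Complex.exp (Φ ζ)) = Complex.exp ζ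

theorem exists_isLogLift {f : ℂ → ℂ} {ρ : ℝ} (hf : Differentiable ℂ f)
    (hd : ∀ z, Real.exp ρ < ‖f z‖ → deriv f z ≠ 0)
    (ha : ∀ a ∈ asymptoticValues f, ‖a‖ ≤ Real.exp ρ) (hf0 : ‖f 0‖ ≤ Real.exp ρ)
    {z : ℂ} (hz : Real.exp ρ < ‖f (Complex.exp z)‖) :
    ∃ Φ, IsLogLift f ρ Φ ∧ ∃ ζ ∈ rightHalfPlane ρ, Φ ζ = z := by
  have hne : f (Complex.exp z) ≠ 0 := norm_pos_iff.1 ((Real.exp_pos ρ).trans hz)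
  set ζ := Complex.log (f (Complex.exp z)) with hζdef
  have hζe : f (Complex.exp z) = Complex.exp ζ := (Complex.exp_log hne).symm
  have hζ : ζ ∈ rightHalfPlane ρ := by
    rw [hζe, Complex.norm_exp] at hz
    exact Real.exp_lt_exp.1 hz
  obtain ⟨φ, hφd, hφl, hφz⟩ := exists_differentiableOn_lift_exp hf hd ha hζ hζe
  have hφ0 : (0 : ℂ) ∉ φ '' rightHalfPlane ρ := by
    rintro ⟨w, hw, h⟩
    have := exp_lt_norm_exp hw
    rw [← hφl w hw, h] at this
    exact absurd this (not_lt.2 hf0)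
  obtain ⟨L, hLc, hL⟩ := Complex.exists_continuousOn_eqOn_exp_comp
    (isSimplyConnected_rightHalfPlane ρ) (isOpen_rightHalfPlane ρ) hφd.continuousOn hφ0
  have hL' : ∀ w ∈ rightHalfPlane ρ, Complex.exp (L w) = φ w := hL
  have hLd : DifferentiableOn ℂ L (rightHalfPlane ρ) :=
    differentiableOn_of_comp (isOpen_rightHalfPlane ρ) Complex.differentiable_exp hLc
      (fun w _ => by simp [Complex.exp_ne_zero]) hφd hL'
  obtain ⟨n, hn⟩ := Complex.exp_eq_exp_iff_exists_int.1 ((hL' ζ hζ).trans hφz)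
  refine ⟨fun w => L w - n * (2 * Real.pi * Complex.I), ⟨hLd.sub_const _, fun w hw => ?_⟩,
    ζ, hζ, by simp [hn]⟩
  have : Complex.exp (L w - n * (2 * Real.pi * Complex.I)) = Complex.exp (L w) :=
    Complex.exp_periodic.sub_int_mul_eq n
  rw [this, hL' w hw, hφl w hw]

/-- An entire function of polynomial growth is a polynomial. -/
theorem exists_polynomial_of_norm_le_pow (l : ℕ) : ∀ {f : ℂ → ℂ} {C r : ℝ}, Differentiable ℂ f →
    (∀ z, r ≤ ‖z‖ → ‖f z‖ ≤ C * ‖z‖ ^ l) → ∃ p : Polynomial ℂ, ∀ z, f z = p.eval z := by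
  induction l with
  | zero =>
    intro f C r hf h
    obtain ⟨B, hB⟩ := (isCompact_closedBall (0 : ℂ) r).exists_bound_of_continuousOn
      hf.continuous.continuousOn
    have hb : Bornology.IsBounded (Set.range f) := by
      refine isBounded_iff_forall_norm_le.2 ⟨max B C, ?_⟩
      rintro _ ⟨z, rfl⟩
      rcases le_total r ‖z‖ with hz | hz
      · exact (by simpa using h z hz : ‖f z‖ ≤ C).trans (le_max_right _ _)
      · exact (hB z (by simpa using hz)).trans (le_max_left _ _)
    obtain ⟨c, hc⟩ := hf.exists_const_forall_eq_of_bounded hb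
    exact ⟨Polynomial.C c, fun z => by simp [hc z]⟩
  | succ l ih =>
    intro f C r hf h
    have hg : Differentiable ℂ (dslope f 0) := by
      have := (Complex.differentiableOn_dslope (s := Set.univ) (f := f) (c := 0)
        Filter.univ_mem).2 hf.differentiableOn
      exact differentiableOn_univ.1 this
    obtain ⟨p, hp⟩ := ih (f := dslope f 0) (C := C + ‖f 0‖) (r := max r 1) hg (by
      intro z hz
      have h1 : 1 ≤ ‖z‖ := (le_max_right _ _).trans hz
      have hz0 : z ≠ 0 := by rintro rfl; norm_num at h1
      have hzp : 0 < ‖z‖ := by positivity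
      rw [dslope_of_ne _ hz0, slope_def_field, sub_zero, norm_div, div_le_iff₀ hzp]
      have h2 := h z ((le_max_left _ _).trans hz)
      have h3 : 1 ≤ ‖z‖ ^ (l + 1) := one_le_pow₀ h1
      calc ‖f z - f 0‖ ≤ ‖f z‖ + ‖f 0‖ := norm_sub_le _ _
        _ ≤ C * ‖z‖ ^ (l + 1) + ‖f 0‖ * ‖z‖ ^ (l + 1) := by
          gcongr
          exact le_mul_of_one_le_right (norm_nonneg _) h3
        _ = _ := by ring)
    refine ⟨Polynomial.X * p + Polynomial.C (f 0), fun z => ?_⟩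
    have := sub_smul_dslope f 0 z
    rw [hp] at this
    simp only [sub_zero, smul_eq_mul] at this
    simp [this]

theorem IsLogLift.deriv_ne_zero {f Φ : ℂ → ℂ} {ρ : ℝ} (hf : Differentiable ℂ f)
    (hΦ : IsLogLift f ρ Φ) {ζ : ℂ} (hζ : ζ ∈ rightHalfPlane ρ) : deriv Φ ζ ≠ 0 := by
  intro h0
  have hd : DifferentiableAt ℂ Φ ζ := hΦ.1.differentiableAt ((isOpen_rightHalfPlane ρ).mem_nhds hζ)
  have h1 : HasDerivAt (fun w => f (Complex.exp (Φ w)))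
      (deriv f (Complex.exp (Φ ζ)) * (Complex.exp (Φ ζ) * deriv Φ ζ)) ζ :=
    (hf _).hasDerivAt.comp ζ hd.hasDerivAt.cexp
  have h2 : (fun w => f (Complex.exp (Φ w))) =ᶠ[𝓝 ζ] Complex.exp :=
    Filter.eventually_of_mem ((isOpen_rightHalfPlane ρ).mem_nhds hζ) fun w hw => hΦ.2 w hw
  have h3 := (h1.congr_of_eventuallyEq h2.symm).unique (Complex.hasDerivAt_exp ζ)
  rw [h0] at h3
  simp at h3
  exact Complex.exp_ne_zero _ h3.symm

open Function Function.Periodic in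
/-- A holomorphic branch of `f⁻¹ ∘ exp` on a right half-plane cannot be periodic when `f` is
transcendental. -/
theorem exists_polynomial_of_periodic_lift {f φ : ℂ → ℂ} {ρ : ℝ} (hf : Differentiable ℂ f)
    (hφ : DifferentiableOn ℂ φ (rightHalfPlane ρ))
    (hfφ : ∀ ζ ∈ rightHalfPlane ρ, f (φ ζ) = Complex.exp ζ)
    (hφ0 : ∀ ζ ∈ rightHalfPlane ρ, φ ζ ≠ 0)
    {l : ℕ} (hl : 0 < l)
    (hper : ∀ ζ ∈ rightHalfPlane ρ, φ (ζ + 2 * Real.pi * l * Complex.I) = φ ζ) :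
    ∃ p : Polynomial ℂ, ∀ z, f z = p.eval z := by
  classical
  set h : ℝ := 2 * Real.pi * l with hh
  have hpos : 0 < h := by positivity
  set F : ℂ → ℂ := fun z => if ρ < z.im then (φ (-Complex.I * z))⁻¹ else 0 with hF
  have hmem : ∀ z : ℂ, ρ < z.im → -Complex.I * z ∈ rightHalfPlane ρ := fun z hz => by
    simpa [rightHalfPlane] using hz
  have hFper : Periodic F h := by
    intro z
    simp only [hF, Complex.add_im, Complex.ofReal_im, add_zero]
    split_ifs with hz
    · have := hper (-Complex.I * (z + h)) (hmem _ (by simpa using hz))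
      rw [← this]
      congr 2
      rw [hh]; push_cast; ring_nf
    · rfl
  have him : ∀ A : ℝ, ∀ᶠ z : ℂ in (comap Complex.im atTop), A < z.im := fun A =>
    tendsto_comap.eventually (eventually_gt_atTop A)
  have hFd : ∀ᶠ z in (comap Complex.im atTop), DifferentiableAt ℂ F z := by
    filter_upwards [him ρ] with z hz
    have h1 : (fun z => (φ (-Complex.I * z))⁻¹) =ᶠ[𝓝 z] F := by
      filter_upwards [(isOpen_lt continuous_const Complex.continuous_im).mem_nhds hz] with w hw
      have hw' : ρ < w.im := hw
      simp [hF, hw']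
    refine DifferentiableAt.congr_of_eventuallyEq ?_ h1.symm
    have h2 : DifferentiableAt ℂ φ (-Complex.I * z) :=
      hφ.differentiableAt ((isOpen_rightHalfPlane ρ).mem_nhds (hmem z hz))
    exact (h2.comp z (by fun_prop)).inv (hφ0 _ (hmem z hz))
  have hF0 : ZeroAtFilter (comap Complex.im atTop) F := by
    rw [ZeroAtFilter, Metric.tendsto_nhds]
    intro ε hε
    obtain ⟨B, hB⟩ := (isCompact_closedBall (0 : ℂ) (1 / ε)).exists_bound_of_continuousOn
      hf.continuous.continuousOn
    filter_upwards [him ρ, him (Real.log (max B 1))] with z hz hz2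
    simp only [hF, hz, if_true, dist_zero_right, norm_inv]
    by_contra! hcon
    have hn : 0 < ‖φ (-Complex.I * z)‖ := norm_pos_iff.2 (hφ0 _ (hmem z hz))
    have h3 : ‖φ (-Complex.I * z)‖ ≤ 1 / ε := by
      rw [le_div_iff₀ hε]
      rw [inv_eq_one_div, le_div_iff₀ hn] at hcon
      linarith
    have h4 := hB _ (mem_closedBall_zero_iff.2 h3)
    rw [hfφ _ (hmem z hz), Complex.norm_exp] at h4
    have h5 : max B 1 < Real.exp ((-Complex.I * z).re) := by
      rw [← Real.log_lt_iff_lt_exp (by positivity)]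
      simpa using hz2
    exact absurd (h4.trans (le_max_left _ _)) (not_le.2 h5)
  set χ := cuspFunction h F with hχ
  have hχ0 : χ 0 = 0 := cuspFunction_zero_of_zero_at_inf hpos hF0
  have hχd : DifferentiableAt ℂ χ 0 :=
    differentiableAt_cuspFunction_zero hpos hFper hFd hF0.boundedAtFilter
  have hχev := eventually_differentiableAt_cuspFunction_nhds_ne_zero hpos hFper hFd
  have hχan : AnalyticAt ℂ χ 0 := by
    rw [Complex.analyticAt_iff_eventually_differentiableAt]
    rw [eventually_nhdsWithin_iff] at hχev
    filter_upwards [hχev] with q hq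
    by_cases h0 : q = 0
    · rw [h0]; exact hχd
    · exact hq h0
  have hinv : ∀ᶠ q in 𝓝[≠] (0 : ℂ), ρ < (invQParam h q).im :=
    (invQParam_tendsto hpos).eventually (him ρ)
  have hval : ∀ᶠ q in 𝓝[≠] (0 : ℂ), χ q ≠ 0 ∧ ‖f (χ q)⁻¹‖ = (‖q‖⁻¹) ^ l := by
    filter_upwards [hinv, self_mem_nhdsWithin] with q hq hq0
    have e1 : χ q = F (invQParam h q) := by
      rw [← eq_cuspFunction hpos.ne' hFper, qParam_right_inv hpos.ne' hq0]
    rw [e1]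
    simp only [hF, hq, if_true, inv_inv]
    refine ⟨inv_ne_zero (hφ0 _ (hmem _ hq)), ?_⟩
    rw [hfφ _ (hmem _ hq), Complex.norm_exp]
    have e2 : (-Complex.I * invQParam h q).re = (invQParam h q).im := by simp
    have hqn : 0 < ‖q‖ := norm_pos_iff.2 hq0
    rw [e2, im_invQParam, hh, ← Real.exp_log (inv_pos.2 hqn), ← Real.exp_nat_mul, Real.log_inv]
    congr 1
    field_simp
  have hO : ∃ C > 0, ∀ᶠ q in 𝓝 (0 : ℂ), ‖χ q‖ ≤ C * ‖q‖ := by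
    have := hχd.isBigO_sub
    simp only [hχ0, sub_zero] at this
    exact this.exists_pos.imp fun C hC => ⟨hC.1, hC.2.bound⟩
  obtain ⟨C, hC0, hC⟩ := hO
  rcases hχan.eventually_constant_or_nhds_le_map_nhds with hconst | hopen
  · exfalso
    have h1 := hconst.filter_mono (nhdsWithin_le_nhds (s := {0}ᶜ))
    obtain ⟨q, hq1, hq2⟩ := (h1.and hval).exists
    exact hq2.1 (hq1.trans hχ0)
  · rw [hχ0] at hopen
    rw [eventually_nhdsWithin_iff] at hval
    have hgood : ∀ᶠ w in 𝓝 (0 : ℂ), ∃ q, χ q = w ∧ ‖χ q‖ ≤ C * ‖q‖ ∧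
        (q ≠ 0 → χ q ≠ 0 ∧ ‖f (χ q)⁻¹‖ = (‖q‖⁻¹) ^ l) := by
      apply hopen
      rw [mem_map]
      filter_upwards [hC, hval] with q h1 h2
      exact ⟨q, rfl, h1, h2⟩
    obtain ⟨δ, hδ, hgood⟩ := Metric.eventually_nhds_iff.1 hgood
    refine exists_polynomial_of_norm_le_pow l (C := C ^ l) (r := 2 / δ) hf fun z hz => ?_
    have hzp : 0 < ‖z‖ := lt_of_lt_of_le (by positivity) hz
    obtain ⟨q, hq1, hq2, hq3⟩ := hgood (y := z⁻¹) (by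
      rw [dist_zero_right, norm_inv, inv_lt_comm₀ hzp hδ]
      refine lt_of_lt_of_le ?_ hz
      rw [inv_eq_one_div]; gcongr; norm_num)
    have hq0 : q ≠ 0 := by
      rintro rfl
      rw [hχ0] at hq1
      exact (norm_pos_iff.1 hzp) (inv_eq_zero.1 hq1.symm)
    have hv := (hq3 hq0).2
    rw [hq1, inv_inv] at hv
    rw [hv, ← mul_pow]
    have hqn : 0 < ‖q‖ := norm_pos_iff.2 hq0
    gcongr
    rw [hq1, norm_inv] at hq2
    rw [inv_eq_one_div, div_le_iff₀ hqn]
    rw [inv_eq_one_div, div_le_iff₀ hzp] at hq2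
    linarith

/-- `f` is transcendental entire, `‖f 0‖ ≤ exp ρ`, and every singular value of `f` has modulus at
most `exp ρ`. -/
structure IsLogarithmicAbove (f : ℂ → ℂ) (ρ : ℝ) : Prop where
  differentiable : Differentiable ℂ f
  not_polynomial : ¬ ∃ p : Polynomial ℂ, ∀ z, f z = p.eval z
  deriv_ne_zero : ∀ z, Real.exp ρ < ‖f z‖ → deriv f z ≠ 0
  asymptotic_le : ∀ a ∈ asymptoticValues f, ‖a‖ ≤ Real.exp ρ
  norm_zero_le : ‖f 0‖ ≤ Real.exp ρ

theorem deriv_comp_exp {f : ℂ → ℂ} (hf : Differentiable ℂ f) (z : ℂ) :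
    deriv (fun w => f (Complex.exp w)) z = deriv f (Complex.exp z) * Complex.exp z :=
  ((hf _).hasDerivAt.comp z (Complex.hasDerivAt_exp z)).deriv

theorem add_mul_I_mem_rightHalfPlane {ρ : ℝ} {ζ : ℂ} (hζ : ζ ∈ rightHalfPlane ρ) (n : ℤ) :
    ζ + n * (2 * Real.pi * Complex.I) ∈ rightHalfPlane ρ := by
  simpa [rightHalfPlane] using hζ

theorem differentiableOn_comp_add_mul_I {ρ : ℝ} {Φ : ℂ → ℂ}
    (h : DifferentiableOn ℂ Φ (rightHalfPlane ρ)) (n : ℤ) :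
    DifferentiableOn ℂ (fun ζ => Φ (ζ + n * (2 * Real.pi * Complex.I))) (rightHalfPlane ρ) :=
  h.comp (by fun_prop) fun _ hζ => add_mul_I_mem_rightHalfPlane hζ n

theorem exp_add_mul_I (ζ : ℂ) (n : ℤ) :
    Complex.exp (ζ + n * (2 * Real.pi * Complex.I)) = Complex.exp ζ := by
  rw [Complex.exp_eq_exp_iff_exists_int]; exact ⟨n, rfl⟩

namespace IsLogarithmicAbove

variable {f Φ Ψ : ℂ → ℂ} {ρ : ℝ}

theorem deriv_lift_ne_zero (hf : IsLogarithmicAbove f ρ) (hΦ : IsLogLift f ρ Φ) {ζ : ℂ}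
    (hζ : ζ ∈ rightHalfPlane ρ) : deriv f (Complex.exp (Φ ζ)) ≠ 0 :=
  hf.deriv_ne_zero _ (by rw [hΦ.2 ζ hζ]; exact exp_lt_norm_exp hζ)

theorem injOn_exp_lift (hf : IsLogarithmicAbove f ρ) (hΦ : IsLogLift f ρ Φ) :
    Set.InjOn (fun ζ => Complex.exp (Φ ζ)) (rightHalfPlane ρ) := by
  have key : ∀ ζ ∈ rightHalfPlane ρ, ∀ n : ℤ, 0 < n →
      Complex.exp (Φ (ζ + n * (2 * Real.pi * Complex.I))) ≠ Complex.exp (Φ ζ) := by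
    intro ζ hζ n hn heq
    have hc : DifferentiableOn ℂ (fun ζ => Complex.exp (Φ ζ)) (rightHalfPlane ρ) := hΦ.1.cexp
    have hE := eqOn_of_comp_eqOn_of_deriv_ne_zero hf.differentiable
      (isPreconnected_rightHalfPlane ρ)
      (g₁ := fun ζ => Complex.exp (Φ (ζ + n * (2 * Real.pi * Complex.I))))
      (g₂ := fun ζ => Complex.exp (Φ ζ))
      (differentiableOn_comp_add_mul_I hc n).continuousOn hc.continuousOn
      (fun t ht => hf.deriv_lift_ne_zero hΦ (add_mul_I_mem_rightHalfPlane ht n))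
      (fun t ht => hf.deriv_lift_ne_zero hΦ ht)
      (fun t ht => by
        simp only [hΦ.2 _ (add_mul_I_mem_rightHalfPlane ht n), hΦ.2 t ht, exp_add_mul_I])
      hζ heq
    lift n to ℕ using hn.le
    refine hf.not_polynomial (exists_polynomial_of_periodic_lift hf.differentiable hc
      (fun ζ hζ => hΦ.2 ζ hζ) (fun ζ _ => Complex.exp_ne_zero _) (l := n) (by exact_mod_cast hn)
      fun ζ hζ => ?_)
    have := hE hζ
    simp only [Int.cast_natCast] at this
    rw [← this]
    ring_nf
  intro ζ₁ h₁ ζ₂ h₂ he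
  have h := congrArg f he
  simp only [hΦ.2 _ h₁, hΦ.2 _ h₂] at h
  obtain ⟨n, hn⟩ := Complex.exp_eq_exp_iff_exists_int.1 h
  rcases lt_trichotomy n 0 with h0 | h0 | h0
  · refine absurd ?_ (key ζ₁ h₁ (-n) (by omega))
    rw [show ζ₁ + ((-n : ℤ) : ℂ) * (2 * Real.pi * Complex.I) = ζ₂ by rw [hn]; push_cast; ring]
    exact he.symm
  · simpa [h0] using hn
  · refine absurd ?_ (key ζ₂ h₂ n h0)
    rw [← hn]
    exact he

theorem univalent_lift (hf : IsLogarithmicAbove f ρ) (hΦ : IsLogLift f ρ Φ) :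
    Univalent Φ (rightHalfPlane ρ) :=
  ⟨hΦ.1, fun _ h₁ _ h₂ he => hf.injOn_exp_lift hΦ h₁ h₂ (congrArg Complex.exp he),
    fun _ hζ => hΦ.deriv_ne_zero hf.differentiable hζ⟩

theorem norm_deriv_lift_le (hf : IsLogarithmicAbove f ρ) (hΦ : IsLogLift f ρ Φ) {ζ : ℂ}
    (hζ : ζ ∈ rightHalfPlane ρ) : (ζ.re - ρ) * ‖deriv Φ ζ‖ ≤ 36 * Real.pi := by
  have hr : 0 < ζ.re - ρ := sub_pos.2 hζ
  have hsub : Metric.ball ζ (ζ.re - ρ) ⊆ rightHalfPlane ρ := by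
    intro w hw
    have h1 : |(w - ζ).re| ≤ ‖w - ζ‖ := Complex.abs_re_le_norm _
    rw [Metric.mem_ball, dist_eq_norm] at hw
    have h2 := (abs_le.1 (h1.trans hw.le)).1
    have h3 := (abs_lt.1 (h1.trans_lt hw)).1
    simp only [Complex.sub_re] at h3
    simp only [rightHalfPlane, Set.mem_ofPred_eq]
    linarith
  by_contra! hlt
  have hb := ((hf.univalent_lift hΦ).mono hsub).ball_subset_image hr
  have hmem : Φ ζ + 2 * Real.pi * Complex.I ∈
      Metric.ball (Φ ζ) ((ζ.re - ρ) * ‖deriv Φ ζ‖ / 18) := by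
    have : ‖(2 * Real.pi * Complex.I : ℂ)‖ = 2 * Real.pi := by
      simp [abs_of_pos Real.pi_pos]
    rw [Metric.mem_ball, dist_eq_norm, add_sub_cancel_left, this]
    linarith
  obtain ⟨w, hw, hw2⟩ := hb hmem
  have := hf.injOn_exp_lift hΦ (hsub hw) hζ (by
    simp only [hw2]
    simpa using exp_add_mul_I (Φ ζ) 1)
  rw [this] at hw2
  simp [Real.pi_ne_zero] at hw2

theorem image_lift_eq (hf : IsLogarithmicAbove f ρ) (hΦ : IsLogLift f ρ Φ) (hΨ : IsLogLift f ρ Ψ)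
    (h : ¬ Disjoint (Φ '' rightHalfPlane ρ) (Ψ '' rightHalfPlane ρ)) :
    Φ '' rightHalfPlane ρ = Ψ '' rightHalfPlane ρ := by
  have key : ∀ Φ Ψ, IsLogLift f ρ Φ → IsLogLift f ρ Ψ → ∀ ζ ∈ rightHalfPlane ρ,
      ∀ ξ ∈ rightHalfPlane ρ, Φ ζ = Ψ ξ → Φ '' rightHalfPlane ρ ⊆ Ψ '' rightHalfPlane ρ := by
    intro Φ Ψ hΦ hΨ ζ hζ ξ hξ he
    have h := congrArg (fun z => f (Complex.exp z)) he
    simp only [hΦ.2 _ hζ, hΨ.2 _ hξ] at h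
    obtain ⟨n, hn⟩ := Complex.exp_eq_exp_iff_exists_int.1 h.symm
    have hE := eqOn_of_comp_eqOn_of_deriv_ne_zero
      (F := fun z => f (Complex.exp z))
      (hf.differentiable.comp Complex.differentiable_exp)
      (isPreconnected_rightHalfPlane ρ)
      hΦ.1.continuousOn (differentiableOn_comp_add_mul_I hΨ.1 n).continuousOn
      (fun t ht => by
        rw [deriv_comp_exp hf.differentiable]
        exact mul_ne_zero (hf.deriv_lift_ne_zero hΦ ht) (Complex.exp_ne_zero _))
      (fun t ht => by
        rw [deriv_comp_exp hf.differentiable]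
        exact mul_ne_zero (hf.deriv_lift_ne_zero hΨ (add_mul_I_mem_rightHalfPlane ht n))
          (Complex.exp_ne_zero _))
      (fun t ht => by
        rw [hΦ.2 t ht, hΨ.2 _ (add_mul_I_mem_rightHalfPlane ht n), exp_add_mul_I])
      hζ (by rw [he, hn])
    rintro _ ⟨t, ht, rfl⟩
    exact ⟨_, add_mul_I_mem_rightHalfPlane ht n, (hE ht).symm⟩
  obtain ⟨_, ⟨ζ, hζ, rfl⟩, ξ, hξ, he⟩ := Set.not_disjoint_iff.1 h
  exact (key Φ Ψ hΦ hΨ ζ hζ ξ hξ he.symm).antisymm (key Ψ Φ hΨ hΦ ξ hξ ζ hζ he)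

theorem isOpen_image_lift (hf : IsLogarithmicAbove f ρ) (hΦ : IsLogLift f ρ Φ) :
    IsOpen (Φ '' rightHalfPlane ρ) := by
  rw [isOpen_iff_mem_nhds]
  rintro _ ⟨ζ, hζ, rfl⟩
  obtain ⟨r, hr, hsub⟩ := Metric.isOpen_iff.1 (isOpen_rightHalfPlane ρ) ζ hζ
  have hb := ((hf.univalent_lift hΦ).mono hsub).ball_subset_image hr
  refine mem_of_superset (Metric.ball_mem_nhds _ ?_) (hb.trans (Set.image_mono hsub))
  have := norm_pos_iff.2 (hΦ.deriv_ne_zero hf.differentiable hζ)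
  positivity

theorem exists_lift (hf : IsLogarithmicAbove f ρ) {z : ℂ}
    (hz : Real.exp ρ < ‖f (Complex.exp z)‖) :
    ∃ Φ, IsLogLift f ρ Φ ∧ z ∈ Φ '' rightHalfPlane ρ :=
  exists_isLogLift hf.differentiable hf.deriv_ne_zero hf.asymptotic_le hf.norm_zero_le hz

/-- Every circle about the origin meets `{‖f‖ ≤ exp ρ}`. -/
theorem exists_norm_exp_le (hf : IsLogarithmicAbove f ρ) (t : ℝ) :
    ∃ θ : ℝ, ‖f (Complex.exp (t + θ * Complex.I))‖ ≤ Real.exp ρ := by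
  by_contra! hcon
  set S : Set ℂ := Set.range fun θ : ℝ => (t + θ * Complex.I : ℂ) with hS
  have hSc : IsPreconnected S := isPreconnected_range (by fun_prop)
  have hSf : ∀ z ∈ S, Real.exp ρ < ‖f (Complex.exp z)‖ := by
    rintro _ ⟨θ, rfl⟩; exact hcon θ
  have h0 : (t : ℂ) ∈ S := ⟨0, by simp⟩
  have h1 : (t + 2 * Real.pi * Complex.I : ℂ) ∈ S := ⟨2 * Real.pi, by simp⟩
  obtain ⟨Φ, hΦ, hΦ0⟩ := hf.exists_lift (hSf _ h0)
  set V : Set ℂ := ⋃₀ {W | ∃ Ψ, IsLogLift f ρ Ψ ∧ W = Ψ '' rightHalfPlane ρ ∧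
    Disjoint (Φ '' rightHalfPlane ρ) W} with hV
  have hVo : IsOpen V := by
    refine isOpen_sUnion ?_
    rintro _ ⟨Ψ, hΨ, rfl, -⟩
    exact hf.isOpen_image_lift hΨ
  have hsub : S ⊆ Φ '' rightHalfPlane ρ := by
    refine hSc.subset_left_of_subset_union (hf.isOpen_image_lift hΦ) hVo ?_ ?_ ⟨_, h0, hΦ0⟩
    · refine Set.disjoint_sUnion_right.2 ?_
      rintro _ ⟨Ψ, hΨ, rfl, hd⟩
      exact hd
    · intro z hz
      obtain ⟨Ψ, hΨ, hΨz⟩ := hf.exists_lift (hSf z hz)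
      by_cases hd : Disjoint (Φ '' rightHalfPlane ρ) (Ψ '' rightHalfPlane ρ)
      · exact Or.inr ⟨_, ⟨Ψ, hΨ, rfl, hd⟩, hΨz⟩
      · exact Or.inl (by rw [hf.image_lift_eq hΦ hΨ hd]; exact hΨz)
  obtain ⟨ζ, hζ, hζe⟩ := hΦ0
  obtain ⟨ξ, hξ, hξe⟩ := hsub h1
  have := hf.injOn_exp_lift hΦ hξ hζ (by
    simp only [hξe, hζe]
    simpa using exp_add_mul_I t 1)
  rw [this, hζe] at hξe
  simp [Real.pi_ne_zero] at hξe

end IsLogarithmicAbove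

theorem hasDerivAt_sq_mul_of_bounded {W ψ : ℝ → ℝ} {W' x B : ℝ} (hW : HasDerivAt W W' x)
    (h0 : W x = 0) (hψ : ∀ y, |ψ y| ≤ B) : HasDerivAt (fun y => W y ^ 2 * ψ y) 0 x := by
  have h1 : W =O[𝓝 x] fun y => y - x := by simpa [h0] using hW.isBigO_sub
  have h2 : (fun y => W y * ψ y) =o[𝓝 x] fun _ => (1 : ℝ) := by
    rw [Asymptotics.isLittleO_one_iff]
    have h3 : Tendsto (fun y => |W y| * B) (𝓝 x) (𝓝 0) := by
      have := (hW.continuousAt.tendsto.abs.mul_const B)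
      simpa [h0] using this
    refine squeeze_zero_norm (fun y => ?_) h3
    rw [Real.norm_eq_abs, abs_mul]
    exact mul_le_mul_of_nonneg_left (hψ y) (abs_nonneg _)
  rw [hasDerivAt_iff_isLittleO]
  refine ((h1.mul_isLittleO h2).congr_left fun y => ?_).congr_right fun y => ?_
  · simp [h0]; ring
  · simp

theorem hasDerivAt_cot {x : ℝ} (hx : Real.sin x ≠ 0) :
    HasDerivAt Real.cot (-(1 + Real.cot x ^ 2)) x := by
  have h : HasDerivAt (fun y => Real.cos y / Real.sin y)
      ((-Real.sin x * Real.sin x - Real.cos x * Real.cos x) / Real.sin x ^ 2) x :=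
    (Real.hasDerivAt_cos x).div (Real.hasDerivAt_sin x) hx
  have e : (fun y => Real.cos y / Real.sin y) = Real.cot := by
    ext y; rw [Real.cot_eq_cos_div_sin]
  rw [e] at h
  convert h using 1
  rw [Real.cot_eq_cos_div_sin]
  field_simp
  ring

/-- Wirtinger's inequality for functions supported on a set of measure at most `Θ`. -/
theorem sq_mul_integral_sq_le_integral_deriv_sq {W W' : ℝ → ℝ} {a b Θ : ℝ} (hab : a ≤ b)
    (hW : ∀ x, HasDerivAt W (W' x) x) (hW' : Continuous W') (ha : W a = 0) (hb : W b = 0)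
    (hΘ : 0 < Θ) (hE : ∫ x in a..b, {x | W x ≠ 0}.indicator (1 : ℝ → ℝ) x ≤ Θ) :
    (Real.pi / Θ) ^ 2 * ∫ x in a..b, W x ^ 2 ≤ ∫ x in a..b, W' x ^ 2 := by
  have hWc : Continuous W := continuous_iff_continuousAt.2 fun x => (hW x).continuousAt
  set E : Set ℝ := {x | W x ≠ 0} with hEdef
  have hEo : IsOpen E := isOpen_ne_fun hWc continuous_const
  set e : ℝ → ℝ := E.indicator 1 with he
  have he0 : ∀ x, 0 ≤ e x := fun x => Set.indicator_nonneg (fun _ _ => zero_le_one) x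
  have hei : ∀ c d, IntervalIntegrable e volume c d := by
    intro c d
    rw [intervalIntegrable_iff]
    refine Integrable.indicator ?_ hEo.measurableSet
    exact (continuous_const (y := (1 : ℝ))).integrableOn_uIoc
  suffices key : ∀ α, 0 < α → α < Real.pi / Θ →
      α ^ 2 * ∫ x in a..b, W x ^ 2 ≤ ∫ x in a..b, W' x ^ 2 by
    have hlim : Tendsto (fun α : ℝ => α ^ 2 * ∫ x in a..b, W x ^ 2) (𝓝[<] (Real.pi / Θ))
        (𝓝 ((Real.pi / Θ) ^ 2 * ∫ x in a..b, W x ^ 2)) :=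
      Tendsto.mono_left (Continuous.tendsto (by fun_prop) _) nhdsWithin_le_nhds
    refine le_of_tendsto hlim ?_
    have hpos : 0 < Real.pi / Θ := by have := Real.pi_pos; positivity
    filter_upwards [Ioo_mem_nhdsLT hpos] with α hα using key α hα.1 hα.2
  intro α hα0 hα
  have hαΘ : α * Θ < Real.pi := (lt_div_iff₀ hΘ).1 hα
  set η : ℝ := (Real.pi - α * Θ) / 2 with hη
  have hη0 : 0 < η := by rw [hη]; linarith
  set μ : ℝ → ℝ := fun x => max 0 (min Θ (∫ y in a..x, e y)) with hμ
  set ψ : ℝ → ℝ := fun x => α * Real.cot (α * μ x + η) with hψ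
  have hμm : ∀ x, μ x ∈ Set.Icc 0 Θ := fun x =>
    ⟨le_max_left _ _, max_le hΘ.le (min_le_left _ _)⟩
  have hcotc : ContinuousOn (fun s => α * Real.cot (α * s + η)) (Set.Icc 0 Θ) := by
    intro s hs
    refine ContinuousAt.continuousWithinAt ?_
    have hs' : Real.sin (α * s + η) ≠ 0 := by
      refine (Real.sin_pos_of_pos_of_lt_pi ?_ ?_).ne'
      · have := mul_nonneg hα0.le hs.1; linarith
      · have := mul_le_mul_of_nonneg_left hs.2 hα0.le
        linarith
    exact ((hasDerivAt_cot hs').continuousAt.comp (f := fun s => α * s + η)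
      (by fun_prop)).const_mul α
  obtain ⟨B, hB⟩ := isCompact_Icc.exists_bound_of_continuousOn hcotc
  have hψB : ∀ x, |ψ x| ≤ B := fun x => hB _ (hμm x)
  have hmono : ∀ x ∈ Set.Icc a b, (∫ y in a..x, e y) ∈ Set.Icc 0 Θ := by
    intro x hx
    refine ⟨intervalIntegral.integral_nonneg hx.1 fun y _ => he0 y, le_trans ?_ hE⟩
    exact intervalIntegral.integral_mono_interval le_rfl hx.1 hx.2
      (Eventually.of_forall he0) (hei a b)
  have hμeq : ∀ x ∈ Set.Icc a b, μ x = ∫ y in a..x, e y := fun x hx => by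
    simp only [hμ]; rw [min_eq_right (hmono x hx).2, max_eq_right (hmono x hx).1]
  have hderiv : ∀ x ∈ Set.Ioo a b, ∃ g', HasDerivAt (fun y => W y ^ 2 * ψ y) g' x ∧
      g' ≤ W' x ^ 2 - α ^ 2 * W x ^ 2 := by
    intro x hx
    by_cases h0 : W x = 0
    · refine ⟨0, hasDerivAt_sq_mul_of_bounded (hW x) h0 hψB, ?_⟩
      rw [h0]; nlinarith [sq_nonneg (W' x)]
    · have h1 : HasDerivAt (fun u => ∫ y in a..u, e y) 1 x := by
        have hex : e x = 1 := Set.indicator_of_mem (show x ∈ E from h0) _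
        have hev : e =ᶠ[𝓝 x] fun _ => 1 := by
          filter_upwards [hEo.mem_nhds (show x ∈ E from h0)] with y hy
          exact Set.indicator_of_mem hy _
        have h2 : ContinuousAt e x := continuousAt_const.congr hev.symm
        rw [← hex]
        refine intervalIntegral.integral_hasDerivAt_right (hei a x) ?_ h2
        have hm : Measurable e := measurable_one.indicator hEo.measurableSet
        exact hm.stronglyMeasurable.stronglyMeasurableAtFilter
      have h2 : HasDerivAt μ 1 x := by
        refine h1.congr_of_eventuallyEq ?_
        filter_upwards [Ioo_mem_nhds hx.1 hx.2] with y hy using hμeq y ⟨hy.1.le, hy.2.le⟩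
      have hs' : Real.sin (α * μ x + η) ≠ 0 := by
        have hs := hμm x
        refine (Real.sin_pos_of_pos_of_lt_pi ?_ ?_).ne'
        · have := mul_nonneg hα0.le hs.1; linarith
        · have := mul_le_mul_of_nonneg_left hs.2 hα0.le
          linarith
      have h3 : HasDerivAt ψ (α * (-(1 + Real.cot (α * μ x + η) ^ 2) * (α * 1))) x :=
        (HasDerivAt.comp x (h₂ := Real.cot) (h := fun x => α * μ x + η) (hasDerivAt_cot hs')
          ((h2.const_mul α).add_const η)).const_mul α
      have h4 : HasDerivAt (fun y => W y ^ 2 * ψ y) _ x := ((hW x).pow 2).mul h3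
      refine ⟨_, h4, ?_⟩
      have e3 : α * (-(1 + Real.cot (α * μ x + η) ^ 2) * (α * 1)) = -(α ^ 2 + ψ x ^ 2) := by
        simp only [hψ]; ring
      rw [e3]
      simp only [Nat.cast_ofNat, Nat.add_one_sub_one, pow_one]
      simp only [Pi.pow_apply]
      nlinarith [sq_nonneg (W' x - W x * ψ x)]
  have hcont : Continuous fun y => W y ^ 2 * ψ y := by
    have hμc : Continuous μ := by
      have : Continuous fun x => ∫ y in a..x, e y :=
        intervalIntegral.continuous_primitive hei a
      fun_prop
    refine (hWc.pow 2).mul ?_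
    exact hcotc.comp_continuous hμc hμm
  choose! g' hg' hg'le using hderiv
  have hc2 : Continuous fun y => W' y ^ 2 - α ^ 2 * W y ^ 2 := by fun_prop
  have := intervalIntegral.sub_le_integral_of_hasDeriv_right_of_le hab hcont.continuousOn
    (fun x hx => (hg' x hx).hasDerivWithinAt) hc2.integrableOn_Icc hg'le
  rw [intervalIntegral.integral_sub (by apply Continuous.intervalIntegrable; fun_prop)
    (by apply Continuous.intervalIntegrable; fun_prop),
    intervalIntegral.integral_const_mul] at this
  simp only [ha, hb] at this
  simp at this
  linarith

/-- A convex `C²` function vanishing on `(-∞, 0]`, positive on `(0, ∞)`, with derivative in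
`[0, 1]`. -/
noncomputable def smoothPos (s : ℝ) : ℝ := (max s 0) ^ 3 / (1 + max s 0) ^ 2

/-- The derivative of `smoothPos`. -/
noncomputable def smoothPosDeriv (s : ℝ) : ℝ :=
  (max s 0) ^ 2 * (3 + max s 0) / (1 + max s 0) ^ 3

/-- The second derivative of `smoothPos`. -/
noncomputable def smoothPosDerivTwo (s : ℝ) : ℝ := 6 * max s 0 / (1 + max s 0) ^ 4

theorem one_add_max_pos (s : ℝ) : 0 < 1 + max s 0 := by
  have := le_max_right s 0; linarith

theorem continuous_smoothPos : Continuous smoothPos :=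
  Continuous.div (by fun_prop) (by fun_prop) fun s => (pow_pos (one_add_max_pos s) _).ne'

theorem continuous_smoothPosDeriv : Continuous smoothPosDeriv :=
  Continuous.div (by fun_prop) (by fun_prop) fun s => (pow_pos (one_add_max_pos s) _).ne'

theorem continuous_smoothPosDerivTwo : Continuous smoothPosDerivTwo :=
  Continuous.div (by fun_prop) (by fun_prop) fun s => (pow_pos (one_add_max_pos s) _).ne'

theorem smoothPos_of_nonpos {s : ℝ} (hs : s ≤ 0) : smoothPos s = 0 := by
  simp [smoothPos, max_eq_right hs]

theorem smoothPosDeriv_of_nonpos {s : ℝ} (hs : s ≤ 0) : smoothPosDeriv s = 0 := by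
  simp [smoothPosDeriv, max_eq_right hs]

theorem smoothPosDerivTwo_of_nonpos {s : ℝ} (hs : s ≤ 0) : smoothPosDerivTwo s = 0 := by
  simp [smoothPosDerivTwo, max_eq_right hs]

theorem smoothPos_nonneg (s : ℝ) : 0 ≤ smoothPos s := by
  have := one_add_max_pos s
  have := le_max_right s 0
  unfold smoothPos; positivity

theorem smoothPos_pos {s : ℝ} (hs : 0 < s) : 0 < smoothPos s := by
  unfold smoothPos; rw [max_eq_left hs.le]; positivity

theorem smoothPosDerivTwo_nonneg (s : ℝ) : 0 ≤ smoothPosDerivTwo s := by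
  have := one_add_max_pos s
  have := le_max_right s 0
  unfold smoothPosDerivTwo; positivity

theorem smoothPos_le (s : ℝ) : smoothPos s ≤ max s 0 := by
  have h1 := one_add_max_pos s
  have h2 := le_max_right s 0
  unfold smoothPos
  rw [div_le_iff₀ (by positivity)]
  nlinarith [pow_nonneg h2 2]

theorem smoothPosDeriv_le_one (s : ℝ) : smoothPosDeriv s ≤ 1 := by
  have h1 := one_add_max_pos s
  have h2 := le_max_right s 0
  unfold smoothPosDeriv
  rw [div_le_one (by positivity)]
  nlinarith [pow_nonneg h2 2]

theorem hasDerivAt_comp_max_zero {h h' : ℝ → ℝ} (hd : ∀ p, 0 ≤ p → HasDerivAt h (h' p) p)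
    (h0 : h' 0 = 0) (s : ℝ) : HasDerivAt (fun s => h (max s 0)) (h' (max s 0)) s := by
  rcases lt_trichotomy s 0 with hs | hs | hs
  · rw [max_eq_right hs.le, h0]
    refine (hasDerivAt_const s (h 0)).congr_of_eventuallyEq ?_
    filter_upwards [eventually_lt_nhds hs] with y hy
    rw [max_eq_right hy.le]
  · subst hs
    rw [max_self, h0]
    rw [← hasDerivWithinAt_univ, ← Set.Iic_union_Ici (a := (0 : ℝ))]
    refine HasDerivWithinAt.union ?_ ?_
    · refine (hasDerivWithinAt_const (0 : ℝ) (Set.Iic 0) (h 0)).congr (fun y hy => ?_) (by simp)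
      rw [max_eq_right hy]
    · have := (hd 0 le_rfl).hasDerivWithinAt (s := Set.Ici 0)
      rw [h0] at this
      refine this.congr (fun y hy => ?_) (by simp)
      rw [max_eq_left hy]
  · rw [max_eq_left hs.le]
    refine (hd s hs.le).congr_of_eventuallyEq ?_
    filter_upwards [eventually_gt_nhds hs] with y hy
    rw [max_eq_left hy.le]

theorem hasDerivAt_smoothPos (s : ℝ) : HasDerivAt smoothPos (smoothPosDeriv s) s := by
  refine hasDerivAt_comp_max_zero (h := fun p => p ^ 3 / (1 + p) ^ 2)
    (h' := fun p => p ^ 2 * (3 + p) / (1 + p) ^ 3) (fun p hp => ?_) (by simp) s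
  have h1 : 1 + p ≠ 0 := by positivity
  have := ((hasDerivAt_id p).pow 3).div (((hasDerivAt_id p).const_add 1).pow 2) (pow_ne_zero 2 h1)
  refine HasDerivAt.congr_deriv this ?_
  simp
  field_simp
  ring

theorem hasDerivAt_smoothPosDeriv (s : ℝ) :
    HasDerivAt smoothPosDeriv (smoothPosDerivTwo s) s := by
  refine hasDerivAt_comp_max_zero (h := fun p => p ^ 2 * (3 + p) / (1 + p) ^ 3)
    (h' := fun p => 6 * p / (1 + p) ^ 4) (fun p hp => ?_) (by simp) s
  have h1 : 1 + p ≠ 0 := by positivity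
  have := (((hasDerivAt_id p).pow 2).mul ((hasDerivAt_id p).const_add 3)).div
    (((hasDerivAt_id p).const_add 1).pow 3) (pow_ne_zero 3 h1)
  refine HasDerivAt.congr_deriv this ?_
  simp
  field_simp
  ring

theorem smoothPos_le_add {s t : ℝ} (hst : s ≤ t) : smoothPos t ≤ smoothPos s + (t - s) := by
  have h : Antitone fun x => smoothPos x - x := by
    refine antitone_of_deriv_nonpos (fun x => ?_) fun x => ?_
    · exact ((hasDerivAt_smoothPos x).sub (hasDerivAt_id x)).differentiableAt
    · have := ((hasDerivAt_smoothPos x).sub (hasDerivAt_id x)).deriv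
      change deriv (fun x => smoothPos x - id x) x = _ at this
      simp only [id] at this
      rw [this]
      linarith [smoothPosDeriv_le_one x]
  have := h hst
  simp only at this
  linarith

theorem hasDerivAt_log_norm_comp {F : ℂ → ℂ} (hF : Differentiable ℂ F) {γ : ℝ → ℂ} {c : ℂ} {s : ℝ}
    (hγ : HasDerivAt γ c s) (h0 : F (γ s) ≠ 0) :
    HasDerivAt (fun s => Real.log ‖F (γ s)‖) (c * logDeriv F (γ s)).re s := by
  have h1 : HasDerivAt (fun r => Complex.log (F (γ r) / F (γ s)))
      ((deriv F (γ s) * c / F (γ s)) / (F (γ s) / F (γ s))) s := by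
    refine HasDerivAt.clog_real ?_ (by simp [div_self h0])
    exact ((hF _).hasDerivAt.comp_of_eq s hγ rfl).div_const _
  have h2 : HasDerivAt (fun r => (Complex.log (F (γ r) / F (γ s))).re + Real.log ‖F (γ s)‖)
      (c * logDeriv F (γ s)).re s := by
    have := (Complex.reCLM.hasFDerivAt.comp_hasDerivAt s h1).add_const (Real.log ‖F (γ s)‖)
    refine this.congr_deriv ?_
    rw [div_self h0, div_one, logDeriv_apply]
    simp only [Complex.reCLM_apply]
    congr 1; ring
  refine h2.congr_of_eventuallyEq ?_
  have hne : ∀ᶠ r in 𝓝 s, F (γ r) ≠ 0 :=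
    (hF.continuous.continuousAt.comp hγ.continuousAt).eventually_ne h0
  filter_upwards [hne] with r hr
  rw [Complex.log_re, norm_div, Real.log_div (norm_ne_zero_iff.2 hr) (norm_ne_zero_iff.2 h0)]
  ring

theorem differentiableAt_logDeriv {F : ℂ → ℂ} (hF : Differentiable ℂ F) {z : ℂ} (h0 : F z ≠ 0) :
    DifferentiableAt ℂ (logDeriv F) z :=
  ((hF.analyticAt z).deriv.differentiableAt).div (hF z) h0

theorem hasDerivAt_re_mul_logDeriv_comp {F : ℂ → ℂ} (hF : Differentiable ℂ F) {γ : ℝ → ℂ}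
    {c d : ℂ} {s : ℝ} (hγ : HasDerivAt γ c s) (h0 : F (γ s) ≠ 0) :
    HasDerivAt (fun s => (d * logDeriv F (γ s)).re) (d * (deriv (logDeriv F) (γ s) * c)).re s :=
  Complex.reCLM.hasFDerivAt.comp_hasDerivAt s
    (((differentiableAt_logDeriv hF h0).hasDerivAt.comp_of_eq s hγ rfl).const_mul d)

section TractFunction

variable (F : ℂ → ℂ) (U : Set ℂ)

/-- The smoothed positive part of `log ‖F‖`, restricted to `U`. -/
noncomputable def tractFn : ℂ → ℝ := U.indicator fun z => smoothPos (Real.log ‖F z‖)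

/-- The derivative of `tractFn F U` in the direction `c`. -/
noncomputable def tractFnDeriv (c : ℂ) : ℂ → ℝ :=
  U.indicator fun z => smoothPosDeriv (Real.log ‖F z‖) * (c * logDeriv F z).re

/-- The second derivative of `tractFn F U` in the direction `c`. -/
noncomputable def tractFnDerivTwo (c : ℂ) : ℂ → ℝ :=
  U.indicator fun z => smoothPosDerivTwo (Real.log ‖F z‖) * (c * logDeriv F z).re ^ 2 +
    smoothPosDeriv (Real.log ‖F z‖) * (c * (deriv (logDeriv F) z * c)).re

/-- `U` is open and `‖F‖ < 1` on the part of its closure outside `U`. -/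
structure IsTractSet : Prop where
  differentiable : Differentiable ℂ F
  isOpen : IsOpen U
  norm_lt_one : ∀ z ∈ closure U, z ∉ U → ‖F z‖ < 1

variable {F U}

theorem log_norm_nonpos_of_lt_one {z : ℂ} (h : ‖F z‖ < 1) : Real.log ‖F z‖ ≤ 0 :=
  Real.log_nonpos (norm_nonneg _) h.le

theorem IsTractSet.eventually_or (h : IsTractSet F U) (z : ℂ) :
    (∀ᶠ w in 𝓝 z, tractFn F U w = 0 ∧ (∀ c, tractFnDeriv F U c w = 0) ∧
      ∀ c, tractFnDerivTwo F U c w = 0) ∨ (F z ≠ 0 ∧ U ∈ 𝓝 z) := by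
  have hzero : ∀ w, (w ∉ U ∨ ‖F w‖ < 1) → tractFn F U w = 0 ∧ (∀ c, tractFnDeriv F U c w = 0) ∧
      ∀ c, tractFnDerivTwo F U c w = 0 := by
    rintro w (hw | hw)
    · simp [tractFn, tractFnDeriv, tractFnDerivTwo, hw]
    · have := log_norm_nonpos_of_lt_one hw
      simp [tractFn, tractFnDeriv, tractFnDerivTwo, smoothPos_of_nonpos this,
        smoothPosDeriv_of_nonpos this, smoothPosDerivTwo_of_nonpos this]
  by_cases h1 : ‖F z‖ < 1
  · left
    filter_upwards [h.differentiable.continuous.norm.continuousAt.eventually_lt_const h1] with w hw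
      using hzero w (Or.inr hw)
  by_cases h2 : z ∈ U
  · right
    refine ⟨fun h0 => h1 (by simp [h0]), h.isOpen.mem_nhds h2⟩
  · left
    have h3 : z ∉ closure U := fun hc => h1 (h.norm_lt_one z hc h2)
    filter_upwards [isClosed_closure.isOpen_compl.mem_nhds h3] with w hw
      using hzero w (Or.inl fun hU => hw (subset_closure hU))

theorem IsTractSet.continuous_tractFn (h : IsTractSet F U) : Continuous (tractFn F U) := by
  refine continuous_iff_continuousAt.2 fun z => ?_
  rcases h.eventually_or z with h0 | ⟨h0, hU⟩
  · exact continuousAt_const.congr (h0.mono fun w hw => hw.1.symm)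
  · have : ContinuousAt (fun z => smoothPos (Real.log ‖F z‖)) z :=
      continuous_smoothPos.continuousAt.comp (h.differentiable.continuous.norm.continuousAt.log
        (norm_ne_zero_iff.2 h0))
    refine this.congr ?_
    filter_upwards [hU] with w hw
    exact (Set.indicator_of_mem hw fun z => smoothPos (Real.log ‖F z‖)).symm

theorem IsTractSet.continuous_tractFnDeriv (h : IsTractSet F U) (c : ℂ) :
    Continuous (tractFnDeriv F U c) := by
  refine continuous_iff_continuousAt.2 fun z => ?_
  rcases h.eventually_or z with h0 | ⟨h0, hU⟩
  · exact continuousAt_const.congr (h0.mono fun w hw => (hw.2.1 c).symm)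
  · have h1 : ContinuousAt (fun z => smoothPosDeriv (Real.log ‖F z‖)) z :=
      continuous_smoothPosDeriv.continuousAt.comp
        (h.differentiable.continuous.norm.continuousAt.log (norm_ne_zero_iff.2 h0))
    have h2 : ContinuousAt (fun z => (c * logDeriv F z).re) z :=
      Complex.continuous_re.continuousAt.comp
        ((differentiableAt_logDeriv h.differentiable h0).continuousAt.const_mul c)
    refine (h1.mul h2).congr ?_
    filter_upwards [hU] with w hw
    exact (Set.indicator_of_mem hw _).symm

theorem IsTractSet.continuous_tractFnDerivTwo (h : IsTractSet F U) (c : ℂ) :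
    Continuous (tractFnDerivTwo F U c) := by
  refine continuous_iff_continuousAt.2 fun z => ?_
  rcases h.eventually_or z with h0 | ⟨h0, hU⟩
  · exact continuousAt_const.congr (h0.mono fun w hw => (hw.2.2 c).symm)
  · have hl : ContinuousAt (fun z => Real.log ‖F z‖) z :=
      h.differentiable.continuous.norm.continuousAt.log (norm_ne_zero_iff.2 h0)
    have h1 : ContinuousAt (fun z => smoothPosDeriv (Real.log ‖F z‖)) z :=
      continuous_smoothPosDeriv.continuousAt.comp hl
    have h2 : ContinuousAt (fun z => (c * logDeriv F z).re) z :=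
      Complex.continuous_re.continuousAt.comp
        ((differentiableAt_logDeriv h.differentiable h0).continuousAt.const_mul c)
    have h3 : ContinuousAt (fun z => smoothPosDerivTwo (Real.log ‖F z‖)) z :=
      continuous_smoothPosDerivTwo.continuousAt.comp hl
    have han : AnalyticAt ℂ (logDeriv F) z :=
      (h.differentiable.analyticAt z).deriv.div (h.differentiable.analyticAt z) h0
    have h4 : ContinuousAt (fun z => (c * (deriv (logDeriv F) z * c)).re) z :=
      Complex.continuous_re.continuousAt.comp
        ((han.deriv.continuousAt.mul_const c).const_mul c)
    refine ((h3.mul (h2.pow 2)).add (h1.mul h4)).congr ?_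
    filter_upwards [hU] with w hw
    exact (Set.indicator_of_mem hw _).symm

theorem IsTractSet.hasDerivAt_tractFn (h : IsTractSet F U) {γ : ℝ → ℂ} {c : ℂ} {s : ℝ}
    (hγ : HasDerivAt γ c s) :
    HasDerivAt (fun r => tractFn F U (γ r)) (tractFnDeriv F U c (γ s)) s := by
  rcases h.eventually_or (γ s) with h0 | ⟨h0, hU⟩
  · rw [h0.self_of_nhds.2.1 c]
    exact (hasDerivAt_const s (0 : ℝ)).congr_of_eventuallyEq
      ((hγ.continuousAt.eventually h0).mono fun r hr => hr.1)
  · have h1 := (hasDerivAt_smoothPos _).comp s (hasDerivAt_log_norm_comp h.differentiable hγ h0)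
    rw [tractFnDeriv, Set.indicator_of_mem (mem_of_mem_nhds hU)]
    refine h1.congr_of_eventuallyEq ?_
    filter_upwards [hγ.continuousAt.eventually hU] with r hr
    exact Set.indicator_of_mem hr _

theorem IsTractSet.hasDerivAt_tractFnDeriv (h : IsTractSet F U) {γ : ℝ → ℂ} {c : ℂ} {s : ℝ}
    (hγ : HasDerivAt γ c s) :
    HasDerivAt (fun r => tractFnDeriv F U c (γ r)) (tractFnDerivTwo F U c (γ s)) s := by
  rcases h.eventually_or (γ s) with h0 | ⟨h0, hU⟩
  · rw [h0.self_of_nhds.2.2 c]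
    exact (hasDerivAt_const s (0 : ℝ)).congr_of_eventuallyEq
      ((hγ.continuousAt.eventually h0).mono fun r hr => hr.2.1 c)
  · have h1 := ((hasDerivAt_smoothPosDeriv _).comp s
      (hasDerivAt_log_norm_comp h.differentiable hγ h0)).mul
      (hasDerivAt_re_mul_logDeriv_comp (d := c) h.differentiable hγ h0)
    rw [tractFnDerivTwo, Set.indicator_of_mem (mem_of_mem_nhds hU)]
    refine (h1.congr_deriv ?_).congr_of_eventuallyEq ?_
    · simp only [Function.comp_apply]; ring
    filter_upwards [hγ.continuousAt.eventually hU] with r hr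
    exact Set.indicator_of_mem hr _

theorem tractFn_nonneg (z : ℂ) : 0 ≤ tractFn F U z :=
  Set.indicator_nonneg (fun _ _ => smoothPos_nonneg _) z

theorem tractFnDerivTwo_add_nonneg (z : ℂ) :
    0 ≤ tractFnDerivTwo F U 1 z + tractFnDerivTwo F U Complex.I z := by
  by_cases hz : z ∈ U
  · rw [tractFnDerivTwo, tractFnDerivTwo, Set.indicator_of_mem hz, Set.indicator_of_mem hz]
    have h1 := smoothPosDerivTwo_nonneg (Real.log ‖F z‖)
    have e : Complex.I * (deriv (logDeriv F) z * Complex.I) = -deriv (logDeriv F) z := by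
      rw [mul_comm (deriv (logDeriv F) z), ← mul_assoc, Complex.I_mul_I]; ring
    rw [e]
    simp only [one_mul, mul_one, Complex.neg_re]
    nlinarith [mul_nonneg h1 (sq_nonneg (logDeriv F z).re),
      mul_nonneg h1 (sq_nonneg (Complex.I * logDeriv F z).re)]
  · simp [tractFnDerivTwo, hz]

theorem tractFn_ne_zero_iff {z : ℂ} : tractFn F U z ≠ 0 ↔ z ∈ U ∧ 1 < ‖F z‖ := by
  by_cases hz : z ∈ U
  · rw [tractFn, Set.indicator_of_mem hz]
    simp only [hz, true_and]
    constructor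
    · intro h
      by_contra! hle
      exact h (smoothPos_of_nonpos (Real.log_nonpos (norm_nonneg _) hle))
    · intro h
      exact (smoothPos_pos (Real.log_pos h)).ne'
  · simp [tractFn, hz]

end TractFunction

theorem hasDerivAt_intervalIntegral_of_continuous {F F' : ℝ → ℝ → ℝ} {a b : ℝ}
    (hF : Continuous (Function.uncurry F)) (hF' : Continuous (Function.uncurry F'))
    (hd : ∀ t θ, HasDerivAt (fun s => F s θ) (F' t θ) t) (t : ℝ) :
    HasDerivAt (fun s => ∫ θ in a..b, F s θ) (∫ θ in a..b, F' t θ) t := by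
  obtain ⟨B, hB⟩ := ((isCompact_closedBall t 1).prod (isCompact_uIcc (a := a) (b := b)))
    |>.exists_bound_of_continuousOn hF'.continuousOn
  refine (intervalIntegral.hasDerivAt_integral_of_dominated_loc_of_deriv_le
    (F := F) (F' := F') (bound := fun _ => B) (Metric.ball_mem_nhds t one_pos) ?_ ?_ ?_ ?_ ?_ ?_).2
  · exact Eventually.of_forall fun s =>
      (hF.comp (Continuous.prodMk_right s)).aestronglyMeasurable
  · exact (hF.comp (Continuous.prodMk_right t)).intervalIntegrable _ _
  · exact (hF'.comp (Continuous.prodMk_right t)).aestronglyMeasurable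
  · refine Eventually.of_forall fun θ hθ s hs => ?_
    exact hB (s, θ) ⟨Metric.ball_subset_closedBall hs, Set.uIoc_subset_uIcc hθ⟩
  · exact intervalIntegrable_const
  · exact Eventually.of_forall fun θ _ s _ => hd s θ

theorem hasDerivAt_add_mul_I_left (t θ : ℝ) :
    HasDerivAt (fun s : ℝ => (s + θ * Complex.I : ℂ)) 1 t :=
  (Complex.ofRealCLM.hasDerivAt (x := t)).add_const _

theorem hasDerivAt_add_mul_I_right (t θ : ℝ) :
    HasDerivAt (fun s : ℝ => (t + s * Complex.I : ℂ)) Complex.I θ := by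
  simpa using ((Complex.ofRealCLM.hasDerivAt (x := θ)).mul_const Complex.I).const_add (t : ℂ)

/-- A tract set invariant under translation by `2πi`. -/
structure IsPeriodicTractSet (F : ℂ → ℂ) (U : Set ℂ) : Prop extends IsTractSet F U where
  periodic : Function.Periodic F (2 * Real.pi * Complex.I)
  mem_iff : ∀ z, z + 2 * Real.pi * Complex.I ∈ U ↔ z ∈ U

/-- The mean square of `tractFn F U` over vertical segments. -/
noncomputable def tractEnergy (F : ℂ → ℂ) (U : Set ℂ) (t : ℝ) : ℝ :=
  ∫ θ in (0 : ℝ)..2 * Real.pi, tractFn F U (t + θ * Complex.I) ^ 2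

/-- The derivative of `tractEnergy`. -/
noncomputable def tractEnergyDeriv (F : ℂ → ℂ) (U : Set ℂ) (t : ℝ) : ℝ :=
  ∫ θ in (0 : ℝ)..2 * Real.pi,
    2 * tractFn F U (t + θ * Complex.I) * tractFnDeriv F U 1 (t + θ * Complex.I)

/-- The second derivative of `tractEnergy`. -/
noncomputable def tractEnergyDerivTwo (F : ℂ → ℂ) (U : Set ℂ) (t : ℝ) : ℝ :=
  ∫ θ in (0 : ℝ)..2 * Real.pi, (2 * tractFnDeriv F U 1 (t + θ * Complex.I) ^ 2 +
    2 * tractFn F U (t + θ * Complex.I) * tractFnDerivTwo F U 1 (t + θ * Complex.I))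

/-- The measure of the support of `tractFn F U` in a period of a vertical line. -/
noncomputable def tractWidth (F : ℂ → ℂ) (U : Set ℂ) (t : ℝ) : ℝ :=
  ∫ θ in (0 : ℝ)..2 * Real.pi,
    {θ : ℝ | tractFn F U (t + θ * Complex.I) ≠ 0}.indicator (1 : ℝ → ℝ) θ

section

variable {F : ℂ → ℂ} {U : Set ℂ}

theorem IsTractSet.hasDerivAt_tractEnergy (h : IsTractSet F U) (t : ℝ) :
    HasDerivAt (tractEnergy F U) (tractEnergyDeriv F U t) t := by
  have h0 := h.continuous_tractFn
  have h1 := h.continuous_tractFnDeriv 1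
  refine hasDerivAt_intervalIntegral_of_continuous
    (F := fun t θ => tractFn F U (t + θ * Complex.I) ^ 2)
    (F' := fun t θ => 2 * tractFn F U (t + θ * Complex.I) * tractFnDeriv F U 1 (t + θ * Complex.I))
    (by unfold Function.uncurry; fun_prop) (by unfold Function.uncurry; fun_prop)
    (fun t θ => ?_) t
  have : HasDerivAt (fun s : ℝ => tractFn F U (s + θ * Complex.I) ^ 2) _ t :=
    (h.hasDerivAt_tractFn (hasDerivAt_add_mul_I_left t θ)).pow 2
  simpa using this

theorem IsTractSet.hasDerivAt_tractEnergyDeriv (h : IsTractSet F U) (t : ℝ) :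
    HasDerivAt (tractEnergyDeriv F U) (tractEnergyDerivTwo F U t) t := by
  have h0 := h.continuous_tractFn
  have h1 := h.continuous_tractFnDeriv 1
  have h2 := h.continuous_tractFnDerivTwo 1
  refine hasDerivAt_intervalIntegral_of_continuous
    (F := fun t θ => 2 * tractFn F U (t + θ * Complex.I) * tractFnDeriv F U 1 (t + θ * Complex.I))
    (F' := fun t θ => (2 * tractFnDeriv F U 1 (t + θ * Complex.I) ^ 2 +
      2 * tractFn F U (t + θ * Complex.I) * tractFnDerivTwo F U 1 (t + θ * Complex.I)))
    (by unfold Function.uncurry; fun_prop) (by unfold Function.uncurry; fun_prop)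
    (fun t θ => ?_) t
  have := ((h.hasDerivAt_tractFn (hasDerivAt_add_mul_I_left t θ)).const_mul 2).mul
    (h.hasDerivAt_tractFnDeriv (hasDerivAt_add_mul_I_left t θ))
  refine this.congr_deriv ?_
  ring

theorem IsPeriodicTractSet.logDeriv_add (h : IsPeriodicTractSet F U) (z : ℂ) :
    logDeriv F (z + 2 * Real.pi * Complex.I) = logDeriv F z := by
  rw [logDeriv_apply, logDeriv_apply, h.periodic z, ← deriv_comp_add_const]
  congr 2
  exact funext h.periodic

theorem IsPeriodicTractSet.tractFn_add (h : IsPeriodicTractSet F U) (z : ℂ) :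
    tractFn F U (z + 2 * Real.pi * Complex.I) = tractFn F U z := by
  by_cases hz : z ∈ U
  · rw [tractFn, Set.indicator_of_mem hz, Set.indicator_of_mem ((h.mem_iff z).2 hz), h.periodic]
  · rw [tractFn, Set.indicator_of_notMem hz, Set.indicator_of_notMem (mt (h.mem_iff z).1 hz)]

theorem IsPeriodicTractSet.tractFnDeriv_add (h : IsPeriodicTractSet F U) (c z : ℂ) :
    tractFnDeriv F U c (z + 2 * Real.pi * Complex.I) = tractFnDeriv F U c z := by
  by_cases hz : z ∈ U
  · rw [tractFnDeriv, Set.indicator_of_mem hz, Set.indicator_of_mem ((h.mem_iff z).2 hz),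
      h.periodic, h.logDeriv_add]
  · rw [tractFnDeriv, Set.indicator_of_notMem hz, Set.indicator_of_notMem (mt (h.mem_iff z).1 hz)]

theorem ofReal_add_add_two_pi_mul_I (t θ : ℝ) :
    (t + ((θ + 2 * Real.pi : ℝ) : ℂ) * Complex.I : ℂ) =
      (t + θ * Complex.I) + 2 * Real.pi * Complex.I := by
  push_cast; ring

theorem IsPeriodicTractSet.le_tractEnergyDerivTwo (h : IsPeriodicTractSet F U) (t : ℝ) :
    ∫ θ in (0 : ℝ)..2 * Real.pi, (2 * tractFnDeriv F U 1 (t + θ * Complex.I) ^ 2 +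
      2 * tractFnDeriv F U Complex.I (t + θ * Complex.I) ^ 2) ≤ tractEnergyDerivTwo F U t := by
  have h0 := h.continuous_tractFn
  have h1 := h.continuous_tractFnDeriv 1
  have h2 := h.continuous_tractFnDerivTwo 1
  have h3 := h.continuous_tractFnDeriv Complex.I
  have h4 := h.continuous_tractFnDerivTwo Complex.I
  have hparts : ∫ θ in (0 : ℝ)..2 * Real.pi,
      (2 * tractFnDeriv F U Complex.I (t + θ * Complex.I) ^ 2 +
        2 * tractFn F U (t + θ * Complex.I) * tractFnDerivTwo F U Complex.I (t + θ * Complex.I))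
        = 0 := by
    have hd : ∀ θ : ℝ, HasDerivAt (fun θ : ℝ => 2 * tractFn F U (t + θ * Complex.I) *
        tractFnDeriv F U Complex.I (t + θ * Complex.I))
        (2 * tractFnDeriv F U Complex.I (t + θ * Complex.I) ^ 2 + 2 * tractFn F U
          (t + θ * Complex.I) * tractFnDerivTwo F U Complex.I (t + θ * Complex.I)) θ := by
      intro θ
      have := ((h.hasDerivAt_tractFn (hasDerivAt_add_mul_I_right t θ)).const_mul 2).mul
        (h.hasDerivAt_tractFnDeriv (hasDerivAt_add_mul_I_right t θ))
      refine this.congr_deriv ?_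
      ring
    rw [intervalIntegral.integral_eq_sub_of_hasDerivAt (fun θ _ => hd θ)
      (by apply Continuous.intervalIntegrable; fun_prop)]
    have e := ofReal_add_add_two_pi_mul_I t 0
    rw [zero_add] at e
    rw [e, h.tractFn_add, h.tractFnDeriv_add, sub_self]
  have hsum : tractEnergyDerivTwo F U t = ∫ θ in (0 : ℝ)..2 * Real.pi,
      ((2 * tractFnDeriv F U 1 (t + θ * Complex.I) ^ 2 +
        2 * tractFn F U (t + θ * Complex.I) * tractFnDerivTwo F U 1 (t + θ * Complex.I)) +
      (2 * tractFnDeriv F U Complex.I (t + θ * Complex.I) ^ 2 +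
        2 * tractFn F U (t + θ * Complex.I) *
          tractFnDerivTwo F U Complex.I (t + θ * Complex.I))) := by
    rw [intervalIntegral.integral_add (by apply Continuous.intervalIntegrable; fun_prop)
      (by apply Continuous.intervalIntegrable; fun_prop), hparts, add_zero, tractEnergyDerivTwo]
  rw [hsum]
  refine intervalIntegral.integral_mono_on (by positivity)
    (by apply Continuous.intervalIntegrable; fun_prop)
    (by apply Continuous.intervalIntegrable; fun_prop) fun θ _ => ?_
  have hW := tractFn_nonneg (F := F) (U := U) (t + θ * Complex.I)
  have hL := tractFnDerivTwo_add_nonneg (F := F) (U := U) (t + θ * Complex.I)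
  nlinarith [mul_nonneg hW hL]

theorem IsPeriodicTractSet.tractEnergyDerivTwo_nonneg (h : IsPeriodicTractSet F U) (t : ℝ) :
    0 ≤ tractEnergyDerivTwo F U t :=
  le_trans (intervalIntegral.integral_nonneg (by positivity) fun θ _ => by positivity)
    (h.le_tractEnergyDerivTwo t)

theorem IsPeriodicTractSet.monotone_tractEnergyDeriv (h : IsPeriodicTractSet F U) :
    Monotone (tractEnergyDeriv F U) :=
  monotone_of_hasDerivAt_nonneg (fun t => h.hasDerivAt_tractEnergyDeriv t)
    h.tractEnergyDerivTwo_nonneg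

theorem tractEnergy_nonneg (t : ℝ) : 0 ≤ tractEnergy F U t :=
  intervalIntegral.integral_nonneg (by positivity) fun θ _ => by positivity

/-- Carleman's differential inequality. -/
theorem IsPeriodicTractSet.carleman (h : IsPeriodicTractSet F U) {t θ₀ : ℝ}
    (hθ₀ : tractFn F U (t + θ₀ * Complex.I) = 0) (hΘ : 0 < tractWidth F U t) :
    2 * (Real.pi / tractWidth F U t) * tractEnergyDeriv F U t ≤ tractEnergyDerivTwo F U t := by
  have h0 := h.continuous_tractFn
  have h1 := h.continuous_tractFnDeriv 1
  have h3 := h.continuous_tractFnDeriv Complex.I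
  set κ := Real.pi / tractWidth F U t with hκ
  have hp0 : Function.Periodic (fun θ : ℝ => tractFn F U (t + θ * Complex.I)) (2 * Real.pi) :=
    fun θ => by simp only [ofReal_add_add_two_pi_mul_I, h.tractFn_add]
  have hp1 : Function.Periodic (fun θ : ℝ => tractFnDeriv F U Complex.I (t + θ * Complex.I))
      (2 * Real.pi) :=
    fun θ => by simp only [ofReal_add_add_two_pi_mul_I, h.tractFnDeriv_add]
  have hshift : ∀ {g : ℝ → ℝ}, Function.Periodic g (2 * Real.pi) →
      ∫ θ in θ₀..θ₀ + 2 * Real.pi, g θ = ∫ θ in (0 : ℝ)..2 * Real.pi, g θ := fun hg => by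
    simpa using hg.intervalIntegral_add_eq θ₀ 0
  have hW : κ ^ 2 * ∫ θ in (0 : ℝ)..2 * Real.pi, tractFn F U (t + θ * Complex.I) ^ 2 ≤
      ∫ θ in (0 : ℝ)..2 * Real.pi, tractFnDeriv F U Complex.I (t + θ * Complex.I) ^ 2 := by
    rw [← hshift (g := fun θ => tractFn F U (t + θ * Complex.I) ^ 2)
      (fun θ => by simp only [hp0 θ]),
      ← hshift (g := fun θ => tractFnDeriv F U Complex.I (t + θ * Complex.I) ^ 2)
      (fun θ => by simp only [hp1 θ])]
    refine sq_mul_integral_sq_le_integral_deriv_sq (by linarith [Real.pi_pos])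
      (fun θ => h.hasDerivAt_tractFn (hasDerivAt_add_mul_I_right t θ)) (by fun_prop) hθ₀
      ((hp0 θ₀).trans hθ₀) hΘ ?_
    rw [tractWidth]
    refine (hshift fun θ => ?_).le
    simp only [Set.indicator, Set.mem_ofPred_eq, ofReal_add_add_two_pi_mul_I, h.tractFn_add,
      Pi.one_apply]
  refine le_trans ?_ (h.le_tractEnergyDerivTwo t)
  rw [intervalIntegral.integral_add (by apply Continuous.intervalIntegrable; fun_prop)
    (by apply Continuous.intervalIntegrable; fun_prop), intervalIntegral.integral_const_mul 2,
    intervalIntegral.integral_const_mul 2]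
  have : 2 * κ * tractEnergyDeriv F U t ≤
      2 * (∫ θ in (0 : ℝ)..2 * Real.pi, tractFnDeriv F U 1 (t + θ * Complex.I) ^ 2) +
      2 * (κ ^ 2 * ∫ θ in (0 : ℝ)..2 * Real.pi, tractFn F U (t + θ * Complex.I) ^ 2) := by
    rw [tractEnergyDeriv, ← intervalIntegral.integral_const_mul,
      ← intervalIntegral.integral_const_mul, ← intervalIntegral.integral_const_mul,
      ← intervalIntegral.integral_const_mul, ← intervalIntegral.integral_add
      (by apply Continuous.intervalIntegrable; fun_prop)
      (by apply Continuous.intervalIntegrable; fun_prop)]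
    refine intervalIntegral.integral_mono_on (by positivity)
      (by apply Continuous.intervalIntegrable; fun_prop)
      (by apply Continuous.intervalIntegrable; fun_prop) fun θ _ => ?_
    nlinarith [sq_nonneg (tractFnDeriv F U 1 (t + θ * Complex.I) -
      κ * tractFn F U (t + θ * Complex.I))]
  linarith

end

theorem intervalIntegrable_indicator_one {s : Set ℝ} (hs : MeasurableSet s) (a b : ℝ) :
    IntervalIntegrable (s.indicator (1 : ℝ → ℝ)) volume a b := by
  rw [intervalIntegrable_iff]
  refine Integrable.indicator ?_ hs
  exact (continuous_const (y := (1 : ℝ))).integrableOn_uIoc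

section

variable {F : ℂ → ℂ} {U : Set ℂ}

theorem IsTractSet.measurableSet_support (h : IsTractSet F U) (t : ℝ) :
    MeasurableSet {θ : ℝ | tractFn F U (t + θ * Complex.I) ≠ 0} := by
  have := h.continuous_tractFn
  exact (isOpen_ne_fun (by fun_prop) continuous_const).measurableSet

theorem IsTractSet.tractWidth_le (h : IsTractSet F U) (t : ℝ) :
    tractWidth F U t ≤ 2 * Real.pi := by
  have : ∫ _ in (0 : ℝ)..2 * Real.pi, (1 : ℝ) = 2 * Real.pi := by simp
  rw [← this, tractWidth]
  refine intervalIntegral.integral_mono_on (by positivity)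
    (intervalIntegrable_indicator_one (h.measurableSet_support t) _ _)
    intervalIntegrable_const fun θ _ => ?_
  exact Set.indicator_le_self' (fun _ _ => zero_le_one) θ

theorem IsTractSet.tractWidth_pos (h : IsTractSet F U) {t : ℝ} (ht : tractEnergyDeriv F U t ≠ 0) :
    0 < tractWidth F U t := by
  have hnn : ∀ θ, 0 ≤ {θ : ℝ | tractFn F U (t + θ * Complex.I) ≠ 0}.indicator (1 : ℝ → ℝ) θ :=
    fun θ => Set.indicator_nonneg (fun _ _ => zero_le_one) θ
  refine lt_of_le_of_ne (intervalIntegral.integral_nonneg (by positivity) fun θ _ => hnn θ) ?_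
  intro h0
  apply ht
  have h1 := (intervalIntegral.integral_eq_zero_iff_of_le_of_nonneg_ae (by positivity)
    (Eventually.of_forall hnn)
    (intervalIntegrable_indicator_one (h.measurableSet_support t) _ _)).1 h0.symm
  rw [tractEnergyDeriv, intervalIntegral.integral_of_le (by positivity)]
  refine integral_eq_zero_of_ae ?_
  filter_upwards [h1] with θ hθ
  by_contra hne
  have : tractFn F U (t + θ * Complex.I) ≠ 0 := by
    intro h0; apply hne; simp [h0]
  rw [Set.indicator_of_mem (show θ ∈ {θ : ℝ | tractFn F U (t + θ * Complex.I) ≠ 0} from this)] at hθ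
  simp at hθ

theorem IsPeriodicTractSet.tractEnergyDeriv_le_derivTwo (h : IsPeriodicTractSet F U) {t θ₀ : ℝ}
    (hθ₀ : tractFn F U (t + θ₀ * Complex.I) = 0) (hpos : 0 < tractEnergyDeriv F U t) :
    tractEnergyDeriv F U t ≤ tractEnergyDerivTwo F U t := by
  have hw := h.tractWidth_pos hpos.ne'
  refine le_trans ?_ (h.carleman hθ₀ hw)
  have : 1 ≤ 2 * (Real.pi / tractWidth F U t) := by
    rw [mul_div_assoc', le_div_iff₀ hw]; linarith [h.tractWidth_le t]
  exact le_mul_of_one_le_left hpos.le this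

theorem IsPeriodicTractSet.tractEnergy_sub_le (h : IsPeriodicTractSet F U) {s t : ℝ}
    (hst : s ≤ t) : tractEnergy F U t - tractEnergy F U s ≤ tractEnergyDeriv F U t * (t - s) := by
  rcases hst.eq_or_lt with rfl | hlt
  · simp
  obtain ⟨c, hc, he⟩ := exists_hasDerivAt_eq_slope (tractEnergy F U) (tractEnergyDeriv F U) hlt
    (fun x _ => (h.hasDerivAt_tractEnergy x).continuousAt.continuousWithinAt)
    fun x _ => h.hasDerivAt_tractEnergy x
  have := h.monotone_tractEnergyDeriv hc.2.le
  rw [he, div_le_iff₀ (sub_pos.2 hlt)] at this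
  exact this

theorem IsPeriodicTractSet.le_tractEnergy_sub (h : IsPeriodicTractSet F U) {s t : ℝ}
    (hst : s ≤ t) : tractEnergyDeriv F U s * (t - s) ≤ tractEnergy F U t - tractEnergy F U s := by
  rcases hst.eq_or_lt with rfl | hlt
  · simp
  obtain ⟨c, hc, he⟩ := exists_hasDerivAt_eq_slope (tractEnergy F U) (tractEnergyDeriv F U) hlt
    (fun x _ => (h.hasDerivAt_tractEnergy x).continuousAt.continuousWithinAt)
    fun x _ => h.hasDerivAt_tractEnergy x
  have := h.monotone_tractEnergyDeriv hc.1.le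
  rw [he, le_div_iff₀ (sub_pos.2 hlt)] at this
  exact this

theorem IsTractSet.tractEnergy_le (h : IsTractSet F U) {t B : ℝ}
    (hB : ∀ θ : ℝ, tractFn F U (t + θ * Complex.I) ≤ B) :
    tractEnergy F U t ≤ 2 * Real.pi * B ^ 2 := by
  have := h.continuous_tractFn
  have e : ∫ _ in (0 : ℝ)..2 * Real.pi, B ^ 2 = 2 * Real.pi * B ^ 2 := by simp
  rw [← e]
  refine intervalIntegral.integral_mono_on (by positivity)
    (by apply Continuous.intervalIntegrable; fun_prop) intervalIntegrable_const fun θ _ => ?_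
  exact pow_le_pow_left₀ (tractFn_nonneg _) (hB θ) 2

/-- A bounded tract function is constant. -/
theorem IsPeriodicTractSet.tractFn_eq_of_bounded (h : IsPeriodicTractSet F U) {B : ℝ}
    (hB : ∀ z, tractFn F U z ≤ B) (z w : ℂ) : tractFn F U z = tractFn F U w := by
  have hE : ∀ t, tractEnergy F U t ≤ 2 * Real.pi * B ^ 2 := fun t => h.tractEnergy_le fun θ => hB _
  have h1 : ∀ t, tractEnergyDeriv F U t = 0 := by
    intro t
    by_contra hne
    rcases lt_or_gt_of_ne hne with hlt | hgt
    · set s := t - (2 * Real.pi * B ^ 2 + 1) / (-tractEnergyDeriv F U t) with hs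
      have hpos : 0 ≤ (2 * Real.pi * B ^ 2 + 1) / (-tractEnergyDeriv F U t) :=
        div_nonneg (by positivity) (by linarith)
      have h2 := h.tractEnergy_sub_le (s := s) (t := t) (by linarith)
      have h3 : tractEnergyDeriv F U t * (t - s) = -(2 * Real.pi * B ^ 2 + 1) := by
        rw [hs]; field_simp; ring
      have := hE s
      have := tractEnergy_nonneg (F := F) (U := U) t
      linarith
    · set s := t + (2 * Real.pi * B ^ 2 + 1) / tractEnergyDeriv F U t with hs
      have hpos : 0 ≤ (2 * Real.pi * B ^ 2 + 1) / tractEnergyDeriv F U t := by positivity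
      have h2 := h.le_tractEnergy_sub (s := t) (t := s) (by linarith)
      have h3 : tractEnergyDeriv F U t * (s - t) = 2 * Real.pi * B ^ 2 + 1 := by
        rw [hs]; field_simp; ring
      have := hE s
      have := tractEnergy_nonneg (F := F) (U := U) t
      linarith
  have h2 : ∀ t, tractEnergyDerivTwo F U t = 0 := by
    intro t
    have := h.hasDerivAt_tractEnergyDeriv t
    rw [funext h1] at this
    exact this.unique (hasDerivAt_const t 0)
  have hc1 := h.continuous_tractFnDeriv 1
  have hc2 := h.continuous_tractFnDeriv Complex.I
  have h3 : ∀ t : ℝ, ∀ θ ∈ Set.Icc (0 : ℝ) (2 * Real.pi),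
      tractFnDeriv F U 1 (t + θ * Complex.I) = 0 ∧
      tractFnDeriv F U Complex.I (t + θ * Complex.I) = 0 := by
    intro t θ hθ
    have h4 := (h.le_tractEnergyDerivTwo t).trans_eq (h2 t)
    have hcont : Continuous fun θ : ℝ => 2 * tractFnDeriv F U 1 (t + θ * Complex.I) ^ 2 +
      2 * tractFnDeriv F U Complex.I (t + θ * Complex.I) ^ 2 := by fun_prop
    by_contra hne
    have : 0 < ∫ θ in (0 : ℝ)..2 * Real.pi, (2 * tractFnDeriv F U 1 (t + θ * Complex.I) ^ 2 +
        2 * tractFnDeriv F U Complex.I (t + θ * Complex.I) ^ 2) := by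
      refine intervalIntegral.integral_pos (by positivity) hcont.continuousOn
        (fun _ _ => by positivity) ⟨θ, hθ, ?_⟩
      rw [not_and_or] at hne
      rcases hne with hne | hne
      · have := sq_pos_of_ne_zero hne; positivity
      · have := sq_pos_of_ne_zero hne; positivity
    linarith
  have hper : ∀ c, ∀ t : ℝ, Function.Periodic
      (fun θ : ℝ => tractFnDeriv F U c (t + θ * Complex.I)) (2 * Real.pi) := fun c t θ => by
    simp only [ofReal_add_add_two_pi_mul_I, h.tractFnDeriv_add]
  have h4 : ∀ t θ : ℝ, tractFnDeriv F U 1 (t + θ * Complex.I) = 0 ∧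
      tractFnDeriv F U Complex.I (t + θ * Complex.I) = 0 := by
    intro t θ
    obtain ⟨y, hy, h5⟩ := (hper 1 t).exists_mem_Ico₀ (by positivity) θ
    obtain ⟨y', hy', h6⟩ := (hper Complex.I t).exists_mem_Ico₀ (by positivity) θ
    exact ⟨h5.trans (h3 t y ⟨hy.1, hy.2.le⟩).1, h6.trans (h3 t y' ⟨hy'.1, hy'.2.le⟩).2⟩
  have h5 : ∀ θ : ℝ, ∀ s t : ℝ, tractFn F U (s + θ * Complex.I) = tractFn F U (t + θ * Complex.I) :=
    fun θ s t => is_const_of_deriv_eq_zero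
      (f := fun s : ℝ => tractFn F U (s + θ * Complex.I))
      (fun s => (h.hasDerivAt_tractFn (hasDerivAt_add_mul_I_left s θ)).differentiableAt)
      (fun s => by rw [(h.hasDerivAt_tractFn (hasDerivAt_add_mul_I_left s θ)).deriv]
                   exact (h4 s θ).1) s t
  have h6 : ∀ t : ℝ, ∀ s θ : ℝ, tractFn F U (t + s * Complex.I) = tractFn F U (t + θ * Complex.I) :=
    fun t s θ => is_const_of_deriv_eq_zero
      (f := fun s : ℝ => tractFn F U (t + s * Complex.I))
      (fun s => (h.hasDerivAt_tractFn (hasDerivAt_add_mul_I_right t s)).differentiableAt)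
      (fun s => by rw [(h.hasDerivAt_tractFn (hasDerivAt_add_mul_I_right t s)).deriv]
                   exact (h4 t s).2) s θ
  rw [← Complex.re_add_im z, ← Complex.re_add_im w, h5 z.im z.re w.re, h6 w.re z.im w.im]

end

/-- A union of components of `{‖f‖ > R}`. -/
structure IsTract (f : ℂ → ℂ) (R : ℝ) (V : Set ℂ) : Prop where
  isOpen : IsOpen V
  nonempty : V.Nonempty
  lt_norm : ∀ z ∈ V, R < ‖f z‖
  norm_le : ∀ z ∈ closure V, z ∉ V → ‖f z‖ ≤ R

/-- The function `f ∘ exp`, normalised so that the level `exp L` becomes `1`. -/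
noncomputable def levelFn (f : ℂ → ℂ) (L : ℝ) (z : ℂ) : ℂ := Real.exp (-L) * f (Complex.exp z)

theorem norm_levelFn (f : ℂ → ℂ) (L : ℝ) (z : ℂ) :
    ‖levelFn f L z‖ = Real.exp (-L) * ‖f (Complex.exp z)‖ := by
  rw [levelFn, norm_mul, Complex.norm_real, Real.norm_of_nonneg (Real.exp_pos _).le]

theorem one_lt_norm_levelFn_iff {f : ℂ → ℂ} {L : ℝ} {z : ℂ} :
    1 < ‖levelFn f L z‖ ↔ Real.exp L < ‖f (Complex.exp z)‖ := by
  rw [norm_levelFn, Real.exp_neg, inv_mul_eq_div, one_lt_div (Real.exp_pos L)]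

theorem norm_levelFn_lt_one_iff {f : ℂ → ℂ} {L : ℝ} {z : ℂ} :
    ‖levelFn f L z‖ < 1 ↔ ‖f (Complex.exp z)‖ < Real.exp L := by
  rw [norm_levelFn, Real.exp_neg, inv_mul_eq_div, div_lt_one (Real.exp_pos L)]

theorem log_norm_levelFn {f : ℂ → ℂ} {L : ℝ} {z : ℂ} (h : f (Complex.exp z) ≠ 0) :
    Real.log ‖levelFn f L z‖ = Real.log ‖f (Complex.exp z)‖ - L := by
  rw [norm_levelFn, Real.log_mul (Real.exp_pos _).ne' (norm_ne_zero_iff.2 h), Real.log_exp]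
  ring

theorem IsTract.isPeriodicTractSet {f : ℂ → ℂ} {R L : ℝ} {V : Set ℂ} (hV : IsTract f R V)
    (hf : Differentiable ℂ f) (hL : R < Real.exp L) :
    IsPeriodicTractSet (levelFn f L) (Complex.exp ⁻¹' V) where
  differentiable := (hf.comp Complex.differentiable_exp).const_mul _
  isOpen := hV.isOpen.preimage Complex.continuous_exp
  norm_lt_one z hz hzU := by
    rw [norm_levelFn_lt_one_iff]
    exact (hV.norm_le _ (Complex.continuous_exp.closure_preimage_subset V hz) hzU).trans_lt hL
  periodic z := by
    rw [levelFn, levelFn, Complex.exp_periodic]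
  mem_iff z := by
    simp only [Set.mem_preimage]; rw [Complex.exp_periodic]

theorem tractFn_levelFn_le {f : ℂ → ℂ} {L B : ℝ} (hL : 0 ≤ L) {U : Set ℂ} {z : ℂ}
    (hB0 : 0 ≤ B) (hB : Real.log ‖f (Complex.exp z)‖ ≤ B) : tractFn (levelFn f L) U z ≤ B := by
  by_cases hz : z ∈ U
  · rw [tractFn, Set.indicator_of_mem hz]
    refine (smoothPos_le _).trans (max_le ?_ hB0)
    by_cases h0 : f (Complex.exp z) = 0
    · simpa [levelFn, h0] using hB0
    · rw [log_norm_levelFn h0]; linarith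
  · rw [tractFn, Set.indicator_of_notMem hz]; exact hB0

theorem IsTract.exists_lt_norm {f : ℂ → ℂ} {R : ℝ} {V : Set ℂ} (hV : IsTract f R V)
    (hR : 0 < R) (hf : Differentiable ℂ f) (hp : ¬ ∃ p : Polynomial ℂ, ∀ z, f z = p.eval z)
    (B : ℝ) : ∃ z ∈ V, B < ‖f z‖ := by
  by_contra! hcon
  obtain ⟨w, hw0, hw⟩ : ∃ w, w ≠ 0 ∧ w ∈ V := by
    obtain ⟨v, hv⟩ := hV.nonempty
    have : V ∈ 𝓝[≠] v := mem_nhdsWithin_of_mem_nhds (hV.isOpen.mem_nhds hv)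
    have h2 : ∀ᶠ w in 𝓝[≠] v, w ≠ 0 := by
      by_cases h0 : v = 0
      · rw [h0]; exact self_mem_nhdsWithin
      · exact (eventually_ne_nhds h0).filter_mono nhdsWithin_le_nhds
    exact (h2.and this).exists
  obtain ⟨x, hx1, hx2⟩ := exists_between (hV.lt_norm w hw)
  have hx0 : 0 < x := hR.trans hx1
  set L := Real.log x with hL
  have hLx : Real.exp L = x := Real.exp_log hx0
  have hP := hV.isPeriodicTractSet hf (L := L) (by rw [hLx]; exact hx1)
  have hbd : ∀ z, tractFn (levelFn f L) (Complex.exp ⁻¹' V) z ≤ max (Real.log B - L) 0 := by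
    intro z
    by_cases hz : z ∈ Complex.exp ⁻¹' V
    · rw [tractFn, Set.indicator_of_mem hz]
      refine (smoothPos_le _).trans (max_le_max ?_ le_rfl)
      have h1 := hV.lt_norm _ hz
      have h2 := hcon _ hz
      rw [log_norm_levelFn (norm_pos_iff.1 (hR.trans h1))]
      linarith [Real.log_le_log (hR.trans h1) h2]
    · rw [tractFn, Set.indicator_of_notMem hz]; exact le_max_right _ _
  have hconst := hP.tractFn_eq_of_bounded hbd
  have hall : ∀ z, z ≠ 0 → z ∈ V := by
    intro z hz
    have h1 : tractFn (levelFn f L) (Complex.exp ⁻¹' V) (Complex.log w) ≠ 0 := by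
      rw [tractFn_ne_zero_iff, one_lt_norm_levelFn_iff, Set.mem_preimage, Complex.exp_log hw0, hLx]
      exact ⟨hw, hx2⟩
    rw [hconst _ (Complex.log z), tractFn_ne_zero_iff, Set.mem_preimage, Complex.exp_log hz] at h1
    exact h1.1
  refine hp (exists_polynomial_of_norm_le_pow 0 (C := B) (r := 1) hf fun z hz => ?_)
  rw [pow_zero, mul_one]
  exact hcon z (hall z (by rintro rfl; norm_num at hz))

theorem norm_exp_add_mul_I (t θ : ℝ) : ‖Complex.exp (t + θ * Complex.I)‖ = Real.exp t := by
  simp [Complex.norm_exp]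

/-- `tractEnergy` of `f` in the tract `V` at level `L`. -/
noncomputable def levelEnergy (f : ℂ → ℂ) (V : Set ℂ) (L : ℝ) : ℝ → ℝ :=
  tractEnergy (levelFn f L) (Complex.exp ⁻¹' V)

noncomputable def levelEnergyDeriv (f : ℂ → ℂ) (V : Set ℂ) (L : ℝ) : ℝ → ℝ :=
  tractEnergyDeriv (levelFn f L) (Complex.exp ⁻¹' V)

section

variable {f : ℂ → ℂ} {ρ R : ℝ} {V : Set ℂ}

theorem IsLogarithmicAbove.exists_tractFn_eq_zero (hf : IsLogarithmicAbove f ρ) {L : ℝ}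
    (hL : ρ ≤ L) (U : Set ℂ) (t : ℝ) :
    ∃ θ : ℝ, tractFn (levelFn f L) U (t + θ * Complex.I) = 0 := by
  obtain ⟨θ, hθ⟩ := hf.exists_norm_exp_le t
  refine ⟨θ, ?_⟩
  by_contra hne
  have := (tractFn_ne_zero_iff.1 hne).2
  rw [one_lt_norm_levelFn_iff] at this
  linarith [Real.exp_le_exp.2 hL]

theorem IsLogarithmicAbove.exists_levelEnergy_eq_zero (hf : IsLogarithmicAbove f ρ) :
    ∃ t₁ : ℝ, ∀ V, ∀ L, ρ + 1 ≤ L → ∀ t ≤ t₁, levelEnergy f V L t = 0 := by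
  have h0 : ‖f 0‖ < Real.exp (ρ + 1) :=
    hf.norm_zero_le.trans_lt (Real.exp_lt_exp.2 (by linarith))
  obtain ⟨δ, hδ, hd⟩ := Metric.eventually_nhds_iff.1
    (hf.differentiable.continuous.norm.continuousAt.eventually_lt_const h0)
  refine ⟨Real.log δ - 1, fun V L hL t ht => ?_⟩
  have hz : ∀ θ : ℝ, tractFn (levelFn f L) (Complex.exp ⁻¹' V) (t + θ * Complex.I) = 0 := by
    intro θ
    by_contra hne
    have h1 := (tractFn_ne_zero_iff.1 hne).2
    rw [one_lt_norm_levelFn_iff] at h1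
    have h2 := hd (y := Complex.exp (t + θ * Complex.I)) (by
      rw [dist_zero_right, norm_exp_add_mul_I, ← Real.lt_log_iff_exp_lt hδ]
      linarith)
    linarith [Real.exp_le_exp.2 hL]
  simp [levelEnergy, tractEnergy, hz]

theorem levelEnergy_le_two_mul_add {L₀ L : ℝ} (hV : IsTract f R V) (hf : Differentiable ℂ f)
    (hR : R < Real.exp L₀) (hL : L₀ ≤ L) (t : ℝ) :
    levelEnergy f V L₀ t ≤ 2 * levelEnergy f V L t + 4 * Real.pi * (L - L₀) ^ 2 := by
  have h0 := (hV.isPeriodicTractSet hf hR).continuous_tractFn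
  have h1 := (hV.isPeriodicTractSet hf (hR.trans_le (Real.exp_le_exp.2 hL))).continuous_tractFn
  have e : 4 * Real.pi * (L - L₀) ^ 2 = ∫ _ in (0 : ℝ)..2 * Real.pi, 2 * (L - L₀) ^ 2 := by
    simp; ring
  rw [e, levelEnergy, levelEnergy, tractEnergy, tractEnergy,
    ← intervalIntegral.integral_const_mul, ← intervalIntegral.integral_add
      (by apply Continuous.intervalIntegrable; fun_prop)
      (by apply Continuous.intervalIntegrable; fun_prop)]
  refine intervalIntegral.integral_mono_on (by positivity)
    (by apply Continuous.intervalIntegrable; fun_prop)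
    (by apply Continuous.intervalIntegrable; fun_prop) fun θ _ => ?_
  set z : ℂ := t + θ * Complex.I
  have hle : tractFn (levelFn f L₀) (Complex.exp ⁻¹' V) z ≤
      tractFn (levelFn f L) (Complex.exp ⁻¹' V) z + (L - L₀) := by
    by_cases hz : z ∈ Complex.exp ⁻¹' V
    · rw [tractFn, tractFn, Set.indicator_of_mem hz, Set.indicator_of_mem hz]
      by_cases hfz : f (Complex.exp z) = 0
      · simp only [levelFn, hfz, mul_zero]
        linarith
      · rw [log_norm_levelFn hfz, log_norm_levelFn hfz]
        have := smoothPos_le_add (s := Real.log ‖f (Complex.exp z)‖ - L)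
          (t := Real.log ‖f (Complex.exp z)‖ - L₀) (by linarith)
        linarith
    · rw [tractFn, tractFn, Set.indicator_of_notMem hz, Set.indicator_of_notMem hz]
      linarith
  have hn := tractFn_nonneg (F := levelFn f L₀) (U := Complex.exp ⁻¹' V) z
  nlinarith [sq_nonneg (tractFn (levelFn f L) (Complex.exp ⁻¹' V) z - (L - L₀))]

theorem IsLogarithmicAbove.exists_mul_exp_le_levelEnergy (hf : IsLogarithmicAbove f ρ)
    (hV : IsTract f R V) (hR : 0 < R) (hRρ : R ≤ Real.exp ρ) :
    ∃ c > 0, ∃ t₂ : ℝ, ∀ t ≥ t₂, c * Real.exp t ≤ levelEnergy f V (ρ + 1) t := by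
  have hP := hV.isPeriodicTractSet (L := ρ + 1) hf.differentiable
    (hRρ.trans_lt (Real.exp_lt_exp.2 (by linarith)))
  have hcW := hP.continuous_tractFn
  obtain ⟨t₁, ht₁⟩ := hf.exists_levelEnergy_eq_zero
  obtain ⟨w, hw, hfw⟩ := hV.exists_lt_norm hR hf.differentiable hf.not_polynomial
    (Real.exp (ρ + 1))
  have hw0 : w ≠ 0 := by
    rintro rfl
    have := hf.norm_zero_le
    linarith [Real.exp_lt_exp.2 (show ρ < ρ + 1 by linarith)]
  set s := (Complex.log w).re with hs
  have hpos : 0 < tractEnergy (levelFn f (ρ + 1)) (Complex.exp ⁻¹' V) s := by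
    have hper : Function.Periodic
        (fun θ : ℝ => tractFn (levelFn f (ρ + 1)) (Complex.exp ⁻¹' V) (s + θ * Complex.I))
        (2 * Real.pi) := fun θ => by simp only [ofReal_add_add_two_pi_mul_I, hP.tractFn_add]
    obtain ⟨θ, hθ, he⟩ := hper.exists_mem_Ico₀ (by positivity) (Complex.log w).im
    simp only [hs, Complex.re_add_im] at he
    have h1 : tractFn (levelFn f (ρ + 1)) (Complex.exp ⁻¹' V) (Complex.log w) ≠ 0 := by
      rw [tractFn_ne_zero_iff, one_lt_norm_levelFn_iff, Set.mem_preimage, Complex.exp_log hw0]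
      exact ⟨hw, hfw⟩
    rw [he] at h1
    refine intervalIntegral.integral_pos (by positivity) (by fun_prop)
      (fun _ _ => by positivity) ⟨θ, ⟨hθ.1, hθ.2.le⟩, ?_⟩
    have := sq_pos_of_ne_zero h1
    exact this
  set D := tractEnergyDeriv (levelFn f (ρ + 1)) (Complex.exp ⁻¹' V) with hD
  have hDs : 0 < D s := by
    have h1 := hP.tractEnergy_sub_le (s := min t₁ s - 1) (t := s) (by
      linarith [min_le_right t₁ s])
    have h2 := ht₁ V (ρ + 1) le_rfl (min t₁ s - 1) (by linarith [min_le_left t₁ s])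
    rw [levelEnergy] at h2
    rw [h2, sub_zero] at h1
    by_contra! hle
    have : D s * (s - (min t₁ s - 1)) ≤ 0 :=
      mul_nonpos_of_nonpos_of_nonneg hle (by linarith [min_le_right t₁ s])
    linarith
  have hDpos : ∀ t ≥ s, 0 < D t := fun t ht => hDs.trans_le (hP.monotone_tractEnergyDeriv ht)
  have hmono : MonotoneOn (fun t => D t * Real.exp (-t)) (Set.Ici s) := by
    have hd : ∀ t, HasDerivAt (fun t => D t * Real.exp (-t))
        (tractEnergyDerivTwo (levelFn f (ρ + 1)) (Complex.exp ⁻¹' V) t * Real.exp (-t) +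
          D t * (Real.exp (-t) * -1)) t := fun t =>
      (hP.hasDerivAt_tractEnergyDeriv t).mul (hasDerivAt_neg t).exp
    refine monotoneOn_of_deriv_nonneg (convex_Ici s)
      (fun t _ => (hd t).continuousAt.continuousWithinAt)
      (fun t _ => (hd t).differentiableAt.differentiableWithinAt) fun t ht => ?_
    rw [interior_Ici] at ht
    rw [(hd t).deriv]
    obtain ⟨θ, hθ⟩ := hf.exists_tractFn_eq_zero (L := ρ + 1) (by linarith) (Complex.exp ⁻¹' V) t
    have := hP.tractEnergyDeriv_le_derivTwo hθ (hDpos t ht.le)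
    nlinarith [Real.exp_pos (-t)]
  refine ⟨D s * Real.exp (-s) * Real.exp (-1), by positivity, s + 1, fun t ht => ?_⟩
  have h1 := hP.le_tractEnergy_sub (s := t - 1) (t := t) (by linarith)
  have h2 := hmono (Set.mem_Ici.2 le_rfl) (show s ≤ t - 1 by linarith) (show s ≤ t - 1 by linarith)
  have h3 := tractEnergy_nonneg (F := levelFn f (ρ + 1)) (U := Complex.exp ⁻¹' V) (t - 1)
  simp only at h2
  have e1 : Real.exp (-1) * Real.exp t = Real.exp (t - 1) := by rw [← Real.exp_add]; ring_nf
  have e2 : Real.exp (-(t - 1)) * Real.exp (t - 1) = 1 := by rw [← Real.exp_add]; simp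
  calc D s * Real.exp (-s) * Real.exp (-1) * Real.exp t
      = D s * Real.exp (-s) * Real.exp (t - 1) := by rw [mul_assoc, e1]
    _ ≤ D (t - 1) * Real.exp (-(t - 1)) * Real.exp (t - 1) := by gcongr
    _ = D (t - 1) * (t - (t - 1)) := by rw [mul_assoc, e2]; ring
    _ ≤ levelEnergy f V (ρ + 1) t := by rw [levelEnergy]; linarith

/-- At level `L ≤ 2 ^ g` the energy is already increasing fast at time `3 g`. -/
theorem IsLogarithmicAbove.eventually_one_le_levelEnergyDeriv (hf : IsLogarithmicAbove f ρ)
    (hρ : 0 ≤ ρ) (hV : IsTract f R V) (hR : 0 < R) (hRρ : R ≤ Real.exp ρ) :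
    ∀ᶠ g : ℕ in atTop, ∀ L, ρ + 1 ≤ L → L ≤ 2 ^ g → 1 ≤ levelEnergyDeriv f V L (3 * g) := by
  obtain ⟨t₁, ht₁⟩ := hf.exists_levelEnergy_eq_zero
  obtain ⟨c, hc, t₂, ht₂⟩ := hf.exists_mul_exp_le_levelEnergy hV hR hRρ
  have hev : ∀ᶠ x : ℝ in atTop, (4 * Real.pi + 6 + 2 * |t₁|) / c ≤ Real.exp x ∧ t₂ ≤ 3 * x ∧
      t₁ < 3 * x ∧ 0 ≤ x := by
    filter_upwards [Real.tendsto_exp_atTop.eventually_ge_atTop ((4 * Real.pi + 6 + 2 * |t₁|) / c),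
      eventually_ge_atTop (|t₂|), eventually_gt_atTop (|t₁|)] with x h1 h2 h3
    have := abs_nonneg t₂
    have := abs_nonneg t₁
    have := le_abs_self t₂
    have := le_abs_self t₁
    exact ⟨h1, by linarith, by linarith, by linarith⟩
  filter_upwards [tendsto_natCast_atTop_atTop.eventually hev] with g hg L hL hLg
  obtain ⟨hg1, hg2, hg3, hg0⟩ := hg
  have hlt : R < Real.exp (ρ + 1) := hRρ.trans_lt (Real.exp_lt_exp.2 (by linarith))
  have hP := hV.isPeriodicTractSet (L := L) hf.differentiable
    (hlt.trans_le (Real.exp_le_exp.2 hL))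
  have h1 := hP.tractEnergy_sub_le hg3.le
  have h2 := ht₁ V L hL t₁ le_rfl
  have h3 := ht₂ (3 * g) hg2
  have h4 := levelEnergy_le_two_mul_add hV hf.differentiable hlt hL (3 * g)
  rw [levelEnergy] at h2
  rw [h2, sub_zero] at h1
  set x := Real.exp g with hx
  have hx1 : 1 ≤ x := Real.one_le_exp hg0
  have hx3 : Real.exp (3 * g) = x ^ 3 := by
    rw [hx, ← Real.exp_nat_mul]; norm_num
  have hgx : (g : ℝ) ≤ x := by linarith [Real.add_one_le_exp (g : ℝ)]
  have h2g : (2 : ℝ) ^ g ≤ x := by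
    have := Real.add_one_le_exp (1 : ℝ)
    rw [hx, ← mul_one (g : ℝ), Real.exp_nat_mul]
    exact pow_le_pow_left₀ (by norm_num) (by linarith) g
  have hLsq : (L - (ρ + 1)) ^ 2 ≤ x ^ 2 := by
    refine pow_le_pow_left₀ (by linarith) (by linarith) 2
  rw [div_le_iff₀ hc] at hg1
  have hbig : (4 * Real.pi + 6 + 2 * |t₁|) * x ^ 2 ≤ c * x ^ 3 := by
    have := mul_le_mul_of_nonneg_right hg1 (sq_nonneg x)
    nlinarith
  have hxx : x ≤ x ^ 2 := by nlinarith
  have h5 : 2 * (3 * g - t₁) + 4 * Real.pi * (L - (ρ + 1)) ^ 2 ≤ c * x ^ 3 := by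
    refine le_trans ?_ hbig
    have := neg_abs_le t₁
    have h6 : 4 * Real.pi * (L - (ρ + 1)) ^ 2 ≤ 4 * Real.pi * x ^ 2 := by gcongr
    have h7 : 2 * |t₁| ≤ 2 * |t₁| * x ^ 2 := by
      refine le_mul_of_one_le_right (by positivity) (by nlinarith)
    nlinarith
  rw [hx3] at h3
  have h8 : 3 * g - t₁ ≤ levelEnergyDeriv f V L (3 * g) * (3 * g - t₁) := by
    rw [levelEnergyDeriv]
    refine le_trans ?_ h1
    rw [levelEnergy, levelEnergy] at h4
    rw [levelEnergy] at h3
    linarith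
  by_contra! hlt
  have := mul_lt_mul_of_pos_right hlt (sub_pos.2 hg3)
  linarith

theorem levelEnergyDeriv_le {L B t : ℝ} (hL : 0 ≤ L) (hV : IsTract f R V)
    (hf : Differentiable ℂ f) (hR : R < Real.exp L) (hB0 : 0 ≤ B)
    (hB : ∀ θ : ℝ, Real.log ‖f (Complex.exp ((t + 1 : ℝ) + θ * Complex.I))‖ ≤ B) :
    levelEnergyDeriv f V L t ≤ 2 * Real.pi * B ^ 2 := by
  have hP := hV.isPeriodicTractSet hf hR
  have h1 := hP.le_tractEnergy_sub (s := t) (t := t + 1) (by linarith)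
  have h2 := hP.tractEnergy_le (t := t + 1) (B := B) fun θ => tractFn_levelFn_le hL hB0 (hB θ)
  have h3 := tractEnergy_nonneg (F := levelFn f L) (U := Complex.exp ⁻¹' V) t
  rw [levelEnergyDeriv]
  simp only [add_sub_cancel_left, mul_one] at h1
  linarith

end

/-- The measure of the angles at which `|f| ≤ e ^ L` on the circle of radius `e ^ t`. -/
noncomputable def lowWidth (f : ℂ → ℂ) (L t : ℝ) : ℝ :=
  ∫ θ in (0 : ℝ)..2 * Real.pi,
    {θ : ℝ | ‖f (Complex.exp (t + θ * Complex.I))‖ ≤ Real.exp L}.indicator (1 : ℝ → ℝ) θ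

section

variable {f : ℂ → ℂ} {ρ R : ℝ} {V : Set ℂ}

theorem measurableSet_low (hf : Continuous f) (L t : ℝ) :
    MeasurableSet {θ : ℝ | ‖f (Complex.exp (t + θ * Complex.I))‖ ≤ Real.exp L} :=
  (isClosed_le (by fun_prop) continuous_const).measurableSet

theorem lowWidth_nonneg (L t : ℝ) : 0 ≤ lowWidth f L t :=
  intervalIntegral.integral_nonneg (by positivity) fun θ _ =>
    Set.indicator_nonneg (fun _ _ => zero_le_one) θ

theorem lowWidth_le (hf : Continuous f) (L t : ℝ) : lowWidth f L t ≤ 2 * Real.pi := by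
  have : ∫ _ in (0 : ℝ)..2 * Real.pi, (1 : ℝ) = 2 * Real.pi := by simp
  rw [← this, lowWidth]
  refine intervalIntegral.integral_mono_on (by positivity)
    (intervalIntegrable_indicator_one (measurableSet_low hf L t) _ _)
    intervalIntegrable_const fun θ _ => ?_
  exact Set.indicator_le_self' (fun _ _ => zero_le_one) θ

theorem stronglyMeasurable_lowWidth (hf : Continuous f) (L : ℝ) :
    StronglyMeasurable (lowWidth f L) := by
  have hm : MeasurableSet
      {p : ℝ × ℝ | ‖f (Complex.exp (p.1 + p.2 * Complex.I))‖ ≤ Real.exp L} :=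
    (isClosed_le (by fun_prop) continuous_const).measurableSet
  have h := (stronglyMeasurable_one (α := ℝ × ℝ) (β := ℝ)).indicator hm
  have h2 := h.integral_prod_right' (ν := volume.restrict (Set.Ioc 0 (2 * Real.pi)))
  have e : lowWidth f L = fun t => ∫ θ in Set.Ioc 0 (2 * Real.pi),
      {p : ℝ × ℝ | ‖f (Complex.exp (p.1 + p.2 * Complex.I))‖ ≤ Real.exp L}.indicator 1 (t, θ) := by
    ext t
    rw [lowWidth, intervalIntegral.integral_of_le (by positivity)]
    rfl
  rw [e]
  exact h2

theorem intervalIntegrable_lowWidth (hf : Continuous f) (L a b : ℝ) :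
    IntervalIntegrable (lowWidth f L) volume a b := by
  refine (intervalIntegrable_const (c := 2 * Real.pi)).mono_fun
    (stronglyMeasurable_lowWidth hf L).aestronglyMeasurable (Eventually.of_forall fun t => ?_)
  beta_reduce
  rw [Real.norm_of_nonneg (lowWidth_nonneg L t), Real.norm_of_nonneg (by positivity)]
  exact lowWidth_le hf L t

theorem sum_tractWidth_add_lowWidth_le {L : ℝ} {𝒱 : Finset (Set ℂ)} (hf : Differentiable ℂ f)
    (h𝒱 : ∀ V ∈ 𝒱, IsTract f R V) (hd : (𝒱 : Set (Set ℂ)).PairwiseDisjoint id)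
    (hL : R < Real.exp L) (t : ℝ) :
    ∑ V ∈ 𝒱, tractWidth (levelFn f L) (Complex.exp ⁻¹' V) t + lowWidth f L t ≤ 2 * Real.pi := by
  have hInt : ∀ V ∈ 𝒱, IntervalIntegrable
      ({θ : ℝ | tractFn (levelFn f L) (Complex.exp ⁻¹' V) (t + θ * Complex.I) ≠ 0}.indicator
        (1 : ℝ → ℝ)) volume 0 (2 * Real.pi) := fun V hV =>
    intervalIntegrable_indicator_one
      (((h𝒱 V hV).isPeriodicTractSet hf hL).measurableSet_support t) _ _
  have hlow := intervalIntegrable_indicator_one (measurableSet_low hf.continuous L t)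
    0 (2 * Real.pi)
  have hsum := IntervalIntegrable.sum 𝒱 hInt
  have : ∫ _ in (0 : ℝ)..2 * Real.pi, (1 : ℝ) = 2 * Real.pi := by simp
  simp only [tractWidth]
  rw [lowWidth, ← intervalIntegral.integral_finsetSum hInt]
  rw [Finset.sum_fn] at hsum
  rw [← intervalIntegral.integral_add hsum hlow]
  refine le_trans ?_ this.le
  refine intervalIntegral.integral_mono_on (by positivity) (hsum.add hlow)
    intervalIntegrable_const fun θ _ => ?_
  set z : ℂ := t + θ * Complex.I with hz
  by_cases hex : ∃ V ∈ 𝒱, tractFn (levelFn f L) (Complex.exp ⁻¹' V) z ≠ 0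
  · obtain ⟨V, hV, hVz⟩ := hex
    have hVz' := tractFn_ne_zero_iff.1 hVz
    rw [Finset.sum_eq_single V]
    · rw [Set.indicator_of_mem (by exact hVz), Set.indicator_of_notMem]
      · simp
      · intro h
        have h2 := one_lt_norm_levelFn_iff.1 hVz'.2
        simp only [Set.mem_ofPred_eq] at h
        linarith
    · intro W hW hne
      refine Set.indicator_of_notMem (fun h => ?_) _
      have h2 := tractFn_ne_zero_iff.1 h
      exact Set.disjoint_left.1 (hd hW hV hne) h2.1 hVz'.1
    · intro h; exact absurd hV h
  · push Not at hex
    rw [Finset.sum_eq_zero]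
    · rw [zero_add]
      exact Set.indicator_le_self' (fun _ _ => zero_le_one) θ
    · intro V hV
      refine Set.indicator_of_notMem (fun h => ?_) _
      exact absurd (hex V hV) h

/-- The Ahlfors–Carleman estimate: fast growing tracts leave little room for small values. -/
theorem IsLogarithmicAbove.integral_lowWidth_le {L B t₀ T : ℝ} {𝒱 : Finset (Set ℂ)}
    (hf : IsLogarithmicAbove f ρ) (h𝒱 : ∀ V ∈ 𝒱, IsTract f R V)
    (hd : (𝒱 : Set (Set ℂ)).PairwiseDisjoint id) (hne : 𝒱.Nonempty) (hρ : 0 ≤ ρ)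
    (hR : R ≤ Real.exp ρ) (hL : ρ + 1 ≤ L) (hT : t₀ ≤ T)
    (h1 : ∀ V ∈ 𝒱, 1 ≤ levelEnergyDeriv f V L t₀) (hB0 : 0 < B)
    (hB : ∀ θ : ℝ, Real.log ‖f (Complex.exp ((T + 1 : ℝ) + θ * Complex.I))‖ ≤ B) :
    (𝒱.card : ℝ) ^ 2 * (T - t₀) + 𝒱.card ^ 2 / (2 * Real.pi) * ∫ t in t₀..T, lowWidth f L t ≤
      𝒱.card * Real.log (2 * Real.pi * B ^ 2) := by
  have hRL : R < Real.exp L := hR.trans_lt (Real.exp_lt_exp.2 (by linarith))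
  have hP := fun V hV => (h𝒱 V hV).isPeriodicTractSet hf.differentiable hRL
  have hge : ∀ V ∈ 𝒱, ∀ t, t₀ ≤ t → 1 ≤ levelEnergyDeriv f V L t := fun V hV t ht =>
    (h1 V hV).trans ((hP V hV).monotone_tractEnergyDeriv ht)
  set D₂ : Set ℂ → ℝ → ℝ := fun V t =>
    tractEnergyDerivTwo (levelFn f L) (Complex.exp ⁻¹' V) t with hD₂
  have hΛ : ∀ t ≥ t₀, HasDerivAt (fun t => ∑ V ∈ 𝒱, Real.log (levelEnergyDeriv f V L t))
      (∑ V ∈ 𝒱, D₂ V t / levelEnergyDeriv f V L t) t := fun t ht =>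
    HasDerivAt.fun_sum fun V hV => ((hP V hV).hasDerivAt_tractEnergyDeriv t).log
      (zero_lt_one.trans_le (hge V hV t ht)).ne'
  have hlow : ∀ t ≥ t₀, (𝒱.card : ℝ) ^ 2 + 𝒱.card ^ 2 / (2 * Real.pi) * lowWidth f L t ≤
      ∑ V ∈ 𝒱, D₂ V t / levelEnergyDeriv f V L t := by
    intro t ht
    set Θ : Set ℂ → ℝ := fun V => tractWidth (levelFn f L) (Complex.exp ⁻¹' V) t with hΘ
    have hpos : ∀ V ∈ 𝒱, 0 < Θ V := fun V hV =>
      (hP V hV).tractWidth_pos (zero_lt_one.trans_le (hge V hV t ht)).ne'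
    have hs := sum_tractWidth_add_lowWidth_le hf.differentiable h𝒱 hd hRL t
    have hSpos : 0 < ∑ V ∈ 𝒱, Θ V := Finset.sum_pos hpos hne
    have hb := lowWidth_nonneg (f := f) L t
    have hSed := Finset.sq_sum_div_le_sum_sq_div 𝒱 (fun _ => (1 : ℝ)) hpos
    simp only [Finset.sum_const, nsmul_eq_mul, mul_one, one_pow] at hSed
    have hstep : ∀ V ∈ 𝒱, 2 * Real.pi * (1 / Θ V) ≤ D₂ V t / levelEnergyDeriv f V L t := by
      intro V hV
      obtain ⟨θ, hθ⟩ := hf.exists_tractFn_eq_zero (L := L) (by linarith) (Complex.exp ⁻¹' V) t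
      have := (hP V hV).carleman hθ (hpos V hV)
      rw [le_div_iff₀ (zero_lt_one.trans_le (hge V hV t ht))]
      calc _ = 2 * (Real.pi / Θ V) * levelEnergyDeriv f V L t := by ring
        _ ≤ _ := this
    refine le_trans ?_ (Finset.sum_le_sum hstep)
    rw [← Finset.mul_sum]
    refine le_trans ?_ (mul_le_mul_of_nonneg_left hSed (by positivity))
    have hpi := Real.pi_pos
    have key : 1 + lowWidth f L t / (2 * Real.pi) ≤ 2 * Real.pi / ∑ V ∈ 𝒱, Θ V := by
      rw [le_div_iff₀ hSpos, one_add_div (by positivity), div_mul_eq_mul_div,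
        div_le_iff₀ (by positivity)]
      nlinarith [mul_nonneg hb hSpos.le, mul_nonneg hb hb]
    have := mul_le_mul_of_nonneg_left key (sq_nonneg (𝒱.card : ℝ))
    calc _ = (𝒱.card : ℝ) ^ 2 * (1 + lowWidth f L t / (2 * Real.pi)) := by ring
      _ ≤ _ := this
      _ = _ := by ring
  have hintb := intervalIntegrable_lowWidth hf.differentiable.continuous L t₀ T
  have hInt := intervalIntegral.integral_le_sub_of_hasDeriv_right_of_le
    (g := fun t => ∑ V ∈ 𝒱, Real.log (levelEnergyDeriv f V L t))
    (φ := fun t => (𝒱.card : ℝ) ^ 2 + 𝒱.card ^ 2 / (2 * Real.pi) * lowWidth f L t) hT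
    (fun t ht => (hΛ t ht.1).continuousAt.continuousWithinAt)
    (fun t ht => (hΛ t ht.1.le).hasDerivWithinAt)
    ((intervalIntegrable_iff_integrableOn_Icc_of_le hT).1
      (intervalIntegrable_const.add (hintb.const_mul _)))
    (fun t ht => hlow t ht.1.le)
  rw [intervalIntegral.integral_add intervalIntegrable_const (hintb.const_mul _),
    intervalIntegral.integral_const_mul, intervalIntegral.integral_const, smul_eq_mul] at hInt
  have hup : ∑ V ∈ 𝒱, Real.log (levelEnergyDeriv f V L T) ≤
      𝒱.card * Real.log (2 * Real.pi * B ^ 2) := by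
    rw [← nsmul_eq_mul]
    refine Finset.sum_le_card_nsmul _ _ _ fun V hV => ?_
    exact Real.log_le_log (zero_lt_one.trans_le (hge V hV T hT))
      (levelEnergyDeriv_le (by linarith) (h𝒱 V hV) hf.differentiable hRL hB0.le hB)
  have hdn : 0 ≤ ∑ V ∈ 𝒱, Real.log (levelEnergyDeriv f V L t₀) :=
    Finset.sum_nonneg fun V hV => Real.log_nonneg (h1 V hV)
  linarith

theorem isTract_connectedComponentIn (hf : Continuous f) {z : ℂ} (hz : R < ‖f z‖) :
    IsTract f R (connectedComponentIn {w : ℂ | R < ‖f w‖} z) := by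
  have ho : IsOpen {w : ℂ | R < ‖f w‖} := isOpen_lt continuous_const hf.norm
  refine ⟨ho.connectedComponentIn, ⟨z, mem_connectedComponentIn hz⟩,
    fun w hw => connectedComponentIn_subset {w : ℂ | R < ‖f w‖} z hw, fun w hw hn => ?_⟩
  by_contra! hlt
  have hwo : IsOpen (connectedComponentIn {w : ℂ | R < ‖f w‖} w) := ho.connectedComponentIn
  obtain ⟨v, hv1, hv2⟩ := mem_closure_iff.1 hw _ hwo (mem_connectedComponentIn hlt)
  have := connectedComponentIn_eq hv1
  rw [connectedComponentIn_eq hv2, ← this] at hn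
  exact hn (mem_connectedComponentIn hlt)

theorem isTract_setOf_lt_norm (hf : Continuous f) {z : ℂ} (hz : R < ‖f z‖) :
    IsTract f R {w : ℂ | R < ‖f w‖} :=
  ⟨isOpen_lt continuous_const hf.norm, ⟨z, hz⟩, fun _ h => h, fun _ _ h => not_lt.1 h⟩

/-- There are at least `N` disjoint tracts, and at least one. -/
theorem exists_finset_isTract (hf : Continuous f) {z : ℂ} (hz : R < ‖f z‖) :
    ∃ 𝒱 : Finset (Set ℂ), (∀ V ∈ 𝒱, IsTract f R V) ∧
      (𝒱 : Set (Set ℂ)).PairwiseDisjoint id ∧ 𝒱.Nonempty ∧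
      (componentsAR f R).ncard ≤ 𝒱.card := by
  rcases Nat.eq_zero_or_pos (componentsAR f R).ncard with h0 | hpos
  · exact ⟨{{w : ℂ | R < ‖f w‖}}, by simpa using isTract_setOf_lt_norm hf hz, by simp, by simp,
      by simp [h0]⟩
  · have hfin := Set.finite_of_ncard_pos hpos
    refine ⟨hfin.toFinset, ?_, ?_, ?_, ?_⟩
    · intro V hV
      obtain ⟨w, hw, rfl⟩ := hfin.mem_toFinset.1 hV
      exact isTract_connectedComponentIn hf hw
    · rw [hfin.coe_toFinset]
      rintro _ ⟨v, hv, rfl⟩ _ ⟨w, hw, rfl⟩ hne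
      refine Set.disjoint_left.2 fun u hu1 hu2 => hne ?_
      rw [connectedComponentIn_eq hu1, connectedComponentIn_eq hu2]
    · rw [Set.Finite.toFinset_nonempty]
      exact (Set.ncard_pos hfin).1 hpos
    · rw [Set.ncard_eq_toFinset_card _ hfin]

end

theorem volume_reProdIm (s t : Set ℝ) : volume (s ×ℂ t) = volume s * volume t := by
  have h := Complex.volume_preserving_equiv_real_prod.measure_preimage_equiv (s ×ˢ t)
  rw [Measure.volume_eq_prod, Measure.prod_prod] at h
  exact h

/-- The square `[2^k, 2^(k+1)) × [j 2^k, (j+1) 2^k)`. -/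
def dyadicSquare (k : ℕ) (j : ℤ) : Set ℂ :=
  Set.Ico (2 ^ k : ℝ) (2 ^ (k + 1)) ×ℂ Set.Ico (j * 2 ^ k : ℝ) ((j + 1) * 2 ^ k)

theorem mem_dyadicSquare {k : ℕ} {j : ℤ} {z : ℂ} :
    z ∈ dyadicSquare k j ↔ (2 ^ k ≤ z.re ∧ z.re < 2 ^ (k + 1)) ∧
      (j * 2 ^ k ≤ z.im ∧ z.im < (j + 1) * 2 ^ k) := by
  rw [dyadicSquare, Complex.mem_reProdIm]; rfl

theorem measurableSet_dyadicSquare (k : ℕ) (j : ℤ) : MeasurableSet (dyadicSquare k j) :=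
  (Complex.measurable_re measurableSet_Ico).inter (Complex.measurable_im measurableSet_Ico)

theorem volume_dyadicSquare (k : ℕ) (j : ℤ) :
    volume (dyadicSquare k j) = ENNReal.ofReal (2 ^ k * 2 ^ k) := by
  rw [dyadicSquare, volume_reProdIm, Real.volume_Ico, Real.volume_Ico,
    ← ENNReal.ofReal_mul (by rw [pow_succ]; nlinarith [pow_pos (two_pos (α := ℝ)) k])]
  ring_nf

section

variable {f : ℂ → ℂ}

theorem volume_low_inter_Ico_le (hf : Continuous f) (L t a : ℝ) (k : ℕ) :
    volume ({θ : ℝ | ‖f (Complex.exp (t + θ * Complex.I))‖ ≤ Real.exp L} ∩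
      Set.Ico a (a + 2 ^ k)) ≤ ENNReal.ofReal (2 ^ k * lowWidth f L t) := by
  set S := {θ : ℝ | ‖f (Complex.exp (t + θ * Complex.I))‖ ≤ Real.exp L} with hS
  have hSm : MeasurableSet S := measurableSet_low hf L t
  have hInt := intervalIntegrable_indicator_one hSm
  have hper : Function.Periodic (S.indicator (1 : ℝ → ℝ)) (2 * Real.pi) := by
    intro θ
    have hiff : θ + 2 * Real.pi ∈ S ↔ θ ∈ S := by
      simp only [hS, Set.mem_ofPred_eq, ofReal_add_add_two_pi_mul_I]
      rw [Complex.exp_periodic]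
    by_cases h : θ ∈ S
    · rw [Set.indicator_of_mem h, Set.indicator_of_mem (hiff.2 h)]; rfl
    · rw [Set.indicator_of_notMem h, Set.indicator_of_notMem (fun h' => h (hiff.1 h'))]
  have h1 := hper.intervalIntegral_add_zsmul_eq (2 ^ k : ℕ) a hInt
  rw [hper.intervalIntegral_add_eq a 0, zero_add] at h1
  have hpi := Real.pi_gt_three
  have h2k : (0 : ℝ) < 2 ^ k := by positivity
  have hle : a ≤ a + 2 ^ k := by linarith
  have hfin : volume (S ∩ Set.Ico a (a + 2 ^ k)) ≠ ⊤ :=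
    measure_ne_top_of_subset Set.inter_subset_right (by simp)
  rw [← ENNReal.ofReal_toReal hfin]
  refine ENNReal.ofReal_le_ofReal ?_
  have e1 : (volume (S ∩ Set.Ico a (a + 2 ^ k))).toReal =
      ∫ θ in a..a + 2 ^ k, S.indicator (1 : ℝ → ℝ) θ := by
    rw [intervalIntegral.integral_of_le hle, ← integral_Ico_eq_integral_Ioc,
      integral_indicator_one hSm, measureReal_restrict_apply hSm, measureReal_def]
  rw [e1]
  have e2 : ∫ θ in a..a + ((2 ^ k : ℕ) : ℤ) • (2 * Real.pi), S.indicator (1 : ℝ → ℝ) θ =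
      2 ^ k * lowWidth f L t := by
    rw [h1, lowWidth, ← hS]; simp
  rw [← e2]
  refine intervalIntegral.integral_mono_interval le_rfl hle ?_
    (Eventually.of_forall fun θ => Set.indicator_nonneg (fun _ _ => zero_le_one) θ) (hInt _ _)
  simp only [zsmul_eq_mul]
  push_cast
  nlinarith

theorem volume_dyadicSquare_inter_low_le (hf : Continuous f) (L : ℝ) (k : ℕ) (j : ℤ) :
    volume (dyadicSquare k j ∩ {z | ‖f (Complex.exp z)‖ ≤ Real.exp L}) ≤
      ENNReal.ofReal (2 ^ k * ∫ t in (2 ^ k : ℝ)..2 ^ (k + 1), lowWidth f L t) := by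
  have hE : MeasurableSet {z | ‖f (Complex.exp z)‖ ≤ Real.exp L} :=
    (isClosed_le (by fun_prop) continuous_const).measurableSet
  have hm := (measurableSet_dyadicSquare k j).inter hE
  have h2k : (0 : ℝ) < 2 ^ k := by positivity
  have hle : (2 : ℝ) ^ k ≤ 2 ^ (k + 1) := by rw [pow_succ]; linarith
  rw [← Complex.volume_preserving_equiv_real_prod.symm.measure_preimage hm.nullMeasurableSet,
    Measure.volume_eq_prod, Measure.prod_apply
      (Complex.measurableEquivRealProd.symm.measurable hm)]
  have hbound : ∀ t : ℝ, volume (Prod.mk t ⁻¹' (Complex.measurableEquivRealProd.symm ⁻¹'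
      (dyadicSquare k j ∩ {z | ‖f (Complex.exp z)‖ ≤ Real.exp L}))) ≤
      (Set.Ico (2 ^ k : ℝ) (2 ^ (k + 1))).indicator
        (fun t => ENNReal.ofReal (2 ^ k * lowWidth f L t)) t := by
    intro t
    by_cases ht : t ∈ Set.Ico (2 ^ k : ℝ) (2 ^ (k + 1))
    · rw [Set.indicator_of_mem ht]
      refine le_trans (measure_mono ?_) (volume_low_inter_Ico_le hf L t (j * 2 ^ k) k)
      intro θ hθ
      simp only [Set.mem_preimage, Complex.measurableEquivRealProd_symm_apply,
        Set.mem_inter_iff, mem_dyadicSquare, Set.mem_ofPred_eq] at hθ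
      refine ⟨?_, hθ.1.2.1, by linarith [hθ.1.2.2]⟩
      simp only [Set.mem_ofPred_eq]
      have e : (⟨t, θ⟩ : ℂ) = t + θ * Complex.I := Complex.mk_eq_add_mul_I t θ
      rw [← e]; exact hθ.2
    · rw [Set.indicator_of_notMem ht]
      refine le_of_eq ?_
      convert measure_empty (μ := (volume : Measure ℝ))
      ext θ
      simp only [Set.mem_preimage, Complex.measurableEquivRealProd_symm_apply,
        Set.mem_inter_iff, mem_dyadicSquare, Set.mem_empty_iff_false, iff_false]
      exact fun h => ht h.1.1
  refine (lintegral_mono hbound).trans ?_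
  rw [lintegral_indicator measurableSet_Ico]
  have hI := intervalIntegrable_lowWidth hf L (2 ^ k) (2 ^ (k + 1))
  rw [intervalIntegrable_iff_integrableOn_Ico_of_le hle] at hI
  rw [← ofReal_integral_eq_lintegral_ofReal (hI.const_mul _)
    (Eventually.of_forall fun t => mul_nonneg h2k.le (lowWidth_nonneg L t)), integral_const_mul,
    intervalIntegral.integral_of_le hle, integral_Ico_eq_integral_Ioc]

end

theorem Real.tendsto_iterate_log_atTop (p : ℕ) : Tendsto (Real.log^[p]) atTop atTop :=
  Real.tendsto_log_atTop.iterate p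

theorem Real.exists_iterate_log_pos_le (p : ℕ) :
    ∃ x₀ : ℝ, ∀ x y, x₀ ≤ x → x ≤ y → 0 < Real.log^[p] x ∧ Real.log^[p] x ≤ Real.log^[p] y := by
  induction p with
  | zero => exact ⟨1, fun x y hx hxy => ⟨by simpa using by linarith, hxy⟩⟩
  | succ p ih =>
    obtain ⟨x₀, h⟩ := ih
    obtain ⟨x₁, h1⟩ := ((Real.tendsto_iterate_log_atTop (p + 1)).eventually_gt_atTop 0)
      |>.exists_forall_of_atTop
    refine ⟨max x₀ x₁, fun x y hx hxy => ⟨h1 x (le_of_max_le_right hx), ?_⟩⟩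
    rw [Function.iterate_succ_apply', Function.iterate_succ_apply']
    obtain ⟨h2, h3⟩ := h x y (le_of_max_le_left hx) hxy
    exact Real.log_le_log h2 h3

theorem Real.eventually_iterate_log_le (p : ℕ) : ∀ᶠ x : ℝ in atTop, Real.log^[p] x ≤ x := by
  induction p with
  | zero => simp
  | succ p ih =>
    filter_upwards [ih, (Real.tendsto_iterate_log_atTop p).eventually_gt_atTop 0] with x h1 h2
    rw [Function.iterate_succ_apply']
    linarith [Real.log_le_sub_one_of_pos h2]

theorem norm_le_maxModulus {f : ℂ → ℂ} (hf : Continuous f) (z : ℂ) :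
    ‖f z‖ ≤ maxModulus f ‖z‖ :=
  le_csSup ((isCompact_sphere _ _).image hf.norm).bddAbove ⟨z, by simp, rfl⟩

theorem eventually_log_norm_exp_le {f : ℂ → ℂ} (hf : Continuous f) {N m : ℕ}
    (hgrowth : ∀ᶠ r in atTop, Real.log (Real.log (maxModulus f r)) ≤
      ((N : ℝ) / 2 + 1 / Real.log^[m] r) * Real.log r) :
    ∀ᶠ t : ℝ in atTop, ∀ θ : ℝ, Real.log ‖f (Complex.exp (t + θ * Complex.I))‖ ≤
      Real.exp (((N : ℝ) / 2 + 1 / Real.log^[m] t) * t) := by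
  obtain ⟨x₀, hx₀⟩ := Real.exists_iterate_log_pos_le m
  filter_upwards [Real.tendsto_exp_atTop.eventually hgrowth, eventually_ge_atTop x₀,
    eventually_ge_atTop 0] with t h1 h2 h3 θ
  rw [Real.log_exp] at h1
  set z := Complex.exp (t + θ * Complex.I) with hz
  have hzn : ‖z‖ = Real.exp t := norm_exp_add_mul_I t θ
  have hM := norm_le_maxModulus hf z
  rw [hzn] at hM
  by_cases hle : Real.log ‖f z‖ ≤ 0
  · exact hle.trans (Real.exp_pos _).le
  push Not at hle
  have hfz : 0 < ‖f z‖ := by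
    by_contra! h
    rw [le_antisymm h (norm_nonneg _), Real.log_zero] at hle
    exact hle.false
  have hlog := Real.log_le_log hfz hM
  refine hlog.trans ((Real.le_exp_log _).trans (Real.exp_le_exp.2 (h1.trans ?_)))
  obtain ⟨h4, h5⟩ := hx₀ t (Real.exp t) h2 (by linarith [Real.add_one_le_exp t])
  gcongr

theorem two_pow_half_bound {k : ℕ} (hk : 16 ≤ k) : k * (7 + 3 * 2 ^ (k / 2)) ≤ 2 ^ k := by
  have h1 : ∀ q : ℕ, 8 ≤ q → 10 * (2 * q + 1) ≤ 2 ^ q := by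
    intro q hq
    induction q, hq using Nat.le_induction with
    | base => norm_num
    | succ q hq ih => rw [pow_succ]; omega
  have h2 := h1 (k / 2) (by omega)
  have h3 : 2 ^ (k / 2) * 2 ^ (k / 2) ≤ 2 ^ k := by
    rw [← pow_add]; exact Nat.pow_le_pow_right (by norm_num) (by omega)
  have h4 : 1 ≤ 2 ^ (k / 2) := Nat.one_le_two_pow
  calc k * (7 + 3 * 2 ^ (k / 2)) ≤ (2 * (k / 2) + 1) * (10 * 2 ^ (k / 2)) := by
        gcongr <;> omega
    _ = 10 * (2 * (k / 2) + 1) * 2 ^ (k / 2) := by ring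
    _ ≤ 2 ^ (k / 2) * 2 ^ (k / 2) := by gcongr
    _ ≤ 2 ^ k := h3

theorem le_of_density_inequality {n N X G J a u u' : ℝ} (hn : 1 ≤ n) (hN : N ≤ n) (hX : 1 ≤ X)
    (hu : 0 ≤ u) (hu' : u' ≤ u) (ha : a ≤ 5.4)
    (h : n ^ 2 * (2 * X - 3 * G) + n ^ 2 * J ≤ n * (a + (N + 2 * u') * (2 * X + 1))) :
    J ≤ 7 + 3 * G + 6 * X * u := by
  have hn0 : 0 < n := by linarith
  have h1 : (N + 2 * u') * (2 * X + 1) ≤ (n + 2 * u) * (2 * X + 1) := by gcongr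
  have h2 : n * (n * (2 * X - 3 * G + J)) ≤ n * (5.4 + (n + 2 * u) * (2 * X + 1)) := by
    have := mul_le_mul_of_nonneg_left (show a + (N + 2 * u') * (2 * X + 1) ≤
      5.4 + (n + 2 * u) * (2 * X + 1) by linarith) hn0.le
    calc _ = _ := by ring
      _ ≤ _ := h
      _ ≤ _ := this
  have h3 := le_of_mul_le_mul_left h2 hn0
  have h4 : u * (2 * X + 1) ≤ u * (3 * X) * n :=
    (mul_le_mul_of_nonneg_left (by linarith) hu).trans
      (le_mul_of_one_le_right (by positivity) hn)
  refine le_of_mul_le_mul_left (a := n) ?_ hn0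
  linarith

theorem InClassB.exists_isLogarithmicAbove {f : ℂ → ℂ} (hf : InClassB f) (R : ℝ) :
    ∃ ρ, 0 ≤ ρ ∧ R ≤ Real.exp ρ ∧ IsLogarithmicAbove f ρ := by
  obtain ⟨⟨hd, hp⟩, hb⟩ := hf
  obtain ⟨C, hC⟩ := hb.exists_norm_le
  set M := max (max 0 R) (max C ‖f 0‖) with hM
  have hle : M ≤ Real.exp M := by linarith [Real.add_one_le_exp M]
  refine ⟨M, by simp [hM], le_trans (by simp [hM]) hle, ⟨hd, hp, fun z hz h0 => ?_, fun a ha => ?_,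
    le_trans (by simp [hM]) hle⟩⟩
  · have h1 : ‖f z‖ ≤ C := hC _ (Or.inl ⟨z, h0, rfl⟩)
    have h2 : C ≤ M := by simp [hM]
    linarith
  · have h1 := hC _ (Or.inr ha)
    have h2 : C ≤ M := by simp [hM]
    linarith

/-- In large squares the set where `f ∘ exp` is not huge has small density. -/
theorem IsLogarithmicAbove.eventually_volume_low_le {f : ℂ → ℂ} {ρ R : ℝ}
    (hf : IsLogarithmicAbove f ρ) (hρ : 0 ≤ ρ) (hR : 0 < R) (hRρ : R ≤ Real.exp ρ) {N m : ℕ}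
    (hN : (componentsAR f R).ncard = N)
    (hgrowth : ∀ᶠ r in atTop, Real.log (Real.log (maxModulus f r)) ≤
      ((N : ℝ) / 2 + 1 / Real.log^[m] r) * Real.log r) :
    ∀ᶠ k : ℕ in atTop, ∀ j : ℤ,
      volume (dyadicSquare k j ∩
        {z | ‖f (Complex.exp z)‖ ≤ Real.exp (2 ^ (2 ^ (k / 2)))}) ≤
      ENNReal.ofReal (50 / Real.log^[m] k) * volume (dyadicSquare k j) := by
  have hc := hf.differentiable.continuous
  obtain ⟨z, hz⟩ : ∃ z, R < ‖f z‖ := by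
    by_contra! h
    exact hf.not_polynomial (exists_polynomial_of_norm_le_pow (r := 0) (C := R) 0 hf.differentiable
      (by simpa using h))
  obtain ⟨𝒱, h𝒱, hd, hne, hcard⟩ := exists_finset_isTract hc hz
  rw [hN] at hcard
  have hg : Tendsto (fun k : ℕ => 2 ^ (k / 2)) atTop atTop :=
    (tendsto_pow_atTop_atTop_of_one_lt (one_lt_two (α := ℕ))).comp
      (Nat.tendsto_div_const_atTop two_ne_zero)
  have hE : ∀ᶠ g : ℕ in atTop, ∀ V ∈ 𝒱, ∀ L, ρ + 1 ≤ L → L ≤ 2 ^ g →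
      1 ≤ levelEnergyDeriv f V L (3 * g) :=
    (Finset.eventually_all 𝒱).2 fun V hV =>
      hf.eventually_one_le_levelEnergyDeriv hρ (h𝒱 V hV) hR hRρ
  have hL : ∀ᶠ g : ℕ in atTop, ρ + 1 ≤ (2 : ℝ) ^ g :=
    (tendsto_pow_atTop_atTop_of_one_lt (one_lt_two (α := ℝ))).eventually_ge_atTop _
  have hT : Tendsto (fun k : ℕ => (2 : ℝ) ^ (k + 1) + 1) atTop atTop :=
    tendsto_atTop_add_const_right _ _
      ((tendsto_pow_atTop_atTop_of_one_lt (one_lt_two (α := ℝ))).comp (tendsto_add_atTop_nat 1))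
  obtain ⟨x₀, hx₀⟩ := Real.exists_iterate_log_pos_le m
  filter_upwards [hg.eventually hE, hg.eventually hL,
    hT.eventually (eventually_log_norm_exp_le hc hgrowth), eventually_ge_atTop 16,
    tendsto_natCast_atTop_atTop.eventually (eventually_ge_atTop x₀),
    tendsto_natCast_atTop_atTop.eventually (Real.eventually_iterate_log_le m)]
    with k hkE hkL hkB hk16 hkx hklog j
  have h2k : (0 : ℝ) < 2 ^ k := by positivity
  have hkk : (k : ℝ) ≤ 2 ^ k := by exact_mod_cast Nat.lt_two_pow_self.le
  obtain ⟨hlpos, hlle⟩ := hx₀ k (2 ^ (k + 1) + 1) hkx (by rw [pow_succ]; linarith)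
  set l := Real.log^[m] k with hl
  set l' := Real.log^[m] (2 ^ (k + 1) + 1) with hl'
  have hbd : (k : ℝ) * (7 + 3 * 2 ^ (k / 2)) ≤ 2 ^ k := by exact_mod_cast two_pow_half_bound hk16
  have hk16' : (16 : ℝ) ≤ k := by exact_mod_cast hk16
  have hgpos : (0 : ℝ) < 2 ^ (k / 2) := by positivity
  have ht0 : 3 * ((2 ^ (k / 2) : ℕ) : ℝ) ≤ 2 ^ k := by
    push_cast
    nlinarith
  have hle : (2 : ℝ) ^ k ≤ 2 ^ (k + 1) := by rw [pow_succ]; linarith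
  set B := Real.exp (((N : ℝ) / 2 + 1 / l') * (2 ^ (k + 1) + 1)) with hBdef
  set L : ℝ := 2 ^ (2 ^ (k / 2)) with hLdef
  have hmain := hf.integral_lowWidth_le (L := L) (B := B) (t₀ := 3 * ((2 ^ (k / 2) : ℕ) : ℝ))
    (T := 2 ^ (k + 1)) h𝒱 hd hne hρ hRρ hkL (ht0.trans hle)
    (fun V hV => hkE V hV L hkL le_rfl) (Real.exp_pos _) (by exact_mod_cast hkB)
  have hlogB : Real.log (2 * Real.pi * B ^ 2) =
      Real.log (2 * Real.pi) + (N + 2 / l') * (2 ^ (k + 1) + 1) := by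
    rw [Real.log_mul (by positivity) (by positivity), Real.log_pow, hBdef, Real.log_exp]
    push_cast; ring
  rw [hlogB] at hmain
  have hn : (1 : ℝ) ≤ 𝒱.card := by exact_mod_cast hne.card_pos
  have hNn : (N : ℝ) ≤ 𝒱.card := by exact_mod_cast hcard
  set n : ℝ := (𝒱.card : ℝ) with hndef
  have hpi4 := Real.pi_le_four
  have hpi := Real.pi_pos
  have hlog2pi : Real.log (2 * Real.pi) ≤ 5.4 := by
    have h1 := Real.log_le_sub_one_of_pos (show 0 < 2 * Real.pi by positivity)
    have := Real.pi_lt_d2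
    linarith
  have hI : ∫ t in (2 ^ k : ℝ)..2 ^ (k + 1), lowWidth f L t ≤
      ∫ t in (3 * ((2 ^ (k / 2) : ℕ) : ℝ))..2 ^ (k + 1), lowWidth f L t :=
    intervalIntegral.integral_mono_interval ht0 hle le_rfl
      (Eventually.of_forall fun t => lowWidth_nonneg L t) (intervalIntegrable_lowWidth hc _ _ _)
  set I := ∫ t in (3 * ((2 ^ (k / 2) : ℕ) : ℝ))..2 ^ (k + 1), lowWidth f L t with hIdef
  set X : ℝ := 2 ^ k with hX
  have hX2 : (2 : ℝ) ^ (k + 1) = 2 * X := by rw [pow_succ]; ring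
  rw [hX2] at hmain
  push_cast at hmain
  set G : ℝ := 2 ^ (k / 2) with hG
  have hl'inv : 1 / l' ≤ 1 / l := one_div_le_one_div_of_le hlpos hlle
  have hl'0 : 0 < 1 / l' := by have := hlpos.trans_le hlle; positivity
  have hIle : I / (2 * Real.pi) ≤ 7 + 3 * G + 6 * X / l := by
    have hX1 : 1 ≤ X := one_le_pow₀ one_le_two
    have e : 6 * X / l = 6 * X * (1 / l) := by ring
    rw [e]
    refine le_of_density_inequality hn hNn hX1 (by positivity) hl'inv hlog2pi ?_
    calc _ = _ := by ring
      _ ≤ _ := hmain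
      _ = _ := by ring
  have hsmall : 7 + 3 * G ≤ X / l := by
    rw [le_div_iff₀ hlpos]
    have : (7 + 3 * G) * l ≤ (7 + 3 * G) * k := by gcongr
    linarith
  have hfin : I ≤ 50 / l * X := by
    rw [div_le_iff₀ (by positivity)] at hIle
    have h1 : 7 + 3 * G + 6 * X / l ≤ 7 * (X / l) := by
      have : 6 * X / l = 6 * (X / l) := by ring
      linarith
    have h2 : 0 < X / l := by positivity
    have h3 := Real.pi_lt_d2
    have e : 50 / l * X = 50 * (X / l) := by ring
    rw [e]
    nlinarith
  refine (volume_dyadicSquare_inter_low_le hc L k j).trans ?_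
  rw [volume_dyadicSquare, ← ENNReal.ofReal_mul (by positivity)]
  refine ENNReal.ofReal_le_ofReal ?_
  calc X * ∫ t in (2 ^ k : ℝ)..2 ^ (k + 1), lowWidth f L t ≤ X * (50 / l * X) := by
        gcongr; exact hI.trans hfin
    _ = 50 / l * (X * X) := by ring

/-- The guaranteed growth of levels under iteration. -/
def levelStep (k : ℕ) : ℕ := 2 ^ (k / 2)

theorem levelStep_mono : Monotone levelStep := fun _ _ h =>
  Nat.pow_le_pow_right two_pos (Nat.div_le_div_right h)

theorem two_mul_le_levelStep {k : ℕ} (hk : 30 ≤ k) : 2 * k ≤ levelStep k := by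
  have h1 : ∀ q : ℕ, 8 ≤ q → 2 * (2 * q + 1) ≤ 2 ^ q := by
    intro q hq
    induction q, hq using Nat.le_induction with
    | base => norm_num
    | succ q hq ih => rw [pow_succ]; omega
  have := h1 (k / 2) (by omega)
  rw [levelStep]; omega

theorem two_pow_mul_le_iterate_levelStep {k : ℕ} (hk : 30 ≤ k) (i : ℕ) :
    2 ^ i * k ≤ levelStep^[i] k := by
  induction i with
  | zero => simp
  | succ i ih =>
    rw [Function.iterate_succ_apply', pow_succ]
    have h1 : 1 ≤ 2 ^ i := Nat.one_le_two_pow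
    have := two_mul_le_levelStep (k := levelStep^[i] k) (by nlinarith)
    linarith

theorem le_iterate_levelStep {k : ℕ} (hk : 30 ≤ k) (i : ℕ) : k ≤ levelStep^[i] k :=
  le_trans (Nat.le_mul_of_pos_left _ (by positivity)) (two_pow_mul_le_iterate_levelStep hk i)

theorem div_six_le_log_levelStep_div_six {k : ℕ} (hk : 30 ≤ k) :
    (k : ℝ) / 6 ≤ Real.log ((levelStep k : ℝ) / 6) := by
  have h1 : ((k / 2 : ℕ) : ℝ) ≥ k / 2 - 1 / 2 := by
    have : k ≤ 2 * (k / 2) + 1 := by omega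
    have : (k : ℝ) ≤ 2 * (k / 2 : ℕ) + 1 := by exact_mod_cast this
    linarith
  have h2 : (30 : ℝ) ≤ k := by exact_mod_cast hk
  have h3 := Real.log_two_gt_d9
  have h4 : Real.log 6 ≤ 3 * Real.log 2 := by
    rw [← Real.log_rpow two_pos]
    exact Real.log_le_log (by norm_num) (by norm_num)
  have h5 := Real.log_two_lt_d9
  rw [levelStep, Nat.cast_pow, Real.log_div (by positivity) (by norm_num), Real.log_pow]
  push_cast
  nlinarith

theorem div_six_le_iterate_log {k : ℕ} (hk : 30 ≤ k) (p : ℕ) :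
    (k : ℝ) / 6 ≤ Real.log^[p] (levelStep^[p] k : ℕ) := by
  induction p generalizing k with
  | zero => simp; linarith [(Nat.cast_nonneg k : (0 : ℝ) ≤ k)]
  | succ p ih =>
    rw [Function.iterate_succ_apply', Function.iterate_succ_apply]
    have h1 : 30 ≤ levelStep k := by have := two_mul_le_levelStep hk; omega
    refine (div_six_le_log_levelStep_div_six hk).trans ?_
    exact Real.log_le_log (by have : 0 < levelStep k := by omega
                              positivity) (ih h1)

theorem exists_forall_sum_div_iterate_log_le (p K : ℕ) {C η : ℝ} (hC : 0 ≤ C) (hη : 0 < η) :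
    ∃ k ≥ K, ∀ n, ∑ i ∈ Finset.range n, C / Real.log^[p] (levelStep^[i] k : ℕ) ≤ η := by
  obtain ⟨M, hM⟩ := exists_nat_ge (12 * C / η)
  set q := max (max 30 K) M with hq
  have hq30 : 30 ≤ q := by simp [hq]
  have hqK : K ≤ q := by simp [hq]
  have hqM : M ≤ q := by simp [hq]
  refine ⟨levelStep^[p] q, hqK.trans (le_iterate_levelStep hq30 p), fun n => ?_⟩
  have hq0 : (0 : ℝ) < q := by have : 0 < q := by omega
                               exact_mod_cast this
  have hterm : ∀ i ∈ Finset.range n,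
      C / Real.log^[p] (levelStep^[i] (levelStep^[p] q) : ℕ) ≤ 6 * C / q * (1 / 2) ^ i := by
    intro i _
    rw [← Function.iterate_add_apply, add_comm, Function.iterate_add_apply]
    have h1 := div_six_le_iterate_log (hq30.trans (le_iterate_levelStep hq30 i)) p
    have h2 : (2 : ℝ) ^ i * q ≤ (levelStep^[i] q : ℕ) := by
      exact_mod_cast two_pow_mul_le_iterate_levelStep hq30 i
    have h3 : 6 * C / q * (1 / 2) ^ i = C / (2 ^ i * q / 6) := by
      rw [one_div, inv_pow]; field_simp
    rw [h3]
    have h4 : (0 : ℝ) < 2 ^ i * q / 6 := by positivity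
    exact div_le_div_of_nonneg_left hC h4 (by linarith)
  refine (Finset.sum_le_sum hterm).trans ?_
  rw [← Finset.mul_sum]
  have h5 : ∑ i ∈ Finset.range n, (1 / 2 : ℝ) ^ i ≤ 2 := sum_geometric_two_le n
  have hqM' : (M : ℝ) ≤ q := by exact_mod_cast hqM
  have h6 : 12 * C / η ≤ q := hM.trans hqM'
  rw [div_le_iff₀ hη] at h6
  calc 6 * C / q * ∑ i ∈ Finset.range n, (1 / 2 : ℝ) ^ i ≤ 6 * C / q * 2 := by gcongr
    _ = 12 * C / q := by ring
    _ ≤ η := by rw [div_le_iff₀ hq0]; linarith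

/-- The points whose first `n` steps under `f` increase the level as prescribed by `levelStep`. -/
def growingSet (f : ℂ → ℂ) : ℕ → Set ℂ
  | 0 => Set.univ
  | n + 1 => {w | (∃ k : ℕ, Real.exp (2 ^ k) ≤ ‖w‖ ∧ ‖w‖ < Real.exp (2 ^ (k + 1)) ∧
      Real.exp (2 ^ levelStep k) < ‖f w‖) ∧ f w ∈ growingSet f n}

section

variable {f : ℂ → ℂ}

theorem growingSet_succ (n : ℕ) : growingSet f (n + 1) =
    {w | ∃ k : ℕ, Real.exp (2 ^ k) ≤ ‖w‖ ∧ ‖w‖ < Real.exp (2 ^ (k + 1)) ∧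
      Real.exp (2 ^ levelStep k) < ‖f w‖} ∩ f ⁻¹' growingSet f n := rfl

theorem measurableSet_growingSet (hf : Continuous f) (n : ℕ) :
    MeasurableSet (growingSet f n) := by
  induction n with
  | zero => exact MeasurableSet.univ
  | succ n ih =>
    rw [growingSet_succ]
    refine MeasurableSet.inter ?_ (hf.measurable ih)
    have : {w : ℂ | ∃ k : ℕ, Real.exp (2 ^ k) ≤ ‖w‖ ∧ ‖w‖ < Real.exp (2 ^ (k + 1)) ∧
        Real.exp (2 ^ levelStep k) < ‖f w‖} =
        ⋃ k : ℕ, ({w : ℂ | Real.exp (2 ^ k) ≤ ‖w‖} ∩ ({w : ℂ | ‖w‖ < Real.exp (2 ^ (k + 1))} ∩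
          {w : ℂ | Real.exp (2 ^ levelStep k) < ‖f w‖})) := by
      ext w; simp
    rw [this]
    refine MeasurableSet.iUnion fun k => ?_
    exact (isClosed_le continuous_const continuous_norm).measurableSet.inter
      ((isOpen_lt continuous_norm continuous_const).measurableSet.inter
        (isOpen_lt continuous_const hf.norm).measurableSet)

theorem growingSet_succ_subset (n : ℕ) : growingSet f (n + 1) ⊆ growingSet f n := by
  induction n with
  | zero => exact Set.subset_univ _
  | succ n ih => exact fun w hw => ⟨hw.1, ih hw.2⟩

theorem level_unique {x : ℝ} {k l : ℕ} (hk : 2 ^ k ≤ x) (hk' : x < 2 ^ (k + 1))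
    (hl : 2 ^ l ≤ x) (hl' : x < 2 ^ (l + 1)) : k = l := by
  have h1 : k < l + 1 := (pow_lt_pow_iff_right₀ (one_lt_two (α := ℝ))).1 (hk.trans_lt hl')
  have h2 : l < k + 1 := (pow_lt_pow_iff_right₀ (one_lt_two (α := ℝ))).1 (hl.trans_lt hk')
  omega

theorem exists_level {x : ℝ} (hx : 1 ≤ x) : ∃ k : ℕ, 2 ^ k ≤ x ∧ x < 2 ^ (k + 1) :=
  exists_nat_pow_near hx one_lt_two

theorem mem_escapingSet_of_forall_mem_growingSet {w : ℂ}
    (hw : ∀ n, w ∈ growingSet f n) (hlarge : Real.exp (2 ^ 30) ≤ ‖w‖) : w ∈ escapingSet f := by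
  have hit : ∀ i n, f^[i] w ∈ growingSet f n := by
    intro i
    induction i with
    | zero => exact hw
    | succ i ih =>
      intro n
      rw [Function.iterate_succ_apply']
      exact (ih (n + 1)).2
  have hlev : ∀ i, Real.exp (2 ^ (30 + i)) ≤ ‖f^[i] w‖ := by
    intro i
    induction i with
    | zero => exact hlarge
    | succ i ih =>
      obtain ⟨k, -, hk2, hk3⟩ := (hit i 1).1
      have h1 : 30 + i < k + 1 := by
        have := Real.exp_lt_exp.1 (ih.trans_lt hk2)
        exact (pow_lt_pow_iff_right₀ (one_lt_two (α := ℝ))).1 this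
      have h2 := two_mul_le_levelStep (k := k) (by omega)
      rw [Function.iterate_succ_apply']
      refine le_trans (Real.exp_le_exp.2 ?_) hk3.le
      exact pow_le_pow_right₀ one_le_two (by omega)
  refine tendsto_atTop_mono hlev (Real.tendsto_exp_atTop.comp ?_)
  exact (tendsto_pow_atTop_atTop_of_one_lt (one_lt_two (α := ℝ))).comp
    (tendsto_atTop_mono (fun i => by simp) tendsto_id)

theorem volume_pos_of_volume_exp_preimage_pos {A : Set ℂ} {S : Set ℂ} (hA : MeasurableSet A)
    (hpos : 0 < volume A) (hS : ∀ z ∈ A, Complex.exp z ∈ S) : 0 < volume S := by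
  have hfl : Measurable fun z : ℂ => ⌊z.im / 6⌋ := by fun_prop
  have hcov : A = ⋃ j : ℤ, A ∩ {z | ⌊z.im / 6⌋ = j} := by
    ext z; simp
  obtain ⟨j, hj⟩ : ∃ j : ℤ, volume (A ∩ {z | ⌊z.im / 6⌋ = j}) ≠ 0 := by
    by_contra! h
    rw [hcov, measure_iUnion_null_iff.2 h] at hpos
    exact hpos.false
  have hm : MeasurableSet (A ∩ {z | ⌊z.im / 6⌋ = j}) := hA.inter (hfl (measurableSet_singleton j))
  have hinj : Set.InjOn Complex.exp (A ∩ {z | ⌊z.im / 6⌋ = j}) := by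
    rintro z ⟨_, hz⟩ w ⟨_, hw⟩ h
    obtain ⟨n, hn⟩ := Complex.exp_eq_exp_iff_exists_int.1 h
    have him : z.im = w.im + n * (2 * Real.pi) := by rw [hn]; simp
    have hz' : ⌊z.im / 6⌋ = j := hz
    have hw' : ⌊w.im / 6⌋ = j := hw
    rw [Int.floor_eq_iff] at hz' hw'
    have hpi := Real.pi_gt_three
    have hn0 : n = 0 := by
      have h1 : (n : ℝ) < 1 := by by_contra! h; nlinarith
      have h2 : (-1 : ℝ) < n := by by_contra! h; nlinarith
      have h1' : n < 1 := by exact_mod_cast h1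
      have h2' : -1 < n := by exact_mod_cast h2
      omega
    simpa [hn0] using hn
  have harea := volume_image_eq_lintegral_norm_deriv_sq hm
    (fun z _ => Complex.differentiable_exp z) hinj
  refine lt_of_lt_of_le ?_ (measure_mono (show Complex.exp '' (A ∩ {z | ⌊z.im / 6⌋ = j}) ⊆ S by
    rintro _ ⟨z, hz, rfl⟩; exact hS z hz.1))
  rw [harea, pos_iff_ne_zero, ne_eq,
    lintegral_eq_zero_iff (by simp only [Complex.deriv_exp]; fun_prop)]
  intro h0
  refine hj ?_
  rw [← Measure.restrict_apply_univ]
  refine le_antisymm ?_ zero_le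
  rw [← ae_iff.1 h0]
  refine measure_mono fun z _ => ?_
  simp [Complex.norm_exp]

end

/-- The centre of `dyadicSquare k j`. -/
noncomputable def dyadicCenter (k : ℕ) (j : ℤ) : ℂ := ⟨3 / 2 * 2 ^ k, (j + 1 / 2) * 2 ^ k⟩

theorem dyadicSquare_subset_closedBall (k : ℕ) (j : ℤ) :
    dyadicSquare k j ⊆ Metric.closedBall (dyadicCenter k j) (71 / 100 * 2 ^ k) := by
  intro z hz
  rw [mem_dyadicSquare, pow_succ] at hz
  obtain ⟨⟨h1, h2⟩, h3, h4⟩ := hz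
  have h2k : (0 : ℝ) < 2 ^ k := by positivity
  rw [mem_closedBall_iff_norm, ← sq_le_sq₀ (norm_nonneg _) (by positivity), Complex.sq_norm,
    Complex.normSq_apply]
  simp only [dyadicCenter, Complex.sub_re, Complex.sub_im]
  set X : ℝ := 2 ^ k
  have ha : (z.re - 3 / 2 * X) ^ 2 ≤ (X / 2) ^ 2 :=
    sq_le_sq' (by linarith) (by linarith)
  have hb : (z.im - (j + 1 / 2) * X) ^ 2 ≤ (X / 2) ^ 2 := by
    refine sq_le_sq' ?_ ?_ <;> linarith
  nlinarith

theorem re_of_mem_ball_dyadicCenter {k : ℕ} {j : ℤ} {z : ℂ}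
    (hz : z ∈ Metric.ball (dyadicCenter k j) (29 / 20 * 2 ^ k)) : 2 ^ k / 20 < z.re := by
  rw [mem_ball_iff_norm] at hz
  have h1 := (Complex.abs_re_le_norm _).trans_lt hz
  rw [Complex.sub_re, abs_lt] at h1
  simp only [dyadicCenter] at h1
  linarith [h1.1]

theorem pairwise_disjoint_dyadicSquare {k l : ℕ} {i j : ℤ} {z : ℂ} (h : z ∈ dyadicSquare k i)
    (h' : z ∈ dyadicSquare l j) : k = l ∧ i = j := by
  rw [mem_dyadicSquare] at h h'
  obtain rfl := level_unique h.1.1 h.1.2 h'.1.1 h'.1.2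
  refine ⟨rfl, ?_⟩
  have h2k : (0 : ℝ) < 2 ^ k := by positivity
  have h1 := lt_of_mul_lt_mul_right (h.2.1.trans_lt h'.2.2) h2k.le
  have h2 := lt_of_mul_lt_mul_right (h'.2.1.trans_lt h.2.2) h2k.le
  have h1' : i < j + 1 := by exact_mod_cast h1
  have h2' : j < i + 1 := by exact_mod_cast h2
  omega

theorem exists_mem_dyadicSquare {z : ℂ} (hz : 1 ≤ z.re) : ∃ k j, z ∈ dyadicSquare k j := by
  obtain ⟨k, hk⟩ := exists_level hz
  have h2k : (0 : ℝ) < 2 ^ k := by positivity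
  refine ⟨k, ⌊z.im / 2 ^ k⌋, mem_dyadicSquare.2 ⟨hk, ?_, ?_⟩⟩
  · rw [← le_div_iff₀ h2k]; exact Int.floor_le _
  · rw [← div_lt_iff₀ h2k]; exact Int.lt_floor_add_one _

/-- The points of `dyadicSquare k j` at distance at least `D` from the boundary. -/
def dyadicInner (k : ℕ) (j : ℤ) (D : ℝ) : Set ℂ :=
  Set.Ico (2 ^ k + D : ℝ) (2 ^ (k + 1) - D) ×ℂ Set.Ico (j * 2 ^ k + D : ℝ) ((j + 1) * 2 ^ k - D)

theorem mem_dyadicSquare_of_dist_lt {k : ℕ} {j : ℤ} {D : ℝ} {z w : ℂ}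
    (hz : z ∈ dyadicInner k j D) (hw : ‖w - z‖ < D) : w ∈ dyadicSquare k j := by
  rw [dyadicInner, Complex.mem_reProdIm] at hz
  obtain ⟨⟨h1, h2⟩, h3, h4⟩ := hz
  have hre := abs_lt.1 ((Complex.abs_re_le_norm _).trans_lt hw)
  have him := abs_lt.1 ((Complex.abs_im_le_norm _).trans_lt hw)
  rw [Complex.sub_re] at hre
  rw [Complex.sub_im] at him
  rw [mem_dyadicSquare]
  refine ⟨⟨?_, ?_⟩, ?_, ?_⟩ <;> linarith [hre.1, hre.2, him.1, him.2]

theorem measurableSet_dyadicInner (k : ℕ) (j : ℤ) (D : ℝ) : MeasurableSet (dyadicInner k j D) :=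
  (Complex.measurable_re measurableSet_Ico).inter (Complex.measurable_im measurableSet_Ico)

theorem volume_dyadicSquare_diff_inner_le {k : ℕ} {D : ℝ} (j : ℤ) (hD : 0 ≤ D)
    (hk : 2 * D ≤ 2 ^ k) :
    volume (dyadicSquare k j \ dyadicInner k j D) ≤
      ENNReal.ofReal (4 * D / 2 ^ k) * volume (dyadicSquare k j) := by
  have h2k : (0 : ℝ) < 2 ^ k := by positivity
  have hsub : dyadicInner k j D ⊆ dyadicSquare k j := by
    intro z hz
    rw [dyadicInner, Complex.mem_reProdIm] at hz
    obtain ⟨⟨h1, h2⟩, h3, h4⟩ := hz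
    rw [mem_dyadicSquare]
    refine ⟨⟨?_, ?_⟩, ?_, ?_⟩ <;> linarith
  have e1 : (2 : ℝ) ^ (k + 1) - D - (2 ^ k + D) = 2 ^ k - 2 * D := by rw [pow_succ]; ring
  have e2 : ((j : ℝ) + 1) * 2 ^ k - D - (j * 2 ^ k + D) = 2 ^ k - 2 * D := by ring
  have hvol : volume (dyadicInner k j D) =
      ENNReal.ofReal ((2 ^ k - 2 * D) * (2 ^ k - 2 * D)) := by
    rw [dyadicInner, volume_reProdIm, Real.volume_Ico, Real.volume_Ico, e1, e2,
      ← ENNReal.ofReal_mul (by linarith)]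
  rw [measure_sdiff hsub (measurableSet_dyadicInner k j D).nullMeasurableSet
    (by rw [hvol]; exact ENNReal.ofReal_ne_top), hvol, volume_dyadicSquare,
    ← ENNReal.ofReal_sub _ (by nlinarith), ← ENNReal.ofReal_mul (by positivity)]
  refine ENNReal.ofReal_le_ofReal ?_
  have : 4 * D / 2 ^ k * (2 ^ k * 2 ^ k) = 4 * D * 2 ^ k := by field_simp
  rw [this]
  nlinarith

/-- The distortion constant for areas. -/
noncomputable def areaDistortion : ENNReal := ENNReal.ofReal (Real.exp 36) ^ 4

theorem Univalent.volume_image_le {ψ : ℂ → ℂ} {c : ℂ} {r : ℝ} (hr : 0 < r)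
    (hψ : Univalent ψ (Metric.ball c r)) {A Q : Set ℂ} (hA : MeasurableSet A)
    (hQ : MeasurableSet Q) (hAQ : A ⊆ Q) (hQc : Q ⊆ Metric.closedBall c (r / 2)) {δ : ENNReal}
    (h : volume A ≤ δ * volume Q) :
    volume (ψ '' A) ≤ areaDistortion * δ * volume (ψ '' Q) := by
  have hsub : Q ⊆ Metric.ball c r :=
    hQc.trans (Metric.closedBall_subset_ball (by linarith))
  have hdiff : ∀ z ∈ Q, DifferentiableAt ℂ ψ z := fun z hz =>
    hψ.1.differentiableAt (Metric.isOpen_ball.mem_nhds (hsub hz))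
  have hc : c ∈ Metric.closedBall c (r / 2) := Metric.mem_closedBall_self (by linarith)
  set M := ENNReal.ofReal (Real.exp 36) with hM
  set d := ENNReal.ofReal (‖deriv ψ c‖ ^ 2) with hd
  have hup : volume (ψ '' A) ≤ M ^ 2 * d * volume A := by
    rw [volume_image_eq_lintegral_norm_deriv_sq hA (fun z hz => hdiff z (hAQ hz))
      (hψ.2.1.mono (hAQ.trans hsub)), ← setLIntegral_const]
    refine setLIntegral_mono' hA fun z hz => ?_
    rw [hM, hd, ← ENNReal.ofReal_pow (by positivity), ← ENNReal.ofReal_mul (by positivity),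
      ← mul_pow]
    refine ENNReal.ofReal_le_ofReal (pow_le_pow_left₀ (norm_nonneg _) ?_ 2)
    exact hψ.norm_deriv_le_of_mem_closedBall hr hc (hQc (hAQ hz))
  have hdn : d * volume Q ≤ M ^ 2 * volume (ψ '' Q) := by
    rw [volume_image_eq_lintegral_norm_deriv_sq hQ hdiff (hψ.2.1.mono hsub), ← setLIntegral_const,
      ← lintegral_const_mul' _ _ (by finiteness)]
    refine setLIntegral_mono' hQ fun z hz => ?_
    rw [hM, hd, ← ENNReal.ofReal_pow (by positivity), ← ENNReal.ofReal_mul (by positivity),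
      ← mul_pow]
    refine ENNReal.ofReal_le_ofReal (pow_le_pow_left₀ (norm_nonneg _) ?_ 2)
    exact hψ.norm_deriv_le_of_mem_closedBall hr (hQc hz) hc
  calc volume (ψ '' A) ≤ M ^ 2 * d * (δ * volume Q) := hup.trans (by gcongr)
    _ = M ^ 2 * δ * (d * volume Q) := by ring
    _ ≤ M ^ 2 * δ * (M ^ 2 * volume (ψ '' Q)) := by gcongr
    _ = areaDistortion * δ * volume (ψ '' Q) := by rw [areaDistortion]; ring

theorem Univalent.comp {g h : ℂ → ℂ} {U V : Set ℂ} (hg : Univalent g V) (hh : Univalent h U)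
    (hU : IsOpen U) (hV : IsOpen V) (hm : Set.MapsTo h U V) : Univalent (g ∘ h) U := by
  refine ⟨hg.1.comp hh.1 hm, hg.2.1.comp hh.2.1 hm, fun z hz => ?_⟩
  rw [deriv_comp z (hg.1.differentiableAt (hV.mem_nhds (hm hz)))
    (hh.1.differentiableAt (hU.mem_nhds hz))]
  exact mul_ne_zero (hg.2.2 _ (hm hz)) (hh.2.2 z hz)

/-- Lifts map the discs around far away dyadic squares to sets of bounded diameter. -/
theorem IsLogarithmicAbove.norm_lift_sub_lt {f Φ : ℂ → ℂ} {ρ : ℝ} (hf : IsLogarithmicAbove f ρ)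
    (hΦ : IsLogLift f ρ Φ) {k : ℕ} {j : ℤ} (hk : 40 * |ρ| ≤ 2 ^ k) {ζ ξ : ℂ}
    (hζ : ζ ∈ Metric.ball (dyadicCenter k j) (29 / 20 * 2 ^ k))
    (hξ : ξ ∈ Metric.ball (dyadicCenter k j) (29 / 20 * 2 ^ k)) : ‖Φ ζ - Φ ξ‖ < 20000 := by
  have h2k : (0 : ℝ) < 2 ^ k := by positivity
  set b := Metric.ball (dyadicCenter k j) (29 / 20 * 2 ^ k) with hb
  have hre : ∀ z ∈ b, 2 ^ k / 40 < z.re - ρ := fun z hz => by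
    have := re_of_mem_ball_dyadicCenter hz
    have := le_abs_self ρ
    linarith
  have hsub : b ⊆ rightHalfPlane ρ := fun z hz => by
    have := hre z hz
    show ρ < z.re
    linarith
  have hbound : ∀ z ∈ b, ‖deriv Φ z‖ ≤ 36 * Real.pi * 40 / 2 ^ k := by
    intro z hz
    have h1 := hf.norm_deriv_lift_le hΦ (hsub hz)
    rw [le_div_iff₀ h2k]
    have h2 := mul_le_mul_of_nonneg_right (hre z hz).le (norm_nonneg (deriv Φ z))
    linarith
  have h3 := (convex_ball _ _).norm_image_sub_le_of_norm_deriv_le (f := Φ)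
    (fun z hz => hΦ.1.differentiableAt ((isOpen_rightHalfPlane ρ).mem_nhds (hsub hz)))
    hbound hξ hζ
  have h4 : ‖ζ - ξ‖ ≤ 29 / 10 * 2 ^ k := by
    rw [← dist_eq_norm]
    have := dist_triangle_right ζ ξ (dyadicCenter k j)
    rw [hb, Metric.mem_ball] at hζ hξ
    linarith
  have hpi := Real.pi_lt_d2
  calc ‖Φ ζ - Φ ξ‖ ≤ 36 * Real.pi * 40 / 2 ^ k * (29 / 10 * 2 ^ k) :=
        h3.trans (mul_le_mul_of_nonneg_left h4 (by positivity))
    _ = 36 * Real.pi * 40 * (29 / 10) := by field_simp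
    _ < 20000 := by linarith

theorem dyadicCenter_mem (k : ℕ) (j : ℤ) : dyadicCenter k j ∈ dyadicSquare k j := by
  have h2k : (0 : ℝ) < 2 ^ k := by positivity
  rw [mem_dyadicSquare, pow_succ, dyadicCenter]
  refine ⟨⟨?_, ?_⟩, ?_, ?_⟩ <;> simp only <;> linarith

theorem dyadicSquare_subset_ball (k : ℕ) (j : ℤ) :
    dyadicSquare k j ⊆ Metric.ball (dyadicCenter k j) (29 / 20 * 2 ^ k) := by
  have h2k : (0 : ℝ) < 2 ^ k := by positivity
  exact (dyadicSquare_subset_closedBall k j).trans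
    (Metric.closedBall_subset_ball (by linarith))

theorem ball_dyadicCenter_subset_rightHalfPlane {k : ℕ} {j : ℤ} {ρ : ℝ} (hk : 40 * |ρ| ≤ 2 ^ k) :
    Metric.ball (dyadicCenter k j) (29 / 20 * 2 ^ k) ⊆ rightHalfPlane ρ := fun z hz => by
  have h1 := re_of_mem_ball_dyadicCenter hz
  have h2 := le_abs_self ρ
  have h3 := abs_nonneg ρ
  show ρ < z.re
  linarith

theorem IsLogarithmicAbove.countable_images_lift {f : ℂ → ℂ} {ρ : ℝ}
    (hf : IsLogarithmicAbove f ρ) :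
    {T | ∃ Φ, IsLogLift f ρ Φ ∧ Φ '' rightHalfPlane ρ = T}.Countable := by
  refine Set.PairwiseDisjoint.countable_of_isOpen (s := id) ?_ ?_ ?_
  · rintro _ ⟨Φ, hΦ, rfl⟩ _ ⟨Ψ, hΨ, rfl⟩ hne
    by_contra h
    exact hne (hf.image_lift_eq hΦ hΨ h)
  · rintro _ ⟨Φ, hΦ, rfl⟩
    exact hf.isOpen_image_lift hΦ
  · rintro _ ⟨Φ, hΦ, rfl⟩
    exact Set.Nonempty.image _ ⟨(ρ + 1 : ℝ), by show ρ < _; simp⟩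

/-- The accumulated density of points which fail to grow in one of the first `n` steps. -/
noncomputable def failureBound (ε : ℕ → ENNReal) (n k : ℕ) : ENNReal :=
  ∑ i ∈ Finset.range n, areaDistortion * (2 * ε (levelStep^[i] k))

theorem failureBound_succ (ε : ℕ → ENNReal) (n k : ℕ) : failureBound ε (n + 1) k =
    areaDistortion * (2 * ε k) + failureBound ε n (levelStep k) := by
  rw [failureBound, Finset.sum_range_succ', add_comm]
  rfl

theorem failureBound_anti {ε : ℕ → ENNReal} {K : ℕ} (hK : 30 ≤ K)
    (hε : ∀ k ≥ K, ∀ l ≥ k, ε l ≤ ε k) (n : ℕ) {k l : ℕ} (hk : K ≤ k) (hkl : k ≤ l) :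
    failureBound ε n l ≤ failureBound ε n k := by
  refine Finset.sum_le_sum fun i _ => ?_
  gcongr
  exact hε _ (hk.trans (le_iterate_levelStep (hK.trans hk) i)) _ (levelStep_mono.iterate i hkl)

theorem IsLogarithmicAbove.volume_image_diff_growingSet_le {f : ℂ → ℂ} {ρ : ℝ}
    (hf : IsLogarithmicAbove f ρ) {ε : ℕ → ENNReal} {K : ℕ} (hK : 30 ≤ K)
    (hρ : 40 * |ρ| ≤ 2 ^ K)
    (hlow : ∀ k ≥ K, ∀ j, volume (dyadicSquare k j ∩
      {z | ‖f (Complex.exp z)‖ ≤ Real.exp (2 ^ levelStep k)}) ≤ ε k * volume (dyadicSquare k j))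
    (hlayer : ∀ k ≥ K, ENNReal.ofReal (4 * 20000 / 2 ^ k) ≤ ε k)
    (hε : ∀ k ≥ K, ∀ l ≥ k, ε l ≤ ε k) (n : ℕ) :
    ∀ k ≥ K, ∀ j, ∀ ψ : ℂ → ℂ,
      Univalent ψ (Metric.ball (dyadicCenter k j) (29 / 20 * 2 ^ k)) →
      volume (ψ '' (dyadicSquare k j \ Complex.exp ⁻¹' growingSet f n)) ≤
        failureBound ε n k * volume (ψ '' dyadicSquare k j) := by
  have hc := hf.differentiable.continuous
  induction n with
  | zero => intro k _ j ψ _; simp [growingSet]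
  | succ n ih =>
    intro k hk j ψ hψ
    have h2k : (0 : ℝ) < 2 ^ k := by positivity
    have hXK : ∀ l ≥ K, 40 * |ρ| ≤ 2 ^ l := fun l hl =>
      hρ.trans (pow_le_pow_right₀ one_le_two hl)
    have hX : (40000 : ℝ) ≤ 2 ^ k :=
      le_trans (by norm_num) (pow_le_pow_right₀ (one_le_two (α := ℝ)) (hK.trans hk))
    have hgk : K ≤ levelStep k := by
      have := two_mul_le_levelStep (hK.trans hk); omega
    set Q := dyadicSquare k j with hQ
    have hQm : MeasurableSet Q := measurableSet_dyadicSquare k j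
    set A := (Q ∩ {z | ‖f (Complex.exp z)‖ ≤ Real.exp (2 ^ levelStep k)}) ∪
      (Q \ dyadicInner k j 20000) with hA
    have hAm : MeasurableSet A := by
      refine (hQm.inter (IsClosed.measurableSet ?_)).union
        (hQm.diff (measurableSet_dyadicInner _ _ _))
      exact isClosed_le (by fun_prop) continuous_const
    have hAQ : A ⊆ Q := Set.union_subset Set.inter_subset_left Set.sdiff_subset
    have hAvol : volume A ≤ 2 * ε k * volume Q := by
      refine (measure_union_le _ _).trans ?_
      rw [two_mul, add_mul]
      refine add_le_add (hlow k hk j) ?_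
      refine (volume_dyadicSquare_diff_inner_le j (by norm_num) (by linarith)).trans ?_
      gcongr
      exact hlayer k hk
    have hψA := hψ.volume_image_le (by positivity) hAm hQm hAQ
      ((dyadicSquare_subset_closedBall k j).trans
        (Metric.closedBall_subset_closedBall (by linarith))) hAvol
    set 𝒯 := {T | ∃ Φ, IsLogLift f ρ Φ ∧ Φ '' rightHalfPlane ρ = T} with h𝒯
    have : Countable 𝒯 := hf.countable_images_lift.to_subtype
    choose Φ hΦ hΦT using fun T : 𝒯 => T.2
    set I : Set (𝒯 × ℕ × ℤ) :=
      {i | levelStep k ≤ i.2.1 ∧ Φ i.1 '' dyadicSquare i.2.1 i.2.2 ⊆ Q} with hI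
    have hIK : ∀ i : I, K ≤ i.1.2.1 := fun i => hgk.trans i.2.1
    have hSH : ∀ i : I, dyadicSquare i.1.2.1 i.1.2.2 ⊆ rightHalfPlane ρ := fun i =>
      (dyadicSquare_subset_ball _ _).trans
        (ball_dyadicCenter_subset_rightHalfPlane (hXK _ (hIK i)))
    have hcover : Q \ Complex.exp ⁻¹' growingSet f (n + 1) ⊆
        A ∪ ⋃ i : I, Φ i.1.1 '' (dyadicSquare i.1.2.1 i.1.2.2 \
          Complex.exp ⁻¹' growingSet f n) := by
      rintro z ⟨hzQ, hzn⟩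
      by_cases hzA : z ∈ A
      · exact Or.inl hzA
      refine Or.inr ?_
      have hzlow : Real.exp (2 ^ levelStep k) < ‖f (Complex.exp z)‖ := by
        by_contra! h
        exact hzA (Or.inl ⟨hzQ, h⟩)
      have hzin : z ∈ dyadicInner k j 20000 := by
        by_contra h
        exact hzA (Or.inr ⟨hzQ, h⟩)
      have hzG : f (Complex.exp z) ∉ growingSet f n := by
        intro h
        refine hzn ⟨⟨k, ?_, ?_, hzlow⟩, h⟩
        · rw [Complex.norm_exp]; exact Real.exp_le_exp.2 (mem_dyadicSquare.1 hzQ).1.1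
        · rw [Complex.norm_exp]; exact Real.exp_lt_exp.2 (mem_dyadicSquare.1 hzQ).1.2
      have hρg : ρ ≤ 2 ^ levelStep k := by
        linarith [le_abs_self ρ, abs_nonneg ρ, hXK _ hgk]
      obtain ⟨Φ₀, hΦ₀, hz₀⟩ := hf.exists_lift ((Real.exp_le_exp.2 hρg).trans_lt hzlow)
      have hT : Φ₀ '' rightHalfPlane ρ ∈ 𝒯 := ⟨Φ₀, hΦ₀, rfl⟩
      set T : 𝒯 := ⟨_, hT⟩
      have hzT : z ∈ Φ T '' rightHalfPlane ρ := by rw [hΦT T]; exact hz₀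
      obtain ⟨ζ, hζ, rfl⟩ := hzT
      rw [(hΦ T).2 ζ hζ] at hzlow hzG
      rw [Complex.norm_exp, Real.exp_lt_exp] at hzlow
      obtain ⟨k', j', hζQ⟩ := exists_mem_dyadicSquare (z := ζ)
        ((one_le_pow₀ one_le_two).trans hzlow.le)
      have hkk' : levelStep k ≤ k' := by
        have := (pow_lt_pow_iff_right₀ (one_lt_two (α := ℝ))).1
          (hzlow.trans (mem_dyadicSquare.1 hζQ).1.2)
        omega
      refine Set.mem_iUnion.2 ⟨⟨(T, k', j'), hkk', ?_⟩, ζ, ⟨hζQ, hzG⟩, rfl⟩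
      rintro _ ⟨ξ, hξ, rfl⟩
      exact mem_dyadicSquare_of_dist_lt hzin (hf.norm_lift_sub_lt (hΦ T)
        (hXK _ (hgk.trans hkk')) (dyadicSquare_subset_ball _ _ hξ)
        (dyadicSquare_subset_ball _ _ hζQ))
    have hpiece : ∀ i : I, volume (ψ '' (Φ i.1.1 '' (dyadicSquare i.1.2.1 i.1.2.2 \
          Complex.exp ⁻¹' growingSet f n))) ≤
        failureBound ε n (levelStep k) *
          volume (ψ '' (Φ i.1.1 '' dyadicSquare i.1.2.1 i.1.2.2)) := by
      intro i
      have hmaps : Set.MapsTo (Φ i.1.1)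
          (Metric.ball (dyadicCenter i.1.2.1 i.1.2.2) (29 / 20 * 2 ^ i.1.2.1))
          (Metric.ball (dyadicCenter k j) (29 / 20 * 2 ^ k)) := by
        intro ζ hζ
        have h1 := hf.norm_lift_sub_lt (hΦ i.1.1) (hXK _ (hIK i)) hζ
          (dyadicSquare_subset_ball _ _ (dyadicCenter_mem i.1.2.1 i.1.2.2))
        have h2 := dyadicSquare_subset_closedBall k j
          (i.2.2 ⟨_, dyadicCenter_mem i.1.2.1 i.1.2.2, rfl⟩)
        rw [← dist_eq_norm] at h1
        rw [Metric.mem_closedBall] at h2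
        rw [Metric.mem_ball]
        have := dist_triangle (Φ i.1.1 ζ) (Φ i.1.1 (dyadicCenter i.1.2.1 i.1.2.2))
          (dyadicCenter k j)
        linarith
      have huniv := hψ.comp ((hf.univalent_lift (hΦ i.1.1)).mono
        (ball_dyadicCenter_subset_rightHalfPlane (hXK _ (hIK i)))) Metric.isOpen_ball
        Metric.isOpen_ball hmaps
      have h := ih i.1.2.1 (hIK i) i.1.2.2 _ huniv
      rw [Set.image_comp, Set.image_comp] at h
      refine h.trans ?_
      gcongr
      exact failureBound_anti hK hε n hgk i.2.1
    have hQball : Q ⊆ Metric.ball (dyadicCenter k j) (29 / 20 * 2 ^ k) :=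
      dyadicSquare_subset_ball k j
    have hPm : ∀ i : I, MeasurableSet (Φ i.1.1 '' dyadicSquare i.1.2.1 i.1.2.2) := fun i =>
      (measurableSet_dyadicSquare _ _).image_of_continuousOn_injOn
        ((hΦ i.1.1).1.continuousOn.mono (hSH i))
        ((hf.univalent_lift (hΦ i.1.1)).2.1.mono (hSH i))
    have hdisj : Pairwise (Function.onFun Disjoint
        fun i : I => Φ i.1.1 '' dyadicSquare i.1.2.1 i.1.2.2) := by
      rintro ⟨⟨T, k₁, j₁⟩, hi⟩ ⟨⟨T', k₂, j₂⟩, hi'⟩ hne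
      refine Set.disjoint_left.2 ?_
      rintro _ ⟨ζ, hζ, rfl⟩ ⟨ξ, hξ, he⟩
      have hζH := hSH ⟨(T, k₁, j₁), hi⟩ hζ
      have hξH := hSH ⟨(T', k₂, j₂), hi'⟩ hξ
      have hTT : T = T' := by
        refine Subtype.ext ?_
        rw [← hΦT T, ← hΦT T']
        exact hf.image_lift_eq (hΦ T) (hΦ T')
          (Set.not_disjoint_iff.2 ⟨_, ⟨ζ, hζH, rfl⟩, ξ, hξH, he⟩)
      subst hTT
      obtain rfl := (hf.univalent_lift (hΦ T)).2.1 hξH hζH he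
      obtain ⟨rfl, rfl⟩ := pairwise_disjoint_dyadicSquare hζ hξ
      exact hne rfl
    have hsum : ∑' i : I, volume (ψ '' (Φ i.1.1 '' dyadicSquare i.1.2.1 i.1.2.2)) ≤
        volume (ψ '' Q) := by
      rw [← measure_iUnion]
      · refine measure_mono (Set.iUnion_subset fun i => Set.image_mono i.2.2)
      · intro i i' hne
        exact (hdisj hne).image hψ.2.1 (i.2.2.trans hQball) (i'.2.2.trans hQball)
      · intro i
        exact (hPm i).image_of_continuousOn_injOn
          (hψ.1.continuousOn.mono (i.2.2.trans hQball)) (hψ.2.1.mono (i.2.2.trans hQball))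
    calc volume (ψ '' (Q \ Complex.exp ⁻¹' growingSet f (n + 1)))
        ≤ volume (ψ '' A ∪ ⋃ i : I, ψ '' (Φ i.1.1 '' (dyadicSquare i.1.2.1 i.1.2.2 \
          Complex.exp ⁻¹' growingSet f n))) := by
          refine measure_mono ((Set.image_mono hcover).trans ?_)
          rw [Set.image_union, Set.image_iUnion]
      _ ≤ volume (ψ '' A) + ∑' i : I, volume (ψ '' (Φ i.1.1 '' (dyadicSquare i.1.2.1 i.1.2.2 \
          Complex.exp ⁻¹' growingSet f n))) :=
          (measure_union_le _ _).trans (by gcongr; exact measure_iUnion_le _)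
      _ ≤ areaDistortion * (2 * ε k) * volume (ψ '' Q) +
          ∑' i : I, failureBound ε n (levelStep k) *
            volume (ψ '' (Φ i.1.1 '' dyadicSquare i.1.2.1 i.1.2.2)) :=
          add_le_add hψA (ENNReal.tsum_le_tsum hpiece)
      _ ≤ areaDistortion * (2 * ε k) * volume (ψ '' Q) +
          failureBound ε n (levelStep k) * volume (ψ '' Q) := by
          rw [ENNReal.tsum_mul_left]; gcongr
      _ = failureBound ε (n + 1) k * volume (ψ '' Q) := by rw [failureBound_succ, add_mul]

theorem failureBound_ofReal_div_le {u : ℕ → ℝ} {C η : ℝ} {K k n : ℕ} (hC : 0 ≤ C) (hK : 30 ≤ K)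
    (hk : K ≤ k) (hu : ∀ l ≥ K, 0 < u l)
    (h : ∑ i ∈ Finset.range n, Real.exp 36 ^ 4 * 2 * C / u (levelStep^[i] k) ≤ η) :
    failureBound (fun l => ENNReal.ofReal (C / u l)) n k ≤ ENNReal.ofReal η := by
  have hpos : ∀ i, 0 < u (levelStep^[i] k) := fun i =>
    hu _ (hk.trans (le_iterate_levelStep (hK.trans hk) i))
  refine le_trans (le_of_eq ?_) (ENNReal.ofReal_le_ofReal h)
  rw [ENNReal.ofReal_sum_of_nonneg fun i _ => by have := hpos i; positivity]
  refine Finset.sum_congr rfl fun i _ => ?_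
  rw [areaDistortion, ← ENNReal.ofReal_pow (Real.exp_pos _).le, ← ENNReal.ofReal_ofNat 2,
    ← ENNReal.ofReal_mul zero_le_two, ← ENNReal.ofReal_mul (by positivity)]
  congr 1
  ring

theorem volume_escapingSet_pos_of_volume_diff_le {f : ℂ → ℂ} (hf : Continuous f) {k : ℕ} {j : ℤ}
    (hk : 30 ≤ k) {c : ENNReal} (hc : c < 1)
    (h : ∀ n, volume (dyadicSquare k j \ Complex.exp ⁻¹' growingSet f n) ≤
      c * volume (dyadicSquare k j)) :
    0 < volume (escapingSet f) := by
  set Q := dyadicSquare k j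
  have hQm : MeasurableSet Q := measurableSet_dyadicSquare k j
  have hQpos : volume Q ≠ 0 := by
    rw [volume_dyadicSquare]; simp
  have hQfin : volume Q ≠ ⊤ := by
    rw [volume_dyadicSquare]; exact ENNReal.ofReal_ne_top
  have hGm : MeasurableSet (Complex.exp ⁻¹' ⋂ n, growingSet f n) :=
    Complex.measurable_exp (MeasurableSet.iInter (measurableSet_growingSet hf))
  have hfail : volume (Q \ Complex.exp ⁻¹' ⋂ n, growingSet f n) ≤ c * volume Q := by
    rw [Set.preimage_iInter, Set.sdiff_iInter, Monotone.measure_iUnion]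
    · exact iSup_le h
    · exact monotone_nat_of_le_succ fun n =>
        Set.sdiff_subset_sdiff_right (Set.preimage_mono (growingSet_succ_subset n))
  refine volume_pos_of_volume_exp_preimage_pos (hQm.inter hGm) ?_ ?_
  · refine pos_iff_ne_zero.2 fun h0 => ?_
    have hsum := measure_inter_add_sdiff (μ := volume) Q hGm
    rw [h0, zero_add] at hsum
    have hlt : c * volume Q < 1 * volume Q := by
      exact (ENNReal.mul_lt_mul_iff_left hQpos hQfin).2 hc
    rw [one_mul] at hlt
    exact (hfail.trans_lt hlt).ne hsum
  · rintro z ⟨hzQ, hzG⟩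
    refine mem_escapingSet_of_forall_mem_growingSet (Set.mem_iInter.1 hzG) ?_
    rw [Complex.norm_exp]
    exact Real.exp_le_exp.2 ((pow_le_pow_right₀ one_le_two hk).trans (mem_dyadicSquare.1 hzQ).1.1)

theorem escaping_set_positive_measure_iterated_log
    (f : ℂ → ℂ) (hf : InClassB f)
    (N m : ℕ) (R : ℝ) (hR : 0 < R)
    (hN : (componentsAR f R).ncard = N)
    (hgrowth : ∀ᶠ r in atTop,
      Real.log (Real.log (maxModulus f r)) ≤
        ((N : ℝ) / 2 + 1 / Real.log^[m] r) * Real.log r) :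
    0 < volume (escapingSet f) := by
  obtain ⟨ρ, hρ, hRρ, hlog⟩ := hf.exists_isLogarithmicAbove R
  obtain ⟨x₀, hx₀⟩ := Real.exists_iterate_log_pos_le m
  have hlow := hlog.eventually_volume_low_le hρ hR hRρ hN hgrowth
  have hle := tendsto_natCast_atTop_atTop.eventually (Real.eventually_iterate_log_le m)
  have hx := tendsto_natCast_atTop_atTop.eventually (eventually_ge_atTop x₀)
  have hpow := (tendsto_pow_atTop_atTop_of_one_lt (one_lt_two (α := ℝ))).eventually
    (eventually_ge_atTop (40 * |ρ|))
  obtain ⟨K, hK⟩ := eventually_atTop.1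
    (hlow.and (hle.and (hx.and (hpow.and (eventually_ge_atTop 30)))))
  have hpos : ∀ k ≥ K, 0 < Real.log^[m] k := fun k hk => (hx₀ k k (hK k hk).2.2.1 le_rfl).1
  have hK30 : 30 ≤ K := (hK K le_rfl).2.2.2.2
  obtain ⟨k, hk, hsum⟩ := exists_forall_sum_div_iterate_log_le m K
    (C := Real.exp 36 ^ 4 * 2 * 80000) (η := 1 / 2) (by positivity) (by norm_num)
  refine volume_escapingSet_pos_of_volume_diff_le (j := 0) hlog.differentiable.continuous
    (hK30.trans hk) (c := ENNReal.ofReal (1 / 2)) (by simp) fun n => ?_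
  have hfail := hlog.volume_image_diff_growingSet_le
    (ε := fun l : ℕ => ENNReal.ofReal (80000 / Real.log^[m] l)) hK30 (hK K le_rfl).2.2.2.1
    (fun l hl j => ((hK l hl).1 j).trans ?_) (fun l hl => ?_) (fun l hl l' hl' => ?_) n k hk 0 id
    ⟨differentiableOn_id, Set.injOn_id _, fun z _ => by simp⟩
  · rw [Set.image_id, Set.image_id] at hfail
    refine hfail.trans ?_
    gcongr
    exact failureBound_ofReal_div_le (by norm_num) hK30 hk hpos (hsum n)
  · have := hpos l hl
    gcongr
    norm_num
  · have h1 := hpos l hl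
    have h2 : Real.log^[m] l ≤ 2 ^ l := (hK l hl).2.1.trans (by
      exact_mod_cast Nat.lt_two_pow_self.le)
    refine ENNReal.ofReal_le_ofReal ?_
    norm_num
    gcongr
  · have h1 := hpos l hl
    have h2 := (hx₀ l l' (hK l hl).2.2.1 (by exact_mod_cast hl')).2
    refine ENNReal.ofReal_le_ofReal ?_
    gcongr
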